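/- For every positive integer k, M(1,...,1,2) with k ones equals 3k - 1 if k ≤ 6, and equals ⌊k²/4⌋ + k + 2 if k > 6. -/

import Mathlib

/-- A finite directed multigraph. -/
structure MultiDigraph where
  V : Type
  E : Type
  fintV : Fintype V
  fintE : Fintype E
  src : E → V
  dst : E → V

namespace MultiDigraph

/-- `p` is a (nonempty) directed path from `u` to `v`, given as its list of edges. -/
def IsPathFrom (G : MultiDigraph) (u v : G.V) (p : List G.E) : Prop :=
  p ≠ [] ∧ List.Chain' (fun e f => G.dst e = G.src f) p ∧
    (∀ e ∈ p.head?, G.src e = u) ∧ ∀ e ∈ p.getLast?, G.dst e = v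

/-- `G` is acyclic: there is no (nonempty) directed path from a vertex to itself. -/
def Acyclic (G : MultiDigraph) : Prop :=
  ∀ (v : G.V) (p : List G.E), ¬ G.IsPathFrom v v p

/-- `α` is a family of `c` pairwise edge-disjoint directed paths from `u` to `v`. -/
def MengerSystem (G : MultiDigraph) (u v : G.V) (c : ℕ) (α : Fin c → List G.E) : Prop :=
  (∀ i, G.IsPathFrom u v (α i)) ∧ ∀ i j, i ≠ j → ∀ e, e ∈ α i → e ∉ α j

/-- The min-cut between `u` and `v` equals `c`: by Menger's theorem, this means the
maximum number of pairwise edge-disjoint directed paths from `u` to `v` is exactly `c`. -/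
def MinCut (G : MultiDigraph) (u v : G.V) (c : ℕ) : Prop :=
  (∃ α : Fin c → List G.E, G.MengerSystem u v c α) ∧
    ¬∃ α : Fin (c + 1) → List G.E, G.MengerSystem u v (c + 1) α

/-- Edge `e` is the starting edge of a merging among paths from (at least) two different
groups: `e` lies on a path of group `i` and on a path of group `j ≠ i`, and there are two
distinct edges immediately ahead of `e` on these two paths.  Mergings are counted without
multiplicity: one merging per such edge `e`. -/
def MergingEdge (G : MultiDigraph) {l : ℕ} {c : Fin l → ℕ}
    (α : (i : Fin l) → Fin (c i) → List G.E) (e : G.E) : Prop :=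
  ∃ i j : Fin l, i ≠ j ∧ ∃ (a : Fin (c i)) (b : Fin (c j)) (f g : G.E),
    f ≠ g ∧ [f, e] <:+: α i a ∧ [g, e] <:+: α j b

/-- The number of mergings among paths from different groups, `|G|_M(α₁,…,α_l)`. -/
noncomputable def mergingCount (G : MultiDigraph) {l : ℕ} {c : Fin l → ℕ}
    (α : (i : Fin l) → Fin (c i) → List G.E) : ℕ :=
  Set.ncard {e : G.E | G.MergingEdge α e}

end MultiDigraph

open MultiDigraph

/-- `G` is a finite acyclic directed multigraph with designated sources `S i`, pairwise
distinct sinks `R i`, and min-cut `c i` between `S i` and `R i`. -/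
def GoodConfig {l : ℕ} (G : MultiDigraph) (S R : Fin l → G.V) (c : Fin l → ℕ) : Prop :=
  G.Acyclic ∧ Function.Injective R ∧ ∀ i, G.MinCut (S i) (R i) (c i)

/-- `M(c₁,…,c_l) ≤ B`: in every acyclic graph with distinct sources, distinct sinks and
the given min-cuts, some choice of Menger path systems yields at most `B` mergings. -/
def MAtMost {l : ℕ} (c : Fin l → ℕ) (B : ℕ) : Prop :=
  ∀ (G : MultiDigraph) (S R : Fin l → G.V), GoodConfig G S R c → Function.Injective S →
    ∃ α : (i : Fin l) → Fin (c i) → List G.E,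
      (∀ i, G.MengerSystem (S i) (R i) (c i) (α i)) ∧ G.mergingCount α ≤ B

/-- `M(c₁,…,c_l) ≥ B`: some acyclic graph with distinct sources, distinct sinks and the
given min-cuts yields at least `B` mergings for every choice of Menger path systems. -/
def MAtLeast {l : ℕ} (c : Fin l → ℕ) (B : ℕ) : Prop :=
  ∃ (G : MultiDigraph) (S R : Fin l → G.V), GoodConfig G S R c ∧ Function.Injective S ∧
    ∀ α : (i : Fin l) → Fin (c i) → List G.E,
      (∀ i, G.MengerSystem (S i) (R i) (c i) (α i)) → B ≤ G.mergingCount α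

/-- `M(c₁,…,c_l) = B`: the largest possible value, over all acyclic graphs with distinct
sources and distinct sinks realizing the min-cuts `c`, of the minimum number of mergings
over all choices of Menger path systems, equals `B`. -/
def MEq {l : ℕ} (c : Fin l → ℕ) (B : ℕ) : Prop := MAtMost c B ∧ MAtLeast c B

/-- `M*(c₁,…,c_l) ≤ B`: as `MAtMost`, but with all sources identical. -/
def MstarAtMost {l : ℕ} (c : Fin l → ℕ) (B : ℕ) : Prop :=
  ∀ (G : MultiDigraph) (S R : Fin l → G.V), GoodConfig G S R c → (∀ i j, S i = S j) →
    ∃ α : (i : Fin l) → Fin (c i) → List G.E,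
      (∀ i, G.MengerSystem (S i) (R i) (c i) (α i)) ∧ G.mergingCount α ≤ B

/-- `M*(c₁,…,c_l) ≥ B`: as `MAtLeast`, but with all sources identical. -/
def MstarAtLeast {l : ℕ} (c : Fin l → ℕ) (B : ℕ) : Prop :=
  ∃ (G : MultiDigraph) (S R : Fin l → G.V), GoodConfig G S R c ∧ (∀ i j, S i = S j) ∧
    ∀ α : (i : Fin l) → Fin (c i) → List G.E,
      (∀ i, G.MengerSystem (S i) (R i) (c i) (α i)) → B ≤ G.mergingCount α

/-- `M*(c₁,…,c_l) = B`: as `MEq`, but with all sources identical. -/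
def MstarEq {l : ℕ} (c : Fin l → ℕ) (B : ℕ) : Prop := MstarAtMost c B ∧ MstarAtLeast c B


structure Cfg (X : Type) [PartialOrder X] (I : Type) where
  R : I → X → Prop
  t : I → X
  ps : Bool → X → Prop
  has : Bool → I → Prop
  c : Bool → I → X
  z : Bool → I → X
  ga : Bool → I → X
  A : Bool → I → X → Prop
  adj : I → I → Prop
  u : I → I → X
  R_up : ∀ {i x y}, R i x → x ≤ y → R i y
  chain : ∀ {σ x y}, ps σ x → ps σ y → x ≤ y ∨ y ≤ x
  disj : ∀ {σ τ x y}, σ ≠ τ → ps σ x → ps τ y → x ≠ y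
  c_ps : ∀ {σ i}, has σ i → ps σ (c σ i)
  z_ps : ∀ {σ τ i}, σ ≠ τ → has σ i → ps τ (z σ i)
  ga_lt : ∀ {σ i}, has σ i → ga σ i < c σ i
  R_c : ∀ {σ i}, has σ i → R i (c σ i)
  c_t : ∀ {σ i}, has σ i → c σ i ≤ t i
  min_c : ∀ {σ i x}, has σ i → ps σ x → R i x → c σ i ≤ x
  R_ga : ∀ {σ i}, has σ i → ¬ R i (ga σ i)
  A_lt : ∀ {σ i x}, has σ i → ps σ x → (A σ i x ↔ x < c σ i)
  A_z : ∀ {σ τ i x}, σ ≠ τ → has σ i → ps τ x → (A σ i x ↔ x < z σ i)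
  c1 : ∀ {σ i y}, has σ i → R i y → y < c σ i → A σ i y → y ≤ z σ i ∧ z σ i < c σ i
  c2 : ∀ {σ i x y}, has σ i → A σ i x → x ≤ y → ¬ A σ i y →
    (x ≤ z σ i ∧ z σ i ≤ y) ∨ (x ≤ ga σ i ∧ c σ i ≤ y)
  byp_c : ∀ {σ τ i x y}, σ ≠ τ → has σ i → ps τ x → ps τ y → x ≤ y → R i x → y ≤ t i →
    c σ i < x ∨ y < c σ i
  cmp_c : ∀ {σ i x}, has σ i → R i x → x ≤ t i → x ≤ c σ i ∨ c σ i ≤ x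
  c_inj : ∀ {σ τ i j}, has σ i → has τ j → c σ i = c τ j → i = j
  adj_symm : ∀ {i j}, adj i j → adj j i
  adj_irr : ∀ {i}, ¬ adj i i
  u_symm : ∀ i j, u i j = u j i
  R_u : ∀ {i j}, adj i j → R i (u i j)
  u_t : ∀ {i j}, adj i j → u i j ≤ t i
  e1 : ∀ {i j x}, adj i j → R i x → R j x → ¬ x < u i j
  cmp_u : ∀ {i j x}, adj i j → R i x → x ≤ t i → x ≤ u i j ∨ u i j ≤ x
  byp_u : ∀ {τ i j x y}, adj i j → ps τ x → ps τ y → x ≤ y → R i x → y ≤ t i →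
    ¬ ps τ (u i j) → u i j < x ∨ y < u i j
  u_ne : ∀ {i j k σ}, adj i j → has σ k → u i j ≠ c σ k
  u_inj : ∀ {i i' j}, adj i j → adj i' j → i ≠ i' → u i j ≠ u i' j
  flexA : ∀ {σ τ i j}, σ ≠ τ → has σ i → has τ i → adj i j → c τ i < c σ i →
    u i j ≤ z σ i → z σ i < c σ i → ¬ c τ i < u i j
  flexB : ∀ {σ τ i j}, σ ≠ τ → has σ i → has τ i → has σ j → adj i j → c σ i < c τ i →
    c τ i < u i j → u i j = z σ j → ¬ c σ i < c σ j

namespace Cfg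
variable {X : Type} [PartialOrder X] {I : Type} (C : Cfg X I) {σ τ : Bool} {i j i' j' : I}

theorem R_u' (h : C.adj i j) : C.R j (C.u i j) := C.u_symm i j ▸ C.R_u (C.adj_symm h)
theorem u_t' (h : C.adj i j) : C.u i j ≤ C.t j := C.u_symm i j ▸ C.u_t (C.adj_symm h)
theorem cmp_u' {x} (h : C.adj i j) (h1 : C.R j x) (h2 : x ≤ C.t j) :
    x ≤ C.u i j ∨ C.u i j ≤ x := C.u_symm i j ▸ C.cmp_u (C.adj_symm h) h1 h2
theorem byp_u' {x y} (h : C.adj i j) (h1 : C.ps τ x) (h2 : C.ps τ y) (h3 : x ≤ y)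
    (h4 : C.R j x) (h5 : y ≤ C.t j) (h6 : ¬ C.ps τ (C.u i j)) : C.u i j < x ∨ y < C.u i j := by
  rw [C.u_symm] at h6 ⊢; exact C.byp_u (C.adj_symm h) h1 h2 h3 h4 h5 h6
theorem cc (h : C.has σ i) (h' : C.has σ j) (hn : i ≠ j) :
    C.c σ i < C.c σ j ∨ C.c σ j < C.c σ i := by
  have h1 := C.chain (C.c_ps h) (C.c_ps h')
  have h2 : C.c σ i ≠ C.c σ j := fun e => hn (C.c_inj h h' e)
  rcases h1 with h1 | h1
  · exact Or.inl (lt_of_le_of_ne h1 h2)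
  · exact Or.inr (lt_of_le_of_ne h1 h2.symm)
theorem ct (hs : σ ≠ τ) (h : C.has σ i) (h' : C.has τ i) :
    C.c σ i < C.c τ i ∨ C.c τ i < C.c σ i := by
  have h1 := C.cmp_c h (C.R_c h') (C.c_t h')
  have h2 : C.c σ i ≠ C.c τ i := C.disj hs (C.c_ps h) (C.c_ps h')
  rcases h1 with h1 | h1
  · exact Or.inr (lt_of_le_of_ne h1 h2.symm)
  · exact Or.inl (lt_of_le_of_ne h1 h2)

theorem L0 (h : C.has σ i) (h' : C.has σ j) (ha : C.adj i j) (hl : C.c σ i < C.c σ j) :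
    C.c σ i < C.u i j ∧ C.u i j < C.c σ j := by
  have hne1 := C.u_ne ha h
  have hne2 := C.u_ne ha h'
  constructor
  · rcases C.cmp_u ha (C.R_c h) (C.c_t h) with h1 | h1
    · exact lt_of_le_of_ne h1 hne1.symm
    · have := C.min_c h' (C.c_ps h) (C.R_up (C.R_u' ha) h1)
      order
  · rcases C.cmp_u' ha (C.R_c h') (C.c_t h') with h1 | h1
    · exact absurd (lt_of_le_of_ne h1 hne2.symm) (C.e1 ha (C.R_up (C.R_c h) hl.le) (C.R_c h'))
    · exact lt_of_le_of_ne h1 hne2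

theorem L0' (h : C.has σ i) (h' : C.has σ j) (ha : C.adj i j) (hl : C.c σ j < C.c σ i) :
    C.c σ j < C.u i j ∧ C.u i j < C.c σ i := by
  rw [C.u_symm]; exact C.L0 h' h (C.adj_symm ha) hl

theorem uu (h : C.adj i j) (h' : C.adj i' j) (hn : i ≠ i') :
    C.u i j < C.u i' j ∨ C.u i' j < C.u i j := by
  have := C.u_inj h h' hn
  rcases C.cmp_u' h (C.R_u' h') (C.u_t' h') with h1 | h1
  · exact Or.inr (lt_of_le_of_ne h1 this.symm)
  · exact Or.inl (lt_of_le_of_ne h1 this)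

theorem tok {x : X} (h : C.adj i j) (h' : C.adj i' j) (hn : i ≠ i') (h1 : C.R i x)
    (h2 : C.R i' x) (h3 : x ≤ C.u i j) (h4 : x ≤ C.u i' j) : False := by
  rcases C.uu h h' hn with h5 | h5
  · exact C.e1 h' (C.R_up h2 h3) (C.R_u' h) h5
  · exact C.e1 h (C.R_up h1 h4) (C.R_u' h') h5

/-- K1 -/
theorem K1 (hs : σ ≠ τ) (h : C.has σ i) (h' : C.has τ i) (hj : C.has σ j) (ha : C.adj i j)
    (hl : C.c σ i < C.c σ j) (hA : ¬ C.A σ j (C.u i j)) :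
    C.c σ i < C.c τ i ∧ C.R i (C.z σ j) ∧ C.c τ i ≤ C.z σ j ∧ C.z σ j ≤ C.u i j := by
  obtain ⟨h1, h2⟩ := C.L0 h hj ha hl
  rcases C.c2 hj ((C.A_lt hj (C.c_ps h)).2 hl) h1.le hA with ⟨h3, h4⟩ | ⟨h3, h4⟩
  · have h5 := C.R_up (C.R_c h) h3
    have h6 := C.min_c h' (C.z_ps hs hj) h5
    refine ⟨?_, h5, h6, h4⟩
    rcases C.byp_c hs h (C.c_ps h') (C.z_ps hs hj) h6 (C.R_c h') (h4.trans (C.u_t ha)) with h7 | h7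
    · exact h7
    · order
  · order

theorem K2 (hs : σ ≠ τ) (h : C.has σ i) (h' : C.has τ i) (hj : C.has σ j) (ha : C.adj i j)
    (hl : C.c σ i < C.c σ j) (hA : C.A σ j (C.u i j)) :
    C.u i j ≤ C.z σ j ∧ C.z σ j < C.c σ j ∧ C.c τ i ≤ C.z σ j := by
  obtain ⟨h1, h2⟩ := C.L0 h hj ha hl
  obtain ⟨h3, h4⟩ := C.c1 hj (C.R_u' ha) h2 hA
  exact ⟨h3, h4, C.min_c h' (C.z_ps hs hj) (C.R_up (C.R_u ha) h3)⟩

theorem K3 (hs : σ ≠ τ) (h : C.has σ i) (h' : C.has τ i) (hj : C.has σ j) (ha : C.adj i j)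
    (hl : C.c σ j < C.c σ i) (hA : C.A σ i (C.u i j)) :
    C.u i j < C.c τ i ∧ C.c τ i ≤ C.z σ i ∧ C.z σ i < C.c σ i := by
  obtain ⟨h1, h2⟩ := C.L0' h hj ha hl
  obtain ⟨h3, h4⟩ := C.c1 h (C.R_u ha) h2 hA
  have h5 := C.min_c h' (C.z_ps hs h) (C.R_up (C.R_u ha) h3)
  refine ⟨?_, h5, h4⟩
  have h6 := C.flexA hs h h' ha (by order) h3 h4
  have h7 := C.u_ne ha h'
  rcases C.cmp_u ha (C.R_c h') (C.c_t h') with h8 | h8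
  · exact absurd (lt_of_le_of_ne h8 h7.symm) h6
  · exact lt_of_le_of_ne h8 h7

theorem K4 (hs : σ ≠ τ) (h : C.has σ i) (h' : C.has τ i) (hj : C.has σ j) (ha : C.adj i j)
    (hl : C.c σ j < C.c σ i) (hA : ¬ C.A σ i (C.u i j)) :
    C.c σ j ≤ C.z σ i ∧ C.z σ i ≤ C.u i j ∧ C.c σ i < C.c τ i := by
  obtain ⟨h1, h2⟩ := C.L0' h hj ha hl
  rcases C.c2 h ((C.A_lt h (C.c_ps hj)).2 hl) h1.le hA with ⟨h3, h4⟩ | ⟨h3, h4⟩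
  swap
  · order
  refine ⟨h3, h4, ?_⟩
  rcases C.ct hs h h' with h5 | h5
  · exact h5
  exfalso
  have hRz := C.R_up (C.R_c hj) h3
  have hne := C.u_ne ha h'
  have key : ¬ C.c τ i < C.u i j := by
    intro h6
    rcases C.chain (C.c_ps h') (C.z_ps hs h) with h7 | h7
    · have h8 := C.e1 ha (C.R_up (C.R_c h') h7) hRz
      have h9 : C.z σ i = C.u i j := by order
      exact C.flexA hs h h' ha h5 h9.ge (by order) h6
    · exact C.e1 ha (C.R_c h') (C.R_up hRz h7) h6
  have h6 : C.u i j < C.c τ i := by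
    rcases C.cmp_u ha (C.R_c h') (C.c_t h') with h8 | h8
    · exact absurd (lt_of_le_of_ne h8 hne.symm) key
    · exact lt_of_le_of_ne h8 hne
  have hw := C.z_ps hs.symm h'
  by_cases hB : C.A τ i (C.u i j)
  · obtain ⟨h7, h8⟩ := C.c1 h' (C.R_u ha) h6 hB
    have := C.min_c h hw (C.R_up (C.R_u ha) h7)
    order
  · rcases C.c2 h' ((C.A_lt h' (C.z_ps hs h)).2 (by order)) h4 hB with ⟨h7, h8⟩ | ⟨h7, h8⟩
    · rcases C.c2 h ((C.A_lt h hw).2 (by order)) h8 hA with ⟨h9, h10⟩ | ⟨h9, h10⟩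
      · exact C.disj hs hw (C.z_ps hs h) (by order)
      · order
    · order

theorem FF (hs : σ ≠ τ) (hi : C.has σ i) (hi' : C.has τ i) (hj : C.has σ j) (hj' : C.has τ j)
    (ha : C.adj i j) (hl : C.c σ i < C.c σ j) : C.c τ i < C.c τ j := by
  have hn : i ≠ j := fun e => C.adj_irr (e ▸ ha)
  rcases C.cc hi' hj' hn with h | h
  · exact h
  exfalso
  obtain ⟨h1, h2⟩ := C.L0 hi hj ha hl
  obtain ⟨h3, h4⟩ := C.L0' hi' hj' ha h
  by_cases hA : C.A σ j (C.u i j)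
  · obtain ⟨h5, h6, h7⟩ := C.K2 hs hi hi' hj ha hl hA
    have h8 : ¬ C.ps τ (C.u i j) := fun hp => by
      have := C.min_c hi' hp (C.R_u ha); order
    rcases C.byp_u' ha (C.c_ps hj') (C.z_ps hs hj) (by order) (C.R_c hj')
      (h6.le.trans (C.c_t hj)) h8 with h9 | h9 <;> order
  · obtain ⟨h5, h6, h7, h8⟩ := C.K1 hs hi hi' hj ha hl hA
    order

theorem FFtype (hs : σ ≠ τ) (hi : C.has σ i) (hi' : C.has τ i) (hj : C.has σ j) (hj' : C.has τ j)
    (ha : C.adj i j) (hl : C.c σ i < C.c σ j) :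
    (C.c σ i < C.c τ i ∧ C.c σ j < C.c τ j ∧ C.R i (C.z σ j) ∧ C.z σ j ≤ C.u i j) ∨
    (C.c τ i < C.c σ i ∧ C.c τ j < C.c σ j ∧ C.R i (C.z τ j) ∧ C.z τ j ≤ C.u i j) := by
  have hl' := C.FF hs hi hi' hj hj' ha hl
  have key : ∀ {σ τ : Bool}, σ ≠ τ → C.has σ i → C.has τ i → C.has σ j → C.has τ j →
      C.c σ i < C.c σ j → (C.c σ i < C.c τ i ∧ C.R i (C.z σ j) ∧ C.z σ j ≤ C.u i j) ∨
        C.c τ j < C.c σ j := by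
    intro σ τ hs hi hi' hj hj' hl
    by_cases hA : C.A σ j (C.u i j)
    · obtain ⟨h5, h6, h7⟩ := C.K2 hs hi hi' hj ha hl hA
      have := C.min_c hj' (C.z_ps hs hj) (C.R_up (C.R_u' ha) h5)
      right; order
    · obtain ⟨h5, h6, h7, h8⟩ := C.K1 hs hi hi' hj ha hl hA
      exact Or.inl ⟨h5, h6, h8⟩
  rcases key hs hi hi' hj hj' hl with h1 | h1 <;> rcases key hs.symm hi' hi hj' hj hl' with h2 | h2
  · order
  · exact Or.inl ⟨h1.1, h2, h1.2⟩
  · exact Or.inr ⟨h2.1, h1, h2.2⟩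
  · order

/-- same type: orders agree -/
theorem same (hi : C.has σ i) (hi' : C.has τ i) (hj : C.has σ j) (hj' : C.has τ j)
    (ti : C.c σ i < C.c τ i) (tj : C.c σ j < C.c τ j) (hl : C.c σ i < C.c σ j) :
    C.c τ i < C.c τ j := by
  have hn : i ≠ j := by rintro rfl; exact lt_irrefl _ hl
  rcases C.cc hi' hj' hn with h | h
  · exact h
  · have := C.min_c hi' (C.c_ps hj') (C.R_up (C.R_c hi) (hl.trans tj).le)
    order

theorem K1K2 (hs : σ ≠ τ) (h : C.has σ i) (h' : C.has τ i) (hj : C.has σ j) (ha : C.adj i j)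
    (hl : C.c σ i < C.c σ j) (hA : ¬ C.A σ j (C.u i j)) (ha' : C.adj i' j)
    (hz : C.u i' j ≤ C.z σ j) : False := by
  obtain ⟨h5, h6, h7, h8⟩ := C.K1 hs h h' hj ha hl hA
  have h9 := C.e1 ha h6 (C.R_up (C.R_u' ha') hz)
  have h10 : C.u i j = C.z σ j := by order
  have := C.u_ne ha h'
  exact C.flexB hs h h' hj ha h5 (by order) h10 hl

theorem K2K4 (hs : σ ≠ τ) (hi : C.has σ i) (hj : C.has σ j) (ha' : C.adj i' j)
    (hR : C.R j (C.z σ j)) (h1 : C.z σ j < C.c σ j) (hi'' : C.has σ i')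
    (h2 : C.c σ j ≤ C.z σ i') (h3 : C.z σ i' ≤ C.u i' j) : False := by
  rcases C.byp_c hs hj (C.z_ps hs hj) (C.z_ps hs hi'') (by order) hR
    (h3.trans (C.u_t' ha')) with h | h <;> order

theorem K2K2s (hs : σ ≠ τ) (hi : C.has σ i) (hi2 : C.has τ i) (hi' : C.has σ i')
    (hi2' : C.has τ i') (hj : C.has σ j) (ha : C.adj i j) (ha' : C.adj i' j)
    (ti : C.c σ i < C.c τ i) (ti' : C.c σ i' < C.c τ i')
    (hl : C.c σ i < C.c σ j) (hl' : C.c σ i' < C.c σ j)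
    (hA : C.A σ j (C.u i j)) (hA' : C.A σ j (C.u i' j)) (hii : C.c σ i < C.c σ i') : False := by
  have hn : i ≠ i' := by rintro rfl; exact lt_irrefl _ hii
  obtain ⟨h1, h2⟩ := C.L0 hi hj ha hl
  obtain ⟨h1', h2'⟩ := C.L0 hi' hj ha' hl'
  obtain ⟨p1, p2, p3⟩ := C.K2 hs hi hi2 hj ha hl hA
  obtain ⟨p1', p2', p3'⟩ := C.K2 hs hi' hi2' hj ha' hl' hA'
  have hbb := C.same hi hi2 hi' hi2' ti ti' hii
  have huu : C.u i j < C.u i' j := by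
    rcases C.uu ha ha' hn with h | h
    · exact h
    · exact absurd h (C.e1 ha (C.R_up (C.R_c hi) (by order)) (C.R_u' ha'))
  have hw := C.z_ps hs.symm hi2'
  have hwR : ∀ x, C.ps σ x → C.R j x → ¬ x < C.c σ j := fun x hx hR => by
    have := C.min_c hj hx hR; order
  have hzA : ¬ C.A τ i' (C.z σ j) := by rw [C.A_lt hi2' (C.z_ps hs hj)]; order
  have hu'A : ¬ C.A τ i' (C.u i' j) := fun h => by
    rcases C.c2 hi2' h p1' hzA with ⟨q1, q2⟩ | ⟨q1, q2⟩
    · exact hwR _ hw (C.R_up (C.R_u' ha') q1) (by order)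
    · exact C.R_ga hi2' (C.R_up (C.R_u ha') q1)
  by_cases huA : C.A τ i' (C.u i j)
  · rcases C.c2 hi2' huA huu.le hu'A with ⟨q1, q2⟩ | ⟨q1, q2⟩
    · exact hwR _ hw (C.R_up (C.R_u' ha) q1) (by order)
    · have := C.ga_lt hi2'
      have hne := C.u_ne ha' hi2'
      exact C.e1 ha' (C.R_c hi2') (C.R_up (C.R_u' ha) (by order)) (by order)
  · have hne := C.u_ne ha hi2
    rcases C.cmp_u ha (C.R_c hi2) (C.c_t hi2) with h5 | h5
    · rcases C.c2 hi2' ((C.A_lt hi2' (C.c_ps hi2)).2 hbb) h5 huA with ⟨q1, q2⟩ | ⟨q1, q2⟩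
      · rcases C.byp_c hs.symm hi2 (C.c_ps hi) hw (by order) (C.R_c hi)
          (q2.trans (C.u_t ha)) with h | h <;> order
      · exact C.e1 ha' (C.R_up (C.R_c hi2') q2) (C.R_u' ha) huu
    · have hRb := C.R_up (C.R_u' ha) h5
      have hlt : C.u i' j < C.c τ i' := by
        have hne' := C.u_ne ha' hi2'
        have := C.e1 ha' (C.R_c hi2') (C.R_up hRb hbb.le)
        rcases C.cmp_u ha' (C.R_c hi2') (C.c_t hi2') with h6 | h6 <;> order
      have hjt := C.c_t hj
      rcases C.cmp_u' ha' hRb (by order) with h6 | h6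
      · have h8 : ¬ C.ps τ (C.u i' j) := fun hp => by
          have := C.min_c hi2' hp (C.R_u ha'); order
        rcases C.byp_u' ha' (C.c_ps hi2) (C.c_ps hi2') hbb.le hRb (by order) h8 with h | h <;> order
      · have := C.min_c hi2' (C.c_ps hi2) (C.R_up (C.R_u ha') h6)
        order

theorem K2K2t (hs : σ ≠ τ) (hi : C.has σ i) (hi2 : C.has τ i) (hi' : C.has σ i')
    (hi2' : C.has τ i') (hj : C.has σ j) (ha : C.adj i j) (ha' : C.adj i' j)
    (ti : C.c τ i < C.c σ i) (ti' : C.c τ i' < C.c σ i')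
    (hl : C.c σ i < C.c σ j) (hl' : C.c σ i' < C.c σ j)
    (hA : C.A σ j (C.u i j)) (hA' : C.A σ j (C.u i' j)) (hii : C.c σ i < C.c σ i') : False := by
  have hn : i ≠ i' := by rintro rfl; exact lt_irrefl _ hii
  obtain ⟨h1, h2⟩ := C.L0 hi hj ha hl
  obtain ⟨h1', h2'⟩ := C.L0 hi' hj ha' hl'
  obtain ⟨p1, p2, p3⟩ := C.K2 hs hi hi2 hj ha hl hA
  obtain ⟨p1', p2', p3'⟩ := C.K2 hs hi' hi2' hj ha' hl' hA'
  have huu : C.u i j < C.u i' j := by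
    rcases C.uu ha ha' hn with h | h
    · exact h
    · exact absurd h (C.e1 ha (C.R_up (C.R_c hi) (by order)) (C.R_u' ha'))
  have hz := C.z_ps hs hi'
  have hza : C.z σ i' < C.c σ i' := by
    by_cases hb : C.A σ i' (C.c τ i')
    · exact (C.c1 hi' (C.R_c hi2') ti' hb).2
    · rw [C.A_z hs hi' (C.c_ps hi2')] at hb
      rcases C.chain (C.c_ps hi2') hz with h | h <;> order
  have huA : C.A σ i' (C.u i j) := by
    by_contra huA
    rcases C.c2 hi' ((C.A_lt hi' (C.c_ps hi)).2 hii) h1.le huA with ⟨q1, q2⟩ | ⟨q1, q2⟩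
    · rcases C.byp_c hs hi (C.c_ps hi2) hz (by order) (C.R_c hi2)
          (q2.trans (C.u_t ha)) with h | h <;> order
    · exact C.e1 ha' (C.R_up (C.R_c hi') q2) (C.R_u' ha) huu
  have hu'A : ¬ C.A σ i' (C.u i' j) := fun h => by
    have hzA : ¬ C.A σ i' (C.z σ j) := by rw [C.A_z hs hi' (C.z_ps hs hj)]; order
    rcases C.c2 hi' h p1' hzA with ⟨q1, q2⟩ | ⟨q1, q2⟩
    · order
    · exact C.R_ga hi' (C.R_up (C.R_u ha') q1)
  rcases C.c2 hi' huA huu.le hu'A with ⟨q1, q2⟩ | ⟨q1, q2⟩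
  · have hRz := C.R_up (C.R_u' ha) q1
    rcases C.chain (C.c_ps hi2') hz with h | h
    · exact C.e1 ha' (C.R_up (C.R_c hi2') h) hRz (by order)
    · exact C.e1 ha' (C.R_c hi2') (C.R_up hRz h) (by order)
  · have := C.ga_lt hi'
    exact C.e1 ha' (C.R_c hi') (C.R_up (C.R_u' ha) (by order)) h1'

theorem K3K3 (hs : σ ≠ τ) (hi : C.has σ i) (hi2 : C.has τ i) (hi' : C.has σ i')
    (hi2' : C.has τ i') (hj : C.has σ j) (ha : C.adj i j) (ha' : C.adj i' j)
    (hl : C.c σ j < C.c σ i) (hl' : C.c σ j < C.c σ i')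
    (hA : C.A σ i (C.u i j)) (hA' : C.A σ i' (C.u i' j)) (hii : C.c σ i < C.c σ i') : False := by
  obtain ⟨h1, h2⟩ := C.L0' hi hj ha hl
  obtain ⟨h1', h2'⟩ := C.L0' hi' hj ha' hl'
  obtain ⟨p1, p2, p3⟩ := C.K3 hs hi hi2 hj ha hl hA
  obtain ⟨p1', p2', p3'⟩ := C.K3 hs hi' hi2' hj ha' hl' hA'
  have H1 : ¬ C.c σ i ≤ C.u i' j := fun h => by
    have hnp : ¬ C.ps σ (C.u i j) := fun hp => by
      have := C.min_c hi hp (C.R_u ha); order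
    rcases C.byp_u' ha (C.c_ps hj) (C.c_ps hi) hl.le (C.R_c hj) (h.trans (C.u_t' ha')) hnp
      with h | h <;> order
  have hu'A : ¬ C.A σ i (C.u i' j) := fun h => by
    have h3 : ¬ C.A σ i (C.c σ i') := by rw [C.A_lt hi (C.c_ps hi')]; order
    have hg := C.ga_lt hi
    have : C.u i' j ≤ C.c σ i := by
      rcases C.c2 hi h h2'.le h3 with ⟨q1, q2⟩ | ⟨q1, q2⟩ <;> order
    have := C.min_c hi' (C.c_ps hi) (C.R_up (C.R_u ha') this)
    order
  have hzu : C.z σ i ≤ C.u i' j := by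
    rcases C.c2 hi ((C.A_lt hi (C.c_ps hj)).2 hl) h1'.le hu'A with ⟨q1, q2⟩ | ⟨q1, q2⟩
    · exact q2
    · exact absurd q2 H1
  have hw := C.z_ps hs.symm hi2'
  have hB : ¬ C.A τ i' (C.u i' j) := fun hB => by
    obtain ⟨q1, q2⟩ := C.c1 hi2' (C.R_u ha') p1' hB
    have := C.min_c hi' hw (C.R_up (C.R_u ha') q1)
    order
  rcases C.c2 hi2' ((C.A_lt hi2' (C.z_ps hs hi)).2 (by order)) hzu hB with ⟨q1, q2⟩ | ⟨q1, q2⟩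
  · have := C.min_c hi hw (C.R_up (C.R_c hi2) (p2.trans q1))
    exact H1 (this.trans q2)
  · order

theorem K4K4 (hs : σ ≠ τ) (hi : C.has σ i) (hi2 : C.has τ i) (hi' : C.has σ i')
    (hi2' : C.has τ i') (hj : C.has σ j) (ha : C.adj i j) (ha' : C.adj i' j)
    (hl : C.c σ j < C.c σ i) (hl' : C.c σ j < C.c σ i')
    (hA : ¬ C.A σ i (C.u i j)) (hA' : ¬ C.A σ i' (C.u i' j)) (hii : C.c σ i < C.c σ i') :
    False := by
  have hn : i ≠ i' := by rintro rfl; exact lt_irrefl _ hii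
  obtain ⟨h1, h2⟩ := C.L0' hi hj ha hl
  obtain ⟨h1', h2'⟩ := C.L0' hi' hj ha' hl'
  obtain ⟨p1, p2, p3⟩ := C.K4 hs hi hi2 hj ha hl hA
  obtain ⟨p1', p2', p3'⟩ := C.K4 hs hi' hi2' hj ha' hl' hA'
  have hbb := C.same hi hi2 hi' hi2' p3 p3' hii
  have huu : C.u i j < C.u i' j := by
    rcases C.uu ha ha' hn with h | h
    · exact h
    · have := C.min_c hi' (C.c_ps hi) (C.R_up (C.R_u ha') (h.trans h2).le)
      order
  have hz' : C.z σ i' ≤ C.u i j := by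
    have ht := p2'.trans (C.u_t' ha')
    rcases C.cmp_u' ha (C.R_up (C.R_c hj) p1') ht with h | h
    · exact h
    · have hnp : ¬ C.ps τ (C.u i j) := fun hp => by
        have := C.min_c hi2 hp (C.R_u ha); order
      rcases C.byp_u' ha (C.z_ps hs hi) (C.z_ps hs hi') (by order) (C.R_up (C.R_c hj) p1) ht hnp
        with h | h <;> order
  have hb : ¬ C.A σ i' (C.c τ i) := by rw [C.A_z hs hi' (C.c_ps hi2)]; order
  rcases C.c2 hi' ((C.A_lt hi' (C.c_ps hi)).2 hii) p3.le hb with ⟨q1, q2⟩ | ⟨q1, q2⟩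
  · order
  · have := C.min_c hi2' (C.c_ps hi2) (C.R_up (C.R_c hi') q2)
    order

theorem K2K3 (hs : σ ≠ τ) (hi : C.has σ i) (hi' : C.has σ i') (hi2' : C.has τ i')
    (hj : C.has σ j) (ha' : C.adj i' j)
    (hl' : C.c σ j < C.c σ i') (hA' : C.A σ i' (C.u i' j))
    (hR : C.R j (C.z σ j)) (hz : C.z σ j < C.c σ j) :
    C.R j (C.z τ i') ∧ C.z τ i' ≤ C.u i' j := by
  obtain ⟨h1', h2'⟩ := C.L0' hi' hj ha' hl'
  obtain ⟨p1', p2', p3'⟩ := C.K3 hs hi' hi2' hj ha' hl' hA'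
  have hw := C.z_ps hs.symm hi2'
  have hB : ¬ C.A τ i' (C.u i' j) := fun hB => by
    obtain ⟨q1, q2⟩ := C.c1 hi2' (C.R_u ha') p1' hB
    have := C.min_c hi' hw (C.R_up (C.R_u ha') q1)
    order
  rcases C.c2 hi2' ((C.A_lt hi2' (C.z_ps hs hj)).2 (by order)) (by order) hB with
    ⟨q1, q2⟩ | ⟨q1, q2⟩
  · exact ⟨C.R_up hR q1, q2⟩
  · order

theorem O5 (hs : σ ≠ τ) (hi : C.has σ i) (hi2 : C.has τ i) (hj : C.has σ j) (hj2 : C.has τ j)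
    (hj' : C.has σ j') (hj2' : C.has τ j') (ti : C.c σ i < C.c τ i) (tj : C.c σ j < C.c τ j)
    (tj' : C.c σ j' < C.c τ j') (ha : C.adj i j) (ha' : C.adj i j')
    (hl : C.c σ i < C.c σ j) (hjj : C.c σ j < C.c σ j') : False := by
  have hl' : C.c σ i < C.c σ j' := hl.trans hjj
  have hb := C.FF hs hi hi2 hj hj2 ha hl
  have hb' := C.FF hs hi hi2 hj' hj2' ha' hl'
  have hbb := C.same hj hj2 hj' hj2' tj tj' hjj
  obtain ⟨a1, a2⟩ := C.L0 hi hj ha hl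
  obtain ⟨b1, b2⟩ := C.L0 hi2 hj2 ha hb
  obtain ⟨a1', a2'⟩ := C.L0 hi hj' ha' hl'
  obtain ⟨b1', b2'⟩ := C.L0 hi2 hj2' ha' hb'
  have hn : j ≠ j' := by rintro rfl; exact lt_irrefl _ hjj
  have hw := C.z_ps hs.symm hj2
  have hbi := (C.A_lt hj2 (C.c_ps hi2)).2 hb
  have H : ∀ y, C.z τ j ≤ y → y ≤ C.t i → C.c τ i ≤ C.z τ j → False := fun y hy hy2 h => by
    rcases C.byp_c hs.symm hi2 (C.c_ps hi) hw (by order) (C.R_c hi) (by order) with h | h <;> order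
  have huA : C.A τ j (C.u i j) := by
    by_contra huA
    rcases C.c2 hj2 hbi b1.le huA with ⟨q1, q2⟩ | ⟨q1, q2⟩
    · exact H _ q2 (C.u_t ha) q1
    · order
  obtain ⟨r1, r2⟩ := C.c1 hj2 (C.R_u' ha) b2 huA
  have huA' : C.A τ j (C.u i j') := by
    by_contra huA'
    rcases C.c2 hj2 hbi b1'.le huA' with ⟨q1, q2⟩ | ⟨q1, q2⟩
    · exact H _ q2 (C.u_t ha') q1
    · have hnp : ¬ C.ps τ (C.u i j) := fun hp => by
        have := C.min_c hj2 hp (C.R_u' ha); order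
      rcases C.byp_u ha (C.c_ps hi2) (C.c_ps hj2) hb.le (C.R_c hi2) (q2.trans (C.u_t ha')) hnp
        with h | h <;> order
  have h3 : ¬ C.A τ j (C.c τ j') := by rw [C.A_lt hj2 (C.c_ps hj2')]; order
  have hg := C.ga_lt hj2
  have : C.u i j' ≤ C.c τ j := by
    rcases C.c2 hj2 huA' b2'.le h3 with ⟨q1, q2⟩ | ⟨q1, q2⟩ <;> order
  have := C.min_c hj2' (C.c_ps hj2) (C.R_up (C.R_u' ha') this)
  order
end Cfg

namespace Cfg
variable {X : Type} [PartialOrder X] {I : Type} (C : Cfg X I) {σ τ ρ : Bool} {i j i' j' i'' k m m' : I}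

/-- full of type `σ` -/
def ty (σ : Bool) (i : I) : Prop := C.has σ i ∧ C.has (!σ) i ∧ C.c σ i < C.c (!σ) i

def Hd (σ : Bool) (m j : I) : Prop :=
  C.ty σ j ∧ C.adj m j ∧ C.R m (C.z σ j) ∧ C.z σ j ≤ C.u m j

theorem ty_has (h : C.ty σ i) (τ : Bool) : C.has τ i := by
  cases σ <;> cases τ <;> first | exact h.1 | exact h.2.1

theorem ty_lt (h : C.ty σ i) (hs : σ ≠ τ) : C.c σ i < C.c τ i := by
  cases σ <;> cases τ <;> first | exact h.2.2 | exact absurd rfl hs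

theorem ty_mk (h : C.has σ i) (h' : C.has τ i) (hs : σ ≠ τ) (hl : C.c σ i < C.c τ i) :
    C.ty σ i := by
  cases σ <;> cases τ <;> first | exact ⟨h, h', hl⟩ | exact absurd rfl hs

theorem ty_or (h : C.has false i) (h' : C.has true i) : C.ty false i ∨ C.ty true i := by
  rcases C.ct (by decide : false ≠ true) h h' with h1 | h1
  · exact Or.inl ⟨h, h', h1⟩
  · exact Or.inr ⟨h', h, h1⟩

theorem ty_uniq (h : C.ty σ i) (h' : C.ty τ i) : σ = τ := by
  by_contra hs
  have := C.ty_lt h hs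
  have := C.ty_lt h' (Ne.symm hs)
  order

theorem HdU (h : C.Hd σ m j) (h' : C.Hd σ m' j) : m = m' := by
  by_contra hn
  exact C.tok h.2.1 h'.2.1 hn h.2.2.1 h'.2.2.1 h.2.2.2 h'.2.2.2

theorem cross (hi : C.ty σ i) (hj : C.ty τ j) (ha : C.adj i j) : σ = τ := by
  by_contra hs
  have hn : i ≠ j := fun e => C.adj_irr (e ▸ ha)
  have h1 := C.ty_lt hi hs
  have h2 := C.ty_lt hj (Ne.symm hs)
  rcases C.cc (C.ty_has hi σ) (C.ty_has hj σ) hn with h | h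
  · rcases C.FFtype hs (C.ty_has hi _) (C.ty_has hi _) (C.ty_has hj _) (C.ty_has hj _) ha h with
      h | h <;> order
  · rcases C.FFtype hs (C.ty_has hj _) (C.ty_has hj _) (C.ty_has hi _) (C.ty_has hi _)
      (C.adj_symm ha) h with h | h <;> order

theorem FFh (hi : C.ty σ i) (hj : C.ty σ j) (ha : C.adj i j) (hl : C.c σ i < C.c σ j) :
    C.Hd σ i j := by
  have hs : σ ≠ !σ := by cases σ <;> decide
  rcases C.FFtype hs (C.ty_has hi _) (C.ty_has hi _) (C.ty_has hj _) (C.ty_has hj _) ha hl with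
    h | h
  · exact ⟨hj, ha, h.2.2⟩
  · exact absurd h.1 (by have := C.ty_lt hi hs; order)

theorem O5' (hi : C.ty σ i) (hj : C.ty σ j) (hj' : C.ty σ j') (ha : C.adj i j) (ha' : C.adj i j')
    (hl : C.c σ i < C.c σ j) (hl' : C.c σ i < C.c σ j') : j = j' := by
  by_contra hn
  have hs : σ ≠ !σ := by cases σ <;> decide
  rcases C.cc (C.ty_has hj σ) (C.ty_has hj' σ) hn with h | h
  · exact C.O5 hs (C.ty_has hi _) (C.ty_has hi _) (C.ty_has hj _) (C.ty_has hj _) (C.ty_has hj' _)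
      (C.ty_has hj' _) (C.ty_lt hi hs) (C.ty_lt hj hs) (C.ty_lt hj' hs) ha ha' hl h
  · exact C.O5 hs (C.ty_has hi _) (C.ty_has hi _) (C.ty_has hj' _) (C.ty_has hj' _) (C.ty_has hj _)
      (C.ty_has hj _) (C.ty_lt hi hs) (C.ty_lt hj' hs) (C.ty_lt hj hs) ha' ha hl' h

/-- a full vertex has no three full neighbours -/
theorem Q5 {j1 j2 j3 : I} {ρ1 ρ2 ρ3 : Bool} (hi : C.ty σ i) (h1 : C.ty ρ1 j1) (h2 : C.ty ρ2 j2)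
    (h3 : C.ty ρ3 j3)
    (a1 : C.adj i j1) (a2 : C.adj i j2) (a3 : C.adj i j3) : j1 = j2 ∨ j1 = j3 ∨ j2 = j3 := by
  obtain rfl := C.cross hi h1 a1
  obtain rfl := C.cross hi h2 a2
  obtain rfl := C.cross hi h3 a3
  have key : ∀ {a b}, C.ty σ a → C.ty σ b → C.adj i a → C.adj i b → C.c σ a < C.c σ i →
      C.c σ b < C.c σ i → a = b := fun ha hb ea eb la lb =>
    C.HdU (C.FFh ha hi (C.adj_symm ea) la) (C.FFh hb hi (C.adj_symm eb) lb)
  have hn : ∀ {a}, C.ty σ a → C.adj i a → C.c σ i < C.c σ a ∨ C.c σ a < C.c σ i := fun ha e =>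
    C.cc (C.ty_has hi _) (C.ty_has ha _) (fun h => C.adj_irr (h ▸ e))
  rcases hn h1 a1 with l1 | l1 <;> rcases hn h2 a2 with l2 | l2 <;> rcases hn h3 a3 with l3 | l3
  · exact Or.inl (C.O5' hi h1 h2 a1 a2 l1 l2)
  · exact Or.inl (C.O5' hi h1 h2 a1 a2 l1 l2)
  · exact Or.inr (Or.inl (C.O5' hi h1 h3 a1 a3 l1 l3))
  · exact Or.inr (Or.inr (key h2 h3 a2 a3 l2 l3))
  · exact Or.inr (Or.inr (C.O5' hi h2 h3 a2 a3 l2 l3))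
  · exact Or.inr (Or.inl (key h1 h3 a1 a3 l1 l3))
  · exact Or.inl (key h1 h2 a1 a2 l1 l2)
  · exact Or.inl (key h1 h2 a1 a2 l1 l2)

theorem dbl_s (hs : σ ≠ τ) (hj : C.has σ j) (hi : C.ty σ i) (hi' : C.ty σ i') (ha : C.adj i j)
    (ha' : C.adj i' j) (hl : C.c σ i < C.c σ i') :
    C.c σ i < C.c σ j ∧ C.c σ j < C.c σ i' ∧ C.c σ j ≤ C.z σ i' ∧ C.z σ i' ≤ C.u i' j := by
  have hn : i ≠ i' := by rintro rfl; exact lt_irrefl _ hl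
  have s1 := C.ty_has hi σ
  have s2 := C.ty_has hi τ
  have s1' := C.ty_has hi' σ
  have s2' := C.ty_has hi' τ
  have t1 := C.ty_lt hi hs
  have t1' := C.ty_lt hi' hs
  rcases C.cc s1 hj (fun h => C.adj_irr (h ▸ ha)) with l1 | l1 <;>
    rcases C.cc s1' hj (fun h => C.adj_irr (h ▸ ha')) with l2 | l2
  · exfalso
    by_cases hA : C.A σ j (C.u i j) <;> by_cases hA' : C.A σ j (C.u i' j)
    · exact C.K2K2s hs s1 s2 s1' s2' hj ha ha' t1 t1' l1 l2 hA hA' hl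
    · exact C.K1K2 hs s1' s2' hj ha' l2 hA' ha (C.K2 hs s1 s2 hj ha l1 hA).1
    · exact C.K1K2 hs s1 s2 hj ha l1 hA ha' (C.K2 hs s1' s2' hj ha' l2 hA').1
    · have k1 := C.K1 hs s1 s2 hj ha l1 hA
      have k1' := C.K1 hs s1' s2' hj ha' l2 hA'
      exact C.tok ha ha' hn k1.2.1 k1'.2.1 k1.2.2.2 k1'.2.2.2
  · by_cases hA' : C.A σ i' (C.u i' j)
    · have := C.K3 hs s1' s2' hj ha' l2 hA'
      order
    · have := C.K4 hs s1' s2' hj ha' l2 hA'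
      exact ⟨l1, l2, this.1, this.2.1⟩
  · order
  · exfalso
    by_cases hA : C.A σ i (C.u i j)
    · have := C.K3 hs s1 s2 hj ha l1 hA
      order
    by_cases hA' : C.A σ i' (C.u i' j)
    · have := C.K3 hs s1' s2' hj ha' l2 hA'
      order
    exact C.K4K4 hs s1 s2 s1' s2' hj ha ha' l1 l2 hA hA' hl

theorem dbl_t (hs : σ ≠ τ) (hj : C.has σ j) (hi : C.ty τ i) (hi' : C.ty τ i') (ha : C.adj i j)
    (ha' : C.adj i' j) (hl : C.c σ i < C.c σ i') :
    C.c σ i < C.c σ j ∧ C.c σ j < C.c σ i' ∧ C.R j (C.z σ j) ∧ C.z σ j < C.c σ j ∧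
      C.R j (C.z τ i') ∧ C.z τ i' ≤ C.u i' j := by
  have s1 := C.ty_has hi σ
  have s2 := C.ty_has hi τ
  have s1' := C.ty_has hi' σ
  have s2' := C.ty_has hi' τ
  have t1 := C.ty_lt hi hs.symm
  have t1' := C.ty_lt hi' hs.symm
  have b1 : ∀ {i}, C.ty τ i → C.adj i j → C.c σ i < C.c σ j → C.A σ j (C.u i j) := by
    intro i hi ha l
    by_contra hA
    have := (C.K1 hs (C.ty_has hi _) (C.ty_has hi _) hj ha l hA).1
    have := C.ty_lt hi hs.symm
    order
  have b2 : ∀ {i}, C.ty τ i → C.adj i j → C.c σ j < C.c σ i → C.A σ i (C.u i j) := by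
    intro i hi ha l
    by_contra hA
    have := (C.K4 hs (C.ty_has hi _) (C.ty_has hi _) hj ha l hA).2.2
    have := C.ty_lt hi hs.symm
    order
  rcases C.cc s1 hj (fun h => C.adj_irr (h ▸ ha)) with l1 | l1 <;>
    rcases C.cc s1' hj (fun h => C.adj_irr (h ▸ ha')) with l2 | l2
  · exact (C.K2K2t hs s1 s2 s1' s2' hj ha ha' t1 t1' l1 l2 (b1 hi ha l1) (b1 hi' ha' l2) hl).elim
  · obtain ⟨p1, p2, p3⟩ := C.K2 hs s1 s2 hj ha l1 (b1 hi ha l1)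
    have hR := C.R_up (C.R_u' ha) p1
    have := C.K2K3 hs s1 s1' s2' hj ha' l2 (b2 hi' ha' l2) hR p2
    exact ⟨l1, l2, hR, p2, this⟩
  · order
  · exact (C.K3K3 hs s1 s2 s1' s2' hj ha ha' l1 l2 (b2 hi ha l1) (b2 hi' ha' l2) hl).elim

theorem dblc (hj : C.has σ j) (hi : C.ty ρ i) (hi' : C.ty ρ i') (ha : C.adj i j)
    (ha' : C.adj i' j) (hl : C.c ρ i < C.c ρ i') :
    C.c σ i < C.c σ j ∧ C.c σ j < C.c σ i' ∧ C.Hd ρ j i' := by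
  by_cases hs : σ = ρ
  · subst hs
    have hs : σ ≠ !σ := by cases σ <;> decide
    obtain ⟨h1, h2, h3, h4⟩ := C.dbl_s hs hj hi hi' ha ha' hl
    exact ⟨h1, h2, hi', C.adj_symm ha', C.R_up (C.R_c hj) h3, by rwa [C.u_symm]⟩
  · have hl' := C.same (C.ty_has hi _) (C.ty_has hi σ) (C.ty_has hi' _) (C.ty_has hi' _)
      (C.ty_lt hi (Ne.symm hs)) (C.ty_lt hi' (Ne.symm hs)) hl
    obtain ⟨h1, h2, h3, h4, h5, h6⟩ := C.dbl_t hs hj hi hi' ha ha' hl'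
    exact ⟨h1, h2, hi', C.adj_symm ha', h5, by rwa [C.u_symm]⟩

theorem dblHd (hj : C.has σ j) (hi : C.ty ρ i) (hi' : C.ty ρ i') (ha : C.adj i j)
    (ha' : C.adj i' j) (hl : C.c ρ i < C.c ρ i') : C.Hd ρ j i' :=
  (C.dblc hj hi hi' ha ha' hl).2.2

/-- no three full neighbours of the same type -/
theorem three {j1 j2 j3 : I} (hj : C.has σ j) (h1 : C.ty ρ j1) (h2 : C.ty ρ j2) (h3 : C.ty ρ j3)
    (a1 : C.adj j1 j) (a2 : C.adj j2 j) (a3 : C.adj j3 j) : j1 = j2 ∨ j1 = j3 ∨ j2 = j3 := by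
  by_contra hcon
  push Not at hcon
  obtain ⟨n1, n2, n3⟩ := hcon
  have key : ∀ {a b c}, C.ty ρ a → C.ty ρ b → C.ty ρ c → C.adj a j → C.adj b j → C.adj c j →
      C.c ρ a < C.c ρ b → C.c ρ b < C.c ρ c → False := fun ha hb hc ea eb ec l1 l2 => by
    have := (C.dblc hj ha hb ea eb l1).2.1
    have := (C.dblc hj hb hc eb ec l2).1
    order
  rcases C.cc (C.ty_has h1 ρ) (C.ty_has h2 ρ) n1 with l1 | l1 <;>
  rcases C.cc (C.ty_has h1 ρ) (C.ty_has h3 ρ) n2 with l2 | l2 <;>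
  rcases C.cc (C.ty_has h2 ρ) (C.ty_has h3 ρ) n3 with l3 | l3
  · exact key h1 h2 h3 a1 a2 a3 l1 l3
  · exact key h1 h3 h2 a1 a3 a2 l2 l3
  · order
  · exact key h3 h1 h2 a3 a1 a2 l2 l1
  · exact key h2 h1 h3 a2 a1 a3 l1 l2
  · order
  · exact key h2 h3 h1 a2 a3 a1 l3 l2
  · exact key h3 h2 h1 a3 a2 a1 l3 l1

/-- not double for both types -/
theorem bothn {j1 j2 j3 j4 : I} (hj : C.has σ j) (h1 : C.ty false j1) (h2 : C.ty false j2)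
    (h3 : C.ty true j3) (h4 : C.ty true j4) (a1 : C.adj j1 j) (a2 : C.adj j2 j)
    (a3 : C.adj j3 j) (a4 : C.adj j4 j) : j1 = j2 ∨ j3 = j4 := by
  by_contra hcon
  push Not at hcon
  obtain ⟨n1, n2⟩ := hcon
  have key : ∀ {τ : Bool}, σ ≠ τ → ∀ {a b c d}, C.ty σ a → C.ty σ b → C.ty τ c → C.ty τ d →
      C.adj a j → C.adj b j → C.adj c j → C.adj d j → C.c σ a < C.c σ b → C.c σ c < C.c σ d →
      False := by
    intro τ hs a b c d ha hb hc hd ea eb ec ed l1 l2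
    obtain ⟨_, _, p1, p2⟩ := C.dbl_s hs hj ha hb ea eb l1
    obtain ⟨_, _, q1, q2, _⟩ := C.dbl_t hs hj hc hd ec ed l2
    exact C.K2K4 hs (C.ty_has ha _) hj eb q1 q2 (C.ty_has hb _) p1 p2
  rcases C.cc (C.ty_has h1 σ) (C.ty_has h2 σ) n1 with l1 | l1 <;>
  rcases C.cc (C.ty_has h3 σ) (C.ty_has h4 σ) n2 with l2 | l2 <;> cases σ
  · exact key (by decide) h1 h2 h3 h4 a1 a2 a3 a4 l1 l2
  · exact key (by decide) h3 h4 h1 h2 a3 a4 a1 a2 l2 l1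
  · exact key (by decide) h1 h2 h4 h3 a1 a2 a4 a3 l1 l2
  · exact key (by decide) h4 h3 h1 h2 a4 a3 a1 a2 l2 l1
  · exact key (by decide) h2 h1 h3 h4 a2 a1 a3 a4 l1 l2
  · exact key (by decide) h3 h4 h2 h1 a3 a4 a2 a1 l2 l1
  · exact key (by decide) h2 h1 h4 h3 a2 a1 a4 a3 l1 l2
  · exact key (by decide) h4 h3 h2 h1 a4 a3 a2 a1 l2 l1

theorem tri {a b c : I} (h1 : C.adj a b) (h2 : C.adj b c) (h3 : C.adj a c) : False := by
  have n1 : a ≠ c := fun e => C.adj_irr (e ▸ h3)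
  have n2 : b ≠ c := fun e => C.adj_irr (e ▸ h2)
  have n3 : a ≠ b := fun e => C.adj_irr (e ▸ h1)
  -- x = u a b, y = u b c, w = u a c
  have e1 := C.uu h1 (C.adj_symm h2) n1
  have e2 := C.uu h3 h2 n3
  have e3 := C.uu (C.adj_symm h1) (C.adj_symm h3) n2
  have q1 : ∀ {a b c}, C.adj a b → C.adj b c → C.adj a c → ¬ C.u a b < C.u a c ∨ ¬ C.u a b < C.u b c := by
    intro a b c h1 h2 h3
    by_contra! h
    exact C.tok h3 h2 (fun e => C.adj_irr (e ▸ h1)) (C.R_u h1) (C.R_u' h1) h.1.le h.2.le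
  have r1 := q1 h1 h2 h3
  have r2 := q1 h2 (C.adj_symm h3) (C.adj_symm h1)
  have r3 := q1 (C.adj_symm h3) h1 (C.adj_symm h2)
  rw [C.u_symm c b] at *
  rw [C.u_symm b a] at *
  rw [C.u_symm c a] at *
  grind
end Cfg

namespace Cfg
open Classical
variable {X : Type} [PartialOrder X] {I : Type} (C : Cfg X I) {σ τ ρ : Bool}
noncomputable section

def w (i : I) : ℕ := (if C.has false i then 1 else 0) + (if C.has true i then 1 else 0)

def e (A B : Finset I) : ℕ := ∑ x ∈ A, ∑ y ∈ B, if C.adj x y then 1 else 0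

def F (τ : Bool) (U : Finset I) : Finset I := U.filter (C.ty τ)

def W2 (U : Finset I) : Finset I := U.filter (fun i => C.w i = 2)
def W0 (U : Finset I) : Finset I := U.filter (fun i => C.w i = 0)
def D (τ : Bool) (U : Finset I) : Finset I := U.filter (fun j => C.w j = 1 ∧
  ∃ i ∈ U, ∃ i' ∈ U, C.ty τ i ∧ C.ty τ i' ∧ C.adj i j ∧ C.adj i' j ∧ C.c τ i < C.c τ i')

theorem w_le (i : I) : C.w i ≤ 2 := by unfold w; split_ifs <;> omega
theorem w_two {i : I} : C.w i = 2 ↔ C.ty false i ∨ C.ty true i := by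
  constructor
  · intro h
    unfold w at h
    split_ifs at h with h1 h2 <;> first | omega | exact C.ty_or h1 h2
  · intro h
    have : C.has false i ∧ C.has true i := by
      rcases h with h | h <;> exact ⟨C.ty_has h _, C.ty_has h _⟩
    simp [w, this]
theorem w_ty {i : I} (h : C.ty τ i) : C.w i = 2 := C.w_two.2 (by cases τ <;> simp [h])
theorem w_one {i : I} (h : C.w i = 1) : ∃ σ, C.has σ i := by
  unfold w at h
  split_ifs at h with h1 h2 <;> first | omega | exact ⟨_, ‹_›⟩

theorem adj_comm {x y : I} : C.adj x y ↔ C.adj y x := ⟨C.adj_symm, C.adj_symm⟩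

theorem e_comm (A B : Finset I) : C.e A B = C.e B A := by
  unfold e; rw [Finset.sum_comm]; simp_rw [C.adj_comm]

theorem e_card (A B : Finset I) :
    C.e A B = ((A ×ˢ B).filter (fun q => C.adj q.1 q.2)).card := by
  rw [Finset.card_filter, Finset.sum_product]; rfl

theorem e_le (A B : Finset I) : C.e A B ≤ A.card * B.card := by
  rw [e_card, ← Finset.card_product]; exact Finset.card_filter_le _ _

theorem e_mono {A B A' B' : Finset I} (h : A ⊆ A') (h' : B ⊆ B') : C.e A B ≤ C.e A' B' := by
  rw [e_card, e_card]
  exact Finset.card_le_card (Finset.filter_subset_filter _ (Finset.product_subset_product h h'))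

theorem e_split (A B : Finset I) (p : I → Prop) :
    C.e A B = C.e (A.filter p) B + C.e (A.filter (fun x => ¬ p x)) B := by
  unfold e; rw [Finset.sum_filter_add_sum_filter_not]

theorem e_zero {A B : Finset I} (h : ∀ x ∈ A, ∀ y ∈ B, ¬ C.adj x y) : C.e A B = 0 := by
  unfold e
  exact Finset.sum_eq_zero fun x hx => Finset.sum_eq_zero fun y hy => by simp [h x hx y hy]

theorem e_union {A A' : Finset I} (h : Disjoint A A') (B : Finset I) :
    C.e (A ∪ A') B = C.e A B + C.e A' B := by
  unfold e; rw [Finset.sum_union h]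

theorem e_union' {A A' : Finset I} (h : Disjoint A A') (B : Finset I) :
    C.e B (A ∪ A') = C.e B A + C.e B A' := by
  rw [e_comm, C.e_union h, C.e_comm A, C.e_comm A']

theorem e_bound {A B A' B' : Finset I} (h : A' ⊆ A) (h' : B' ⊆ B) :
    C.e A B + A'.card * B'.card ≤ A.card * B.card + C.e A' B' ∧
    ((∃ x ∈ A, ∃ y ∈ B, ¬ (x ∈ A' ∧ y ∈ B') ∧ ¬ C.adj x y) →
      C.e A B + A'.card * B'.card + 1 ≤ A.card * B.card + C.e A' B') := by
  have h1 := Finset.card_filter_add_card_filter_not (s := A ×ˢ B) (fun q : I × I => C.adj q.1 q.2)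
  have h2 := Finset.card_filter_add_card_filter_not (s := A' ×ˢ B') (fun q : I × I => C.adj q.1 q.2)
  rw [← e_card, Finset.card_product] at h1 h2
  have hsub := Finset.filter_subset_filter (fun q : I × I => ¬ C.adj q.1 q.2)
    (Finset.product_subset_product h h')
  constructor
  · have := Finset.card_le_card hsub
    omega
  · rintro ⟨x, hx, y, hy, hn, ha⟩
    have := Finset.card_lt_card (Finset.ssubset_iff_subset_ne.2 ⟨hsub, fun he => by
      have : (x, y) ∈ (A ×ˢ B).filter (fun q : I × I => ¬ C.adj q.1 q.2) := by
        simp [hx, hy, ha]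
      rw [← he] at this
      simp at this
      exact hn this.1⟩)
    omega

theorem F_disj (U : Finset I) : Disjoint (C.F false U) (C.F true U) := by
  rw [Finset.disjoint_left]
  intro i h h'
  simp only [F, Finset.mem_filter] at h h'
  exact absurd (C.ty_uniq h.2 h'.2) (by decide)

theorem W2_eq (U : Finset I) : C.W2 U = C.F false U ∪ C.F true U := by
  ext i
  simp only [W2, F, Finset.mem_filter, Finset.mem_union, C.w_two]
  tauto

theorem W2_card (U : Finset I) : (C.W2 U).card = (C.F false U).card + (C.F true U).card := by
  rw [W2_eq, Finset.card_union_of_disjoint (C.F_disj U)]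

theorem sum_w (U : Finset I) : ∑ i ∈ U, C.w i + (C.W0 U).card = U.card + (C.W2 U).card := by
  rw [W0, W2, Finset.card_filter, Finset.card_filter, Finset.card_eq_sum_ones,
    ← Finset.sum_add_distrib, ← Finset.sum_add_distrib]
  refine Finset.sum_congr rfl fun i _ => ?_
  have := C.w_le i
  split_ifs <;> omega

theorem e_W2 (A B : Finset I) : C.e (C.W2 A) (C.W2 B) =
    C.e (C.F false A) (C.F false B) + C.e (C.F true A) (C.F true B) := by
  rw [W2_eq, W2_eq, C.e_union (C.F_disj A), C.e_union' (C.F_disj B), C.e_union' (C.F_disj B)]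
  have : ∀ {σ τ}, σ ≠ τ → C.e (C.F σ A) (C.F τ B) = 0 := fun hs => C.e_zero fun x hx y hy ha => by
    simp only [F, Finset.mem_filter] at hx hy
    exact hs (C.cross hx.2 hy.2 ha)
  rw [this (show false ≠ true by decide), this (show true ≠ false by decide)]
  omega

/-- (Q3) -/
theorem Q3 (U : Finset I) (τ : Bool) (hne : (C.F τ U).Nonempty) :
    C.e (C.F τ U) (C.F τ U) + 2 * (C.D τ U).card + 2 ≤ 2 * (C.F τ U).card := by
  obtain ⟨m0, hm0⟩ := Finset.exists_minimalFor (C.c τ) (C.F τ U) hne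
  set S := (U ×ˢ C.F τ U).filter (fun q => C.Hd τ q.1 q.2 ∧ q.2 ≠ m0) with hS
  have hF : ∀ {i}, i ∈ C.F τ U ↔ i ∈ U ∧ C.ty τ i := by simp [F]
  have h1 : S.card + 1 ≤ (C.F τ U).card := by
    have : S.card ≤ ((C.F τ U).erase m0).card := by
      refine Finset.card_le_card_of_injOn Prod.snd ?_ ?_
      · intro q hq
        simp [hS] at hq
        simp [hq]
      · intro q hq q' hq' he
        simp [hS] at hq hq'
        refine Prod.ext ?_ he
        have h3 := hq.2.1
        rw [he] at h3
        exact C.HdU h3 hq'.2.1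
    rw [Finset.card_erase_of_mem hm0.1] at this
    have := Finset.card_pos.2 hne
    omega
  set P := ((C.F τ U) ×ˢ (C.F τ U)).filter (fun q => C.adj q.1 q.2 ∧ C.c τ q.1 < C.c τ q.2) with hP
  set P' := ((C.F τ U) ×ˢ (C.F τ U)).filter (fun q => C.adj q.1 q.2 ∧ C.c τ q.2 < C.c τ q.1) with hP'
  have hPP : P'.card ≤ P.card := by
    refine Finset.card_le_card_of_injOn Prod.swap ?_ Prod.swap_injective.injOn
    intro q hq
    simp [hP'] at hq
    simp [hP, hq, C.adj_symm hq.2.1]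
  have h2 : C.e (C.F τ U) (C.F τ U) ≤ P.card + P'.card := by
    rw [e_card]
    refine (Finset.card_le_card ?_).trans (Finset.card_union_le _ _)
    intro q hq
    simp only [Finset.mem_filter, Finset.mem_product, Finset.mem_union, hP, hP'] at hq ⊢
    have := C.cc (C.ty_has (hF.1 hq.1.1).2 τ) (C.ty_has (hF.1 hq.1.2).2 τ)
      (fun h => C.adj_irr (h ▸ hq.2))
    tauto
  have hmin : ∀ {a b}, a ∈ C.F τ U → C.c τ a < C.c τ b → b ≠ m0 := by
    rintro a b ha hl rfl
    have := hm0.2 ha hl.le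
    order
  set S2 := S.filter (fun q => C.w q.1 = 1) with hS2
  have h3 : (C.D τ U).card ≤ S2.card := by
    refine (Finset.card_le_card (t := S2.image Prod.fst) ?_).trans Finset.card_image_le
    intro j hj
    simp only [D, Finset.mem_filter] at hj
    obtain ⟨hjU, hw, i, hi, i', hi', t1, t2, a1, a2, hl⟩ := hj
    obtain ⟨σ, hσ⟩ := C.w_one hw
    have hH := C.dblHd hσ t1 t2 a1 a2 hl
    simp only [Finset.mem_image, hS2, hS, Finset.mem_filter, Finset.mem_product]
    exact ⟨(j, i'), ⟨⟨⟨hjU, hF.2 ⟨hi', t2⟩⟩, hH, hmin (hF.2 ⟨hi, t1⟩) hl⟩, hw⟩, rfl⟩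
  have h4 : P.card + S2.card ≤ S.card := by
    rw [← Finset.card_union_of_disjoint]
    · apply Finset.card_le_card
      apply Finset.union_subset
      · intro q hq
        simp only [hP, hS, Finset.mem_filter, Finset.mem_product] at hq ⊢
        have q1 := hF.1 hq.1.1
        have q2 := hF.1 hq.1.2
        exact ⟨⟨q1.1, hq.1.2⟩, C.FFh q1.2 q2.2 hq.2.1 hq.2.2, hmin hq.1.1 hq.2.2⟩
      · exact Finset.filter_subset _ _
    · rw [Finset.disjoint_left]
      intro q hq hq'
      simp only [hP, hS2, Finset.mem_filter, Finset.mem_product] at hq hq'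
      have := C.w_ty (hF.1 hq.1.1).2
      omega
  omega

theorem deg_le (U : Finset I) (τ : Bool) {j : I} (hjU : j ∈ U) (hw : C.w j = 1) :
    C.e {j} (C.F τ U) ≤ 1 + if j ∈ C.D τ U then 1 else 0 := by
  obtain ⟨σ, hσ⟩ := C.w_one hw
  have : C.e {j} (C.F τ U) = ((C.F τ U).filter (C.adj j)).card := by
    simp [e]
  rw [this]
  by_contra! hc
  split_ifs at hc with hD
  · obtain ⟨a, ha, b, hb, c, hcc, n1, n2, n3⟩ := Finset.two_lt_card.1 hc
    simp only [F, Finset.mem_filter] at ha hb hcc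
    have := C.three hσ ha.1.2 hb.1.2 hcc.1.2 (C.adj_symm ha.2) (C.adj_symm hb.2) (C.adj_symm hcc.2)
    tauto
  · obtain ⟨a, ha, b, hb, hn⟩ := Finset.one_lt_card.1 hc
    simp only [F, Finset.mem_filter] at ha hb
    apply hD
    simp only [D, Finset.mem_filter]
    refine ⟨hjU, hw, ?_⟩
    rcases C.cc (C.ty_has ha.1.2 τ) (C.ty_has hb.1.2 τ) hn with h | h
    · exact ⟨a, ha.1.1, b, hb.1.1, ha.1.2, hb.1.2, C.adj_symm ha.2, C.adj_symm hb.2, h⟩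
    · exact ⟨b, hb.1.1, a, ha.1.1, hb.1.2, ha.1.2, C.adj_symm hb.2, C.adj_symm ha.2, h⟩

theorem degs_le (U H : Finset I) (τ : Bool) (hU : H ⊆ U) (hw : ∀ j ∈ H, C.w j = 1) :
    C.e H (C.F τ U) ≤ H.card + (C.D τ U).card := by
  have h1 : C.e H (C.F τ U) ≤ ∑ j ∈ H, (1 + if j ∈ C.D τ U then 1 else 0) := by
    have : C.e H (C.F τ U) = ∑ j ∈ H, C.e {j} (C.F τ U) := by simp [e]
    rw [this]
    exact Finset.sum_le_sum fun j hj => C.deg_le U τ (hU hj) (hw j hj)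
  rw [Finset.sum_add_distrib] at h1
  have h2 : ∑ j ∈ H, (if j ∈ C.D τ U then 1 else 0) ≤ (C.D τ U).card := by
    rw [← Finset.card_filter]
    exact Finset.card_le_card fun j hj => (Finset.mem_filter.1 hj).2
  simp at h1
  simp at h2
  omega

/-- no light edges -/
theorem nolight (U : Finset I) (hne : U.Nonempty)
    (h : ∀ x ∈ U, ∀ y ∈ U, C.adj x y → 3 ≤ C.w x + C.w y) :
    2 * ∑ i ∈ U, C.w i + C.e U U ≤ 2 * (3 * U.card - 1) := by
  have hk := Finset.card_pos.2 hne
  set H := U.filter (fun i => C.w i = 1) with hH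
  have hcard : U.card = (C.W0 U).card + H.card + (C.W2 U).card := by
    rw [W0, W2, hH, Finset.card_filter, Finset.card_filter, Finset.card_filter,
      Finset.card_eq_sum_ones,  ← Finset.sum_add_distrib, ← Finset.sum_add_distrib]
    refine Finset.sum_congr rfl fun i _ => ?_
    have := C.w_le i
    split_ifs <;> omega
  have hs := C.sum_w U
  have hU : U = (C.W0 U ∪ H) ∪ C.W2 U := by
    ext i
    simp only [W0, W2, hH, Finset.mem_union, Finset.mem_filter]
    have := C.w_le i
    constructor
    · intro hi
      have : C.w i = 0 ∨ C.w i = 1 ∨ C.w i = 2 := by omega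
      tauto
    · tauto
  have d1 : Disjoint (C.W0 U) H := by
    rw [Finset.disjoint_left]; intro i h1 h2
    simp only [W0, hH, Finset.mem_filter] at h1 h2; omega
  have d2 : Disjoint (C.W0 U ∪ H) (C.W2 U) := by
    rw [Finset.disjoint_left]; intro i h1 h2
    simp only [W0, W2, hH, Finset.mem_filter, Finset.mem_union] at h1 h2; omega
  have z1 : C.e (C.W0 U ∪ H) (C.W0 U ∪ H) = 0 := C.e_zero fun x hx y hy ha => by
    simp only [W0, hH, Finset.mem_filter, Finset.mem_union] at hx hy
    have := h x (by tauto) y (by tauto) ha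
    omega
  have z2 : C.e (C.W0 U) (C.W2 U) = 0 := C.e_zero fun x hx y hy ha => by
    simp only [W0, W2, Finset.mem_filter] at hx hy
    have := h x (by tauto) y (by tauto) ha
    omega
  have hE : C.e U U = 2 * C.e H (C.W2 U) + C.e (C.W2 U) (C.W2 U) := by
    conv_lhs => rw [hU]
    rw [C.e_union d2, C.e_union' d2, C.e_union' d2, z1, C.e_comm (C.W2 U) (C.W0 U ∪ H),
      C.e_union d1, z2]
    omega
  rw [C.e_W2] at hE
  have hHF : C.e H (C.W2 U) = C.e H (C.F false U) + C.e H (C.F true U) := by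
    rw [W2_eq, C.e_union' (C.F_disj U)]
  have g : ∀ τ, C.e H (C.F τ U) ≤ H.card + (C.D τ U).card := fun τ =>
    C.degs_le U H τ (Finset.filter_subset _ _) (fun j hj => (Finset.mem_filter.1 hj).2)
  have g2 : ∀ τ, (C.F τ U = ∅ ∧ C.e H (C.F τ U) = 0 ∧ C.e (C.F τ U) (C.F τ U) = 0
        ∧ (C.F τ U).card = 0) ∨
      C.e (C.F τ U) (C.F τ U) + 2 * (C.D τ U).card + 2 ≤ 2 * (C.F τ U).card := fun τ => by
    rcases (C.F τ U).eq_empty_or_nonempty with h0 | h0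
    · left; refine ⟨h0, ?_, ?_, ?_⟩ <;> simp [h0, e]
    · exact Or.inr (C.Q3 U τ h0)
  have hW := C.W2_card U
  have ga := g false
  have gb := g true
  rcases g2 false with q | q <;> rcases g2 true with q' | q' <;> omega
end
end Cfg

def Bd : ℕ → ℕ
  | 0 => 0
  | 1 => 2
  | n + 2 => max (3 * (n + 2) - 1) ((n + 2) ^ 2 / 4 + (n + 2) + 2)

theorem Bd_ge (n : ℕ) (h : 0 < n) : 3 * n - 1 ≤ Bd n := by
  rcases n with _ | _ | n
  · omega
  · simp [Bd]
  · exact le_max_left _ _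

theorem Bd_step (n : ℕ) (h : 2 ≤ n) (h6 : n ≠ 6) (h7 : n ≠ 7) : Bd (n - 2) + n + 1 ≤ Bd n := by
  obtain ⟨n, rfl⟩ := Nat.exists_eq_add_of_le' h
  simp only [Nat.add_sub_cancel]
  by_cases hn : n < 6
  · interval_cases n <;> simp_all [Bd]
  · obtain ⟨m, rfl⟩ := Nat.exists_eq_add_of_le' (show 2 ≤ n by omega)
    simp only [Bd]
    have h1 : (m + 2 + 2) ^ 2 = (m + 2) ^ 2 + 4 * (m + 3) := by ring
    have h2 : (m + 2 + 2) ^ 2 / 4 = (m + 2) ^ 2 / 4 + (m + 3) := by rw [h1]; omega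
    have h3 : 8 * (m + 2) - 12 ≤ (m + 2) ^ 2 := by
      have : 12 ≤ 8 * (m+2) := by omega
      zify [this]; nlinarith
    rw [h2]
    have : 3 * (m + 2) - 1 ≤ (m + 2) ^ 2 / 4 + (m + 2) + 2 := by omega
    rw [max_eq_right this]
    refine le_trans ?_ (le_max_right _ _)
    omega

theorem arithA (a0 a1 b0 b1 e0 e1 : ℕ) (h1 : a0 ≤ 2) (h2 : a1 ≤ 2) (h3 : b0 ≤ 2) (h4 : b1 ≤ 2)
    (h5 : ¬ (a0 = 2 ∧ a1 = 2)) (h6 : ¬ (b0 = 2 ∧ b1 = 2)) (g0 : e0 ≤ a0 * b0) (g1 : e1 ≤ a1 * b1)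
    (k0 : 1 ≤ a0 + b0 → e0 + a0 / 2 + b0 / 2 + 1 ≤ a0 + b0)
    (k1 : 1 ≤ a1 + b1 → e1 + a1 / 2 + b1 / 2 + 1 ≤ a1 + b1) :
    (e0 + e1) + (a0 + a1) + (b0 + b1) ≤ (a0 + a1) * (b0 + b1) + 2 ∨
      (a0 + a1 = 3 ∧ b0 + b1 = 0) ∨ (a0 + a1 = 0 ∧ b0 + b1 = 3) := by
  interval_cases a0 <;> interval_cases a1 <;> interval_cases b0 <;> interval_cases b1 <;> omega

theorem pq_le (p q n : ℕ) (h : p + q = n) : p * q ≤ n ^ 2 / 4 := by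
  rw [Nat.le_div_iff_mul_le (by norm_num)]; subst h
  zify; nlinarith [sq_nonneg ((p : ℤ) - q)]

namespace Cfg
open Classical
variable {X : Type} [PartialOrder X] {I : Type} (C : Cfg X I) {σ τ ρ : Bool}

theorem F_le2 {A : Finset I} {y : I} (hy : C.w y = 1) (hA : ∀ i ∈ A, C.adj i y) (τ : Bool) :
    (C.F τ A).card ≤ 2 := by
  obtain ⟨σ, hσ⟩ := C.w_one hy
  by_contra! hc
  obtain ⟨a, ha, b, hb, c, hcc, n1, n2, n3⟩ := Finset.two_lt_card.1 hc
  simp only [F, Finset.mem_filter] at ha hb hcc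
  have := C.three hσ ha.2 hb.2 hcc.2 (hA _ ha.1) (hA _ hb.1) (hA _ hcc.1)
  tauto

theorem F_both {A : Finset I} {y : I} (hy : C.w y = 1) (hA : ∀ i ∈ A, C.adj i y) :
    ¬ ((C.F false A).card = 2 ∧ (C.F true A).card = 2) := by
  obtain ⟨σ, hσ⟩ := C.w_one hy
  rintro ⟨h1, h2⟩
  obtain ⟨a, ha, b, hb, n⟩ := Finset.one_lt_card.1 (by omega : 1 < (C.F false A).card)
  obtain ⟨a', ha', b', hb', n'⟩ := Finset.one_lt_card.1 (by omega : 1 < (C.F true A).card)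
  simp only [F, Finset.mem_filter] at ha hb ha' hb'
  have := C.bothn hσ ha.2 hb.2 ha'.2 hb'.2 (hA _ ha.1) (hA _ hb.1) (hA _ ha'.1) (hA _ hb'.1)
  tauto

theorem F_dbl {A : Finset I} {τ} (h : 1 < (C.F τ A).card) :
    ∃ i ∈ A, ∃ i' ∈ A, C.ty τ i ∧ C.ty τ i' ∧ C.c τ i < C.c τ i' := by
  obtain ⟨a, ha, b, hb, hn⟩ := Finset.one_lt_card.1 h
  simp only [F, Finset.mem_filter] at ha hb
  rcases C.cc (C.ty_has ha.2 τ) (C.ty_has hb.2 τ) hn with h | h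
  · exact ⟨a, ha.1, b, hb.1, ha.2, hb.2, h⟩
  · exact ⟨b, hb.1, a, ha.1, hb.2, ha.2, h⟩

theorem A30 {A B : Finset I} {y : I} (hyB : y ∈ B) (hy : C.w y = 1) (hA : ∀ i ∈ A, C.adj i y)
    (h3 : (C.W2 A).card = 3) (h0 : (C.W2 B).card = 0) (hB : 2 ≤ B.card) :
    1 ≤ (C.W0 B).card ∨ ∃ x ∈ A, ∃ v ∈ B, ¬ (x ∈ C.W2 A ∧ v ∈ C.W2 B) ∧ ¬ C.adj x v := by
  obtain ⟨v, hv, hvy⟩ := Finset.exists_mem_ne (by omega : 1 < B.card) y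
  by_contra! hcon
  obtain ⟨hc1, hc2⟩ := hcon
  have hv2 : v ∉ C.W2 B := by rw [Finset.card_eq_zero.1 h0]; simp
  have hv0 : v ∉ C.W0 B := by rw [Finset.card_eq_zero.1 (by omega : (C.W0 B).card = 0)]; simp
  have hw1 : C.w v = 1 := by
    have := C.w_le v
    simp only [W2, W0, Finset.mem_filter, hv, true_and] at hv2 hv0
    omega
  have : ∃ τ, 1 < (C.F τ A).card := by
    by_contra! hc
    have := hc true
    have := hc false
    have := C.W2_card A
    omega
  obtain ⟨τ, hτ⟩ := this
  obtain ⟨i, hi, i', hi', t1, t2, hl⟩ := C.F_dbl hτ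
  obtain ⟨s1, hs1⟩ := C.w_one hy
  obtain ⟨s2, hs2⟩ := C.w_one hw1
  exact hvy (C.HdU (C.dblHd hs2 t1 t2 (hc2 i hi v hv (by tauto)) (hc2 i' hi' v hv (by tauto)) hl)
    (C.dblHd hs1 t1 t2 (hA _ hi) (hA _ hi') hl))

theorem bipA {A B : Finset I} {x y : I} (hd : Disjoint A B) (hxA : x ∈ A) (hyB : y ∈ B)
    (hx : C.w x = 1) (hy : C.w y = 1) (hA : ∀ i ∈ A, C.adj i y) (hB : ∀ i ∈ B, C.adj i x)
    (hn : A.card + B.card = 6 ∨ A.card + B.card = 7) :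
    ∑ i ∈ A, C.w i + ∑ i ∈ B, C.w i + C.e A B ≤
      (A.card + B.card) + (A.card + B.card) ^ 2 / 4 + 2 := by
  have sA := C.sum_w A
  have sB := C.sum_w B
  have cA := C.W2_card A
  have cB := C.W2_card B
  have eW := C.e_W2 A B
  obtain ⟨b1, b2⟩ := C.e_bound (A := A) (B := B) (A' := C.W2 A) (B' := C.W2 B)
    (Finset.filter_subset _ _) (Finset.filter_subset _ _)
  have hpq := pq_le A.card B.card _ rfl
  have hxy : x ≠ y := fun h => Finset.disjoint_left.1 hd hxA (h ▸ hyB)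
  have hk : ∀ τ, 1 ≤ (C.F τ A).card + (C.F τ B).card →
      C.e (C.F τ A) (C.F τ B) + (C.F τ A).card / 2 + (C.F τ B).card / 2 + 1 ≤
        (C.F τ A).card + (C.F τ B).card := by
    intro τ h
    have hF : C.F τ (A ∪ B) = C.F τ A ∪ C.F τ B := Finset.filter_union _ _ _
    have hdF : Disjoint (C.F τ A) (C.F τ B) :=
      Finset.disjoint_of_subset_left (Finset.filter_subset _ _)
        (Finset.disjoint_of_subset_right (Finset.filter_subset _ _) hd)
    have hcard : (C.F τ (A ∪ B)).card = (C.F τ A).card + (C.F τ B).card := by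
      rw [hF, Finset.card_union_of_disjoint hdF]
    have q := C.Q3 (A ∪ B) τ (Finset.card_pos.1 (by omega))
    rw [hcard, hF, C.e_union hdF, C.e_union' hdF, C.e_union' hdF, C.e_comm (C.F τ B) (C.F τ A)] at q
    have hD : (C.F τ A).card / 2 + (C.F τ B).card / 2 ≤ (C.D τ (A ∪ B)).card := by
      have hyD : 1 < (C.F τ A).card → y ∈ C.D τ (A ∪ B) := fun h => by
        obtain ⟨i, hi, i', hi', t1, t2, hl⟩ := C.F_dbl h
        simp only [D, Finset.mem_filter, Finset.mem_union]
        exact ⟨Or.inr hyB, hy, i, Or.inl hi, i', Or.inl hi', t1, t2, hA _ hi, hA _ hi', hl⟩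
      have hxD : 1 < (C.F τ B).card → x ∈ C.D τ (A ∪ B) := fun h => by
        obtain ⟨i, hi, i', hi', t1, t2, hl⟩ := C.F_dbl h
        simp only [D, Finset.mem_filter, Finset.mem_union]
        exact ⟨Or.inl hxA, hx, i, Or.inr hi, i', Or.inr hi', t1, t2, hB _ hi, hB _ hi', hl⟩
      have g1 := C.F_le2 hy hA τ
      have g2 := C.F_le2 hx hB τ
      by_cases c1 : 1 < (C.F τ A).card <;> by_cases c2 : 1 < (C.F τ B).card
      · have : ({x, y} : Finset I) ⊆ C.D τ (A ∪ B) := by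
          intro v hv
          simp only [Finset.mem_insert, Finset.mem_singleton] at hv
          rcases hv with rfl | rfl
          · exact hxD c2
          · exact hyD c1
        have := Finset.card_le_card this
        rw [Finset.card_pair hxy] at this
        omega
      · have := Finset.card_pos.2 ⟨y, hyD c1⟩
        omega
      · have := Finset.card_pos.2 ⟨x, hxD c2⟩
        omega
      · omega
    omega
  have := arithA _ _ _ _ _ _ (C.F_le2 hy hA false) (C.F_le2 hy hA true) (C.F_le2 hx hB false)
    (C.F_le2 hx hB true) (C.F_both hy hA) (C.F_both hx hB) (C.e_le _ _) (C.e_le _ _)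
    (hk false) (hk true)
  rw [← cA, ← cB, ← eW] at this
  have posA := Finset.card_pos.2 ⟨x, hxA⟩
  have posB := Finset.card_pos.2 ⟨y, hyB⟩
  rcases this with h | ⟨h, h'⟩ | ⟨h, h'⟩
  · omega
  · have e0 := C.e_le (C.W2 A) (C.W2 B)
    rw [h, h'] at b1 b2 e0
    by_cases hB2 : 2 ≤ B.card
    · rcases C.A30 hyB hy hA h h' hB2 with g | g
      · omega
      · have := b2 g
        omega
    · have hB1 : B.card = 1 := by omega
      rcases hn with hn | hn
      · have : A.card = 5 := by omega
        simp only [this, hB1] at *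
        norm_num
        omega
      · have : A.card = 6 := by omega
        simp only [this, hB1] at *
        norm_num
        omega
  · have e0 := C.e_le (C.W2 A) (C.W2 B)
    rw [h, h'] at b1 b2 e0
    by_cases hB2 : 2 ≤ A.card
    · rcases C.A30 hxA hx hB h' h hB2 with g | ⟨a, ha, b, hb, g1, g2⟩
      · omega
      · have := b2 ⟨b, hb, a, ha, by tauto, fun hh => g2 (C.adj_symm hh)⟩
        omega
    · have hB1 : A.card = 1 := by omega
      rcases hn with hn | hn
      · have : B.card = 5 := by omega
        simp only [this, hB1] at *
        norm_num
        omega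
      · have : B.card = 6 := by omega
        simp only [this, hB1] at *
        norm_num
        omega

theorem full_deg {A : Finset I} {y : I} (hy : C.w y = 2) (hA : ∀ i ∈ A, C.w i = 2 ∧ C.adj i y) :
    A.card ≤ 2 := by
  by_contra! hc
  obtain ⟨a, ha, b, hb, c, hcc, n1, n2, n3⟩ := Finset.two_lt_card.1 hc
  have T : ∀ {i}, C.w i = 2 → ∃ τ, C.ty τ i := fun h => by
    rcases C.w_two.1 h with h | h <;> exact ⟨_, h⟩
  obtain ⟨t, ht⟩ := T hy
  obtain ⟨t1, ht1⟩ := T (hA _ ha).1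
  obtain ⟨t2, ht2⟩ := T (hA _ hb).1
  obtain ⟨t3, ht3⟩ := T (hA _ hcc).1
  have := C.Q5 ht ht1 ht2 ht3 (C.adj_symm (hA _ ha).2) (C.adj_symm (hA _ hb).2)
    (C.adj_symm (hA _ hcc).2)
  tauto

theorem bipB {A B : Finset I} {x y : I} (hd : Disjoint A B) (hxA : x ∈ A) (hyB : y ∈ B)
    (hx : C.w x = 0) (hy : C.w y = 2) (hA : ∀ i ∈ A, C.adj i y)
    (hn : A.card + B.card = 6 ∨ A.card + B.card = 7) :
    ∑ i ∈ A, C.w i + ∑ i ∈ B, C.w i + C.e A B ≤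
      (A.card + B.card) + (A.card + B.card) ^ 2 / 4 + 2 := by
  have sA := C.sum_w A
  have sB := C.sum_w B
  obtain ⟨b1, b2⟩ := C.e_bound (A := A) (B := B) (A' := C.W2 A) (B' := C.W2 B)
    (Finset.filter_subset _ _) (Finset.filter_subset _ _)
  have hpq := pq_le A.card B.card _ rfl
  have posA := Finset.card_pos.2 ⟨x, hxA⟩
  have mA : ∀ i ∈ C.W2 A, C.w i = 2 ∧ i ∈ A := fun i hi => by
    simp only [W2, Finset.mem_filter] at hi; exact hi.symm
  have mB : ∀ i ∈ C.W2 B, C.w i = 2 ∧ i ∈ B := fun i hi => by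
    simp only [W2, Finset.mem_filter] at hi; exact hi.symm
  have z1 : 1 ≤ (C.W0 A).card := Finset.card_pos.2 ⟨x, by simp [W0, hxA, hx]⟩
  have a2 : (C.W2 A).card ≤ 2 := C.full_deg hy fun i hi => ⟨(mA i hi).1, hA _ (mA i hi).2⟩
  have bB : (C.W2 B).card ≤ B.card := Finset.card_filter_le _ _
  have b0 : 1 ≤ (C.W2 B).card := Finset.card_pos.2 ⟨y, by simp [W2, hyB, hy]⟩
  obtain h | h | h : (C.W2 A).card = 0 ∨ (C.W2 A).card = 1 ∨ (C.W2 A).card = 2 := by omega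
  · have e0 := C.e_le (C.W2 A) (C.W2 B)
    rw [h, Nat.zero_mul] at b1 b2 e0
    by_cases hb : (C.W2 B).card ≤ 3
    · omega
    · by_cases hs : A.card = 3 ∧ B.card = 4
      · obtain ⟨hp, hq⟩ := hs
        simp only [hp, hq] at b1 b2 bB sA sB ⊢
        clear hpq
        obtain ⟨v, hv, hvx⟩ := Finset.exists_mem_ne (by omega : 1 < A.card) x
        have hv2 : v ∉ C.W2 A := by rw [Finset.card_eq_zero.1 h]; simp
        by_cases hv0 : C.w v = 0
        · have : ({v, x} : Finset I) ⊆ C.W0 A := by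
            intro a ha
            simp only [Finset.mem_insert, Finset.mem_singleton] at ha
            rcases ha with rfl | rfl <;> simp [W0, *]
          have := Finset.card_le_card this
          rw [Finset.card_pair hvx] at this
          omega
        · have hv1 : C.w v = 1 := by
            have := C.w_le v
            simp only [W2, Finset.mem_filter, hv, true_and] at hv2
            omega
          have : ∃ x ∈ A, ∃ y ∈ B, ¬(x ∈ C.W2 A ∧ y ∈ C.W2 B) ∧ ¬C.adj x y := by
            by_contra! hcon
            have hB : ∀ i ∈ B, C.adj i v := fun i hi => C.adj_symm (hcon v hv i hi (by tauto))
            have q1 := C.F_le2 hv1 hB false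
            have q2 := C.F_le2 hv1 hB true
            have q3 := C.F_both hv1 hB
            have q4 := C.W2_card B
            omega
          have := b2 this
          omega
      · clear b2
        rcases hn with hn | hn
        · have hc : (A.card = 2 ∧ B.card = 4) ∨ (A.card = 1 ∧ B.card = 5) := by omega
          rcases hc with ⟨hp, hq⟩ | ⟨hp, hq⟩ <;> simp only [hp, hq] at b1 bB sA sB ⊢ <;>
            norm_num at b1 ⊢ <;> omega
        · have hc : (A.card = 3 ∧ B.card = 4) ∨ (A.card = 2 ∧ B.card = 5) ∨ (A.card = 1 ∧ B.card = 6) := by omega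
          rcases hc with hc | ⟨hp, hq⟩ | ⟨hp, hq⟩
          · exact (hs hc).elim
          all_goals simp only [hp, hq] at b1 bB sA sB ⊢
          all_goals norm_num at b1 ⊢
          all_goals omega
  · have : C.e (C.W2 A) (C.W2 B) ≤ 2 := by
      obtain ⟨v, hv⟩ := Finset.card_eq_one.1 h
      rw [hv]
      have hvA := mA v (by rw [hv]; simp)
      have : C.e {v} (C.W2 B) = ((C.W2 B).filter (C.adj v)).card := by simp [e]
      rw [this]
      refine C.full_deg hvA.1 fun i hi => ?_
      rw [Finset.mem_filter] at hi
      exact ⟨(mB i hi.1).1, C.adj_symm hi.2⟩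
    rw [h] at b1
    omega
  · have hdW : Disjoint (C.W2 A) (C.W2 B) :=
      Finset.disjoint_of_subset_left (Finset.filter_subset _ _)
        (Finset.disjoint_of_subset_right (Finset.filter_subset _ _) hd)
    have hW : C.W2 (A ∪ B) = C.W2 A ∪ C.W2 B := Finset.filter_union _ _ _
    have hcard : (C.W2 (A ∪ B)).card = (C.W2 A).card + (C.W2 B).card := by
      rw [hW, Finset.card_union_of_disjoint hdW]
    have e1 : 2 * C.e (C.W2 A) (C.W2 B) ≤ C.e (C.W2 (A ∪ B)) (C.W2 (A ∪ B)) := by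
      rw [hW, C.e_union hdW, C.e_union' hdW, C.e_union' hdW, C.e_comm (C.W2 B) (C.W2 A)]
      omega
    have e2 := C.e_W2 (A ∪ B) (A ∪ B)
    have hc2 := C.W2_card (A ∪ B)
    have g2 : ∀ τ, (C.e (C.F τ (A ∪ B)) (C.F τ (A ∪ B)) = 0
        ∧ (C.F τ (A ∪ B)).card = 0) ∨
      C.e (C.F τ (A ∪ B)) (C.F τ (A ∪ B)) + 2 * (C.D τ (A ∪ B)).card + 2 ≤
        2 * (C.F τ (A ∪ B)).card := fun τ => by
      rcases (C.F τ (A ∪ B)).eq_empty_or_nonempty with h0 | h0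
      · left; refine ⟨?_, ?_⟩ <;> simp [h0, e]
      · exact Or.inr (C.Q3 (A ∪ B) τ h0)
    rw [h] at b1
    rcases g2 false with q | q <;> rcases g2 true with q' | q' <;> omega

theorem count (n : ℕ) : ∀ U : Finset I, U.card = n → 2 * ∑ i ∈ U, C.w i + C.e U U ≤ 2 * Bd n := by
  induction n using Nat.strong_induction_on with
  | _ n ih =>
  intro U hU
  rcases U.eq_empty_or_nonempty with h0 | h0
  · subst h0; simp [e]
  have hpos := Finset.card_pos.2 h0
  by_cases hl : ∀ x ∈ U, ∀ y ∈ U, C.adj x y → 3 ≤ C.w x + C.w y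
  · have := C.nolight U h0 hl
    have := Bd_ge n (by omega)
    subst hU
    omega
  push Not at hl
  obtain ⟨x, hx, y, hy, hxy, hw⟩ := hl
  have hne : x ≠ y := fun e => C.adj_irr (e ▸ hxy)
  set V := (U.erase x).erase y with hV
  have hyx : y ∈ U.erase x := Finset.mem_erase.2 ⟨hne.symm, hy⟩
  have hVc : V.card = n - 2 := by
    rw [hV, Finset.card_erase_of_mem hyx, Finset.card_erase_of_mem hx]; omega
  have h2n : 2 ≤ n := by
    have := Finset.card_le_card (show ({x, y} : Finset I) ⊆ U by
      intro a ha; simp at ha; rcases ha with rfl | rfl <;> assumption)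
    rw [Finset.card_pair hne] at this; omega
  have hUV : U = {x, y} ∪ V := by
    ext a; simp only [hV, Finset.mem_union, Finset.mem_insert, Finset.mem_singleton,
      Finset.mem_erase]
    constructor
    · intro h; tauto
    · rintro ((rfl | rfl) | h)
      · exact hx
      · exact hy
      · exact h.2.2
  have hdisj : Disjoint ({x, y} : Finset I) V := by
    rw [Finset.disjoint_left]; intro a ha hb; simp [hV] at ha hb; tauto
  have hsum : ∑ i ∈ U, C.w i = C.w x + C.w y + ∑ i ∈ V, C.w i := by
    rw [hUV, Finset.sum_union hdisj, Finset.sum_pair hne]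
  have hE : C.e U U = 2 * C.e {x, y} V + 2 + C.e V V := by
    have h1 : C.e ({x, y} : Finset I) {x, y} = 2 := by
      simp [e, Finset.sum_pair hne, hxy, C.adj_symm hxy, C.adj_irr]
    rw [hUV, C.e_union hdisj, C.e_union' hdisj, C.e_union' hdisj, h1, C.e_comm V]
    omega
  have hm : C.e {x, y} V ≤ n - 2 ∧
      (C.e {x, y} V = n - 2 → ∀ v ∈ V, C.adj v x ∨ C.adj v y) := by
    have hle : ∀ v ∈ V, (if C.adj x v then 1 else 0) + (if C.adj y v then 1 else 0) ≤ 1 := by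
      intro v _
      split_ifs with h1 h2 <;> first | omega | exact (C.tri hxy h2 h1).elim
    have : C.e {x, y} V = ∑ v ∈ V, ((if C.adj x v then 1 else 0) + (if C.adj y v then 1 else 0)) := by
      unfold e; rw [Finset.sum_pair hne, ← Finset.sum_add_distrib]
    rw [this]
    have hcs : ∑ v ∈ V, 1 = n - 2 := by simp [hVc]
    constructor
    · rw [← hcs]; exact Finset.sum_le_sum hle
    · intro he v hv
      rw [← hcs] at he
      have := (Finset.sum_eq_sum_iff_of_le hle).1 he v hv
      rw [C.adj_comm (x := v), C.adj_comm (x := v)]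
      split_ifs at this <;> first | tauto | omega
  have ihV := ih (n - 2) (by omega) V hVc
  by_cases h67 : n ≠ 6 ∧ n ≠ 7
  · have := Bd_step n h2n h67.1 h67.2
    omega
  have hB67 : Bd (n - 2) + n ≤ Bd n ∧ Bd n = n + n ^ 2 / 4 + 2 := by
    have : n = 6 ∨ n = 7 := by omega
    rcases this with rfl | rfl <;> simp [Bd]
  by_cases hnot : C.w x + C.w y ≤ 1 ∨ C.e {x, y} V < n - 2
  · omega
  have hcov := hm.2 (by omega)
  set A := U.filter (fun v => C.adj v y) with hA
  set B := U.filter (fun v => C.adj v x) with hB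
  have hxA : x ∈ A := by simp [hA, hx, hxy]
  have hyB : y ∈ B := by simp [hB, hy, C.adj_symm hxy]
  have hAy : ∀ i ∈ A, C.adj i y := fun i hi => by simp [hA] at hi; exact hi.2
  have hBx : ∀ i ∈ B, C.adj i x := fun i hi => by simp [hB] at hi; exact hi.2
  have hd : Disjoint A B := by
    rw [Finset.disjoint_left]; intro a ha hb
    exact C.tri (hBx a hb) hxy (hAy a ha)
  have hUAB : U = A ∪ B := by
    ext v
    constructor
    · intro hv
      by_cases h1 : v = x
      · subst h1; simp [hxA]
      by_cases h2 : v = y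
      · subst h2; simp [hyB]
      have := hcov v (by simp [hV, h1, h2, hv])
      simp only [Finset.mem_union, hA, hB, Finset.mem_filter, hv, true_and]
      tauto
    · intro hv
      simp only [Finset.mem_union, hA, hB, Finset.mem_filter] at hv
      tauto
  have hcard : A.card + B.card = n := by
    rw [← Finset.card_union_of_disjoint hd, ← hUAB, hU]
  have eAA : C.e A A = 0 := C.e_zero fun a ha b hb h => C.tri h (hAy b hb) (hAy a ha)
  have eBB : C.e B B = 0 := C.e_zero fun a ha b hb h => C.tri h (hBx b hb) (hBx a ha)
  have hEE : C.e U U = 2 * C.e A B := by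
    rw [hUAB, C.e_union hd, C.e_union' hd, C.e_union' hd, eAA, eBB, C.e_comm B A]
    omega
  have hss : ∑ i ∈ U, C.w i = ∑ i ∈ A, C.w i + ∑ i ∈ B, C.w i := by
    rw [hUAB, Finset.sum_union hd]
  have hn67 : A.card + B.card = 6 ∨ A.card + B.card = 7 := by omega
  have fin : ∑ i ∈ A, C.w i + ∑ i ∈ B, C.w i + C.e A B ≤
      (A.card + B.card) + (A.card + B.card) ^ 2 / 4 + 2 := by
    have hwx := C.w_le x
    obtain h | h | h : (C.w x = 1 ∧ C.w y = 1) ∨ (C.w x = 0 ∧ C.w y = 2) ∨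
      (C.w x = 2 ∧ C.w y = 0) := by omega
    · exact C.bipA hd hxA hyB h.1 h.2 hAy hBx hn67
    · exact C.bipB hd hxA hyB h.1 h.2 hAy hn67
    · have := C.bipB hd.symm hyB hxA h.2 h.1 hBx (by omega)
      rw [C.e_comm B A, add_comm B.card] at this
      omega
  rw [hcard] at fin
  omega
end Cfg

namespace Wlk
set_option linter.unusedSectionVars false
open Relation
variable {X : Type} {T T' : X → X → Prop}

/-- `p` is the vertex list of a walk from `a` to `b`. -/
inductive Wk (T : X → X → Prop) : X → X → List X → Prop
  | nil (a) : Wk T a a [a]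
  | cons {a b c p} : T a b → Wk T b c p → Wk T a c (a :: p)

def cut (T : X → X → Prop) (a b : X) : X → X → Prop := fun x y => T x y ∧ ¬ (x = a ∧ y = b)

theorem Wk.mono {a b p} (h : Wk T a b p) (hT : ∀ x y, x ∈ p → y ∈ p → T x y → T' x y) : Wk T' a b p := by
  induction h with
  | nil a => exact .nil a
  | cons h1 h2 ih =>
    rename_i a b c p
    have hb : b ∈ p := by cases h2 <;> simp
    exact .cons (hT _ _ (by simp) (by simp [hb]) h1)
      (ih fun x y hx hy => hT x y (by simp [hx]) (by simp [hy]))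

theorem Wk.mono' {a b p} (h : Wk T a b p) (hT : ∀ x y, T x y → T' x y) : Wk T' a b p :=
  h.mono fun x y _ _ => hT x y

theorem Wk.mem_head {a b p} (h : Wk T a b p) : a ∈ p := by cases h <;> simp
theorem Wk.mem_last {a b p} (h : Wk T a b p) : b ∈ p := by
  induction h with
  | nil a => simp
  | cons _ _ ih => simp [ih]

theorem Wk.from_head {a b p} (h : Wk T a b p) {x} (hx : x ∈ p) : ReflTransGen T a x := by
  induction h with
  | nil a => simp at hx; subst hx; exact .refl
  | cons h1 _ ih =>
    rcases List.mem_cons.1 hx with rfl | hx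
    · exact .refl
    · exact .head h1 (ih hx)

theorem Wk.to_last {a b p} (h : Wk T a b p) {x} (hx : x ∈ p) : ReflTransGen T x b := by
  induction h with
  | nil a => simp at hx; subst hx; exact .refl
  | cons h1 h2 ih =>
    rcases List.mem_cons.1 hx with rfl | hx
    · exact (Wk.cons h1 h2).from_head (Wk.cons h1 h2).mem_last
    · exact ih hx

theorem Wk.total {a b p} (h : Wk T a b p) {x y} (hx : x ∈ p) (hy : y ∈ p) :
    ReflTransGen T x y ∨ ReflTransGen T y x := by
  induction h with
  | nil a => simp at hx hy; subst hx; subst hy; exact Or.inl .refl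
  | cons h1 h2 ih =>
    have h3 := Wk.cons h1 h2
    rcases List.mem_cons.1 hx with rfl | hx
    · exact Or.inl (h3.from_head hy)
    · rcases List.mem_cons.1 hy with rfl | hy
      · exact Or.inr (h3.from_head (by simp [hx]))
      · exact ih hx hy

/-- restriction of walk to its own vertices -/
theorem Wk.self {a b p} (h : Wk T a b p) : Wk (fun x y => T x y ∧ x ∈ p ∧ y ∈ p) a b p :=
  h.mono fun _ _ hx hy h => ⟨h, hx, hy⟩

theorem Wk.of_rtg {a b} (h : ReflTransGen T a b) : ∃ p, Wk T a b p := by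
  induction h using ReflTransGen.head_induction_on with
  | refl => exact ⟨_, .nil _⟩
  | head h1 _ ih => obtain ⟨p, hp⟩ := ih; exact ⟨_, .cons h1 hp⟩

theorem Wk.chain {a b p} (h : Wk T a b p) : List.IsChain T p := by
  induction h with
  | nil a => simp
  | cons h1 h2 ih => cases h2 <;> simp_all

theorem Wk.head? {a b p} (h : Wk T a b p) : p.head? = some a := by cases h <;> rfl
theorem Wk.last? {a b p} (h : Wk T a b p) : p.getLast? = some b := by
  induction h with
  | nil a => rfl
  | cons h1 h2 ih => cases h2 <;> simp_all

theorem Wk.of_chain {p : List X} {a b} (h1 : List.IsChain T p) (h2 : p.head? = some a) (h3 : p.getLast? = some b) :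
    Wk T a b p := by
  induction p generalizing a with
  | nil => simp at h2
  | cons x p ih =>
    simp at h2; subst h2
    cases p with
    | nil => simp at h3; subst h3; exact .nil _
    | cons y p =>
      rw [List.isChain_cons_cons] at h1
      exact .cons h1.1 (ih h1.2 rfl (by simpa using h3))

theorem Wk.ne_nil {a b p} (h : Wk T a b p) : p ≠ [] := by cases h <;> simp

section ord
variable [PartialOrder X]

theorem rtg_le (hlt : ∀ {x y}, T x y → x < y) {x y} (h : ReflTransGen T x y) : x ≤ y := by
  induction h with
  | refl => exact le_rfl
  | tail _ h ih => exact ih.trans (hlt h).le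

theorem avoid (hlt : ∀ {x y}, T x y → x < y) {a b x y} (h : ReflTransGen T x y) (hn : ¬ (x ≤ a ∧ b ≤ y)) :
    ReflTransGen (cut T a b) x y := by
  induction h with
  | refl => exact .refl
  | tail h1 h2 ih =>
    refine .tail (ih fun h => hn ⟨h.1, h.2.trans (hlt h2).le⟩) ⟨h2, ?_⟩
    rintro ⟨rfl, rfl⟩
    exact hn ⟨rtg_le hlt h1, le_rfl⟩

theorem Wk.seg (hlt : ∀ {x y}, T x y → x < y) {a b p} (h : Wk T a b p) {x y} (hx : x ∈ p) (hy : y ∈ p) (hle : x ≤ y) :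
    ReflTransGen T x y := by
  rcases h.total hx hy with h | h
  · exact h
  · rw [le_antisymm hle (rtg_le hlt h)]

inductive Av (T : X → X → Prop) (K : X → Prop) (z : X) : X → Prop
  | base {x} : K x → x ≠ z → Av T K z x
  | step {x y} : T x y → x ≠ z → Av T K z y → Av T K z x

variable {K : X → Prop}

theorem Av.ne {z x} (h : Av T K z x) : x ≠ z := by cases h <;> assumption

theorem Av.through {a b x} (h : Av T K a x) (hb : ¬ Av T K b x) : Av T K a b ∧ ReflTransGen T x b := by
  induction h with
  | base hk hn =>
    rename_i x
    by_cases e : x = b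
    · subst e; exact ⟨.base hk hn, .refl⟩
    · exact (hb (.base hk e)).elim
  | step h1 h2 h3 ih =>
    rename_i x y
    by_cases e : x = b
    · subst e; exact ⟨.step h1 h2 h3, .refl⟩
    · have := ih fun h => hb (.step h1 e h)
      exact ⟨this.1, .head h1 this.2⟩

theorem Av.extend (hlt : ∀ {x y}, T x y → x < y) {z x y} (h : ReflTransGen T x y) (hn : ¬ z ≤ y) (hy : Av T K z y) :
    Av T K z x := by
  induction h using ReflTransGen.head_induction_on with
  | refl => exact hy
  | head h1 h2 ih =>
    refine .step h1 ?_ ih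
    rintro rfl
    exact hn ((hlt h1).le.trans (rtg_le hlt h2))

theorem Av.walk {z x} (h : Av T K z x) : ∃ k p, K k ∧ Wk T x k p ∧ z ∉ p := by
  induction h with
  | base hk hn => exact ⟨_, _, hk, .nil _, by simp [hn.symm]⟩
  | step h1 h2 _ ih =>
    obtain ⟨k, p, hk, hw, hz⟩ := ih
    exact ⟨k, _, hk, .cons h1 hw, by simp [h2.symm, hz]⟩

theorem Wk.av {a k p z} (h : Wk T a k p) (hk : K k) (hz : z ∉ p) : Av T K z a := by
  induction h with
  | nil a => exact .base hk (by simp at hz; exact fun h => hz h.symm)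
  | cons h1 h2 ih =>
    simp at hz
    exact .step h1 (fun h => hz.1 h.symm) (ih hk hz.2)

theorem pebble [Finite X] (hlt : ∀ {x y}, T x y → x < y) (x y : X) (hne : x ≠ y)
    (inv : ∀ z, Av T K z x ∨ Av T K z y) :
    ∃ p q, (∃ k, K k ∧ Wk T x k p) ∧ (∃ k, K k ∧ Wk T y k q) ∧ ∀ a, a ∈ p → a ∉ q := by
  have wf : WellFounded (fun a b : X × X => b < a) := wellFounded_gt
  suffices H : ∀ s : X × X, s.1 ≠ s.2 → (∀ z, Av T K z s.1 ∨ Av T K z s.2) →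
      ∃ p q, (∃ k, K k ∧ Wk T s.1 k p) ∧ (∃ k, K k ∧ Wk T s.2 k q) ∧ ∀ a, a ∈ p → a ∉ q from
    H (x, y) hne inv
  intro s
  induction s using wf.induction with
  | _ s ih =>
  -- one-sided step
  have key : ∀ x y : X, x ≠ y → ¬ y ≤ x → (∀ z, Av T K z x ∨ Av T K z y) →
      (∀ x', T x x' → x' ≠ y → (∀ z, Av T K z x' ∨ Av T K z y) →
        ∃ p q, (∃ k, K k ∧ Wk T x' k p) ∧ (∃ k, K k ∧ Wk T y k q) ∧ ∀ a, a ∈ p → a ∉ q) →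
      ∃ p q, (∃ k, K k ∧ Wk T x k p) ∧ (∃ k, K k ∧ Wk T y k q) ∧ ∀ a, a ∈ p → a ∉ q := by
    intro x y hne hle inv rec
    by_cases hx : K x
    · have : Av T K x y := (inv x).resolve_left fun h => h.ne rfl
      obtain ⟨k, q, hk, hw, hz⟩ := this.walk
      exact ⟨[x], q, ⟨x, hx, .nil _⟩, ⟨k, hk, hw⟩, by simpa using hz⟩
    by_cases hmv : ∃ x', T x x' ∧ x' ≠ y ∧ (∀ z, Av T K z x' ∨ Av T K z y)
    · obtain ⟨x', h1, h2, h3⟩ := hmv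
      obtain ⟨p, q, ⟨k, hk, hp⟩, ⟨k', hk', hq⟩, hd⟩ := rec x' h1 h2 h3
      refine ⟨x :: p, q, ⟨k, hk, .cons h1 hp⟩, ⟨k', hk', hq⟩, ?_⟩
      intro a ha haq
      rcases List.mem_cons.1 ha with rfl | ha
      · exact hle (rtg_le hlt (hq.from_head haq))
      · exact hd a ha haq
    exfalso
    push Not at hmv
    let Z : Set X := {z | ∃ x', T x x' ∧ x' ≠ y ∧ ¬ Av T K z x' ∧ ¬ Av T K z y}
    have hA : Av T K x y := (inv x).resolve_left fun h => h.ne rfl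
    have hZ : Z.Nonempty := by
      have := (inv y).resolve_right fun h => h.ne rfl
      cases this with
      | base hk _ => exact (hx hk).elim
      | step h1 _ h3 =>
        obtain ⟨z, hz⟩ := hmv _ h1 h3.ne
        exact ⟨z, _, h1, h3.ne, hz.1, hz.2⟩
    obtain ⟨m, hm⟩ := (Set.toFinite Z).exists_maximal hZ
    have hmy : ¬ Av T K m y := by obtain ⟨_, _, _, _, h⟩ := hm.1; exact h
    rcases inv m with h | h
    · cases h with
      | base hk _ => exact hx hk
      | @step _ x' h1 _ h3 =>
        by_cases e : x' = y
        · subst e; exact hmy h3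
        obtain ⟨z, hz1, hz2⟩ := hmv _ h1 e
        by_cases ez : z = m
        · subst ez; exact hz1 h3
        refine hmy (Av.extend hlt (hA.through hz2).2 ?_ (h3.through hz1).1)
        intro hle'
        exact ez (le_antisymm (hm.2 ⟨x', h1, e, hz1, hz2⟩ hle') hle')
    · exact hmy h
  intro hne inv
  obtain ⟨x, y⟩ := s
  simp only at hne inv ih ⊢
  by_cases hle : y ≤ x
  · obtain ⟨p, q, h1, h2, h3⟩ := key y x hne.symm (fun h => hne (le_antisymm h hle))
      (fun z => (inv z).symm) (fun x' h1 h2 h3 => by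
        obtain ⟨p, q, g1, g2, g3⟩ := ih (x, x') (Prod.mk_lt_mk.2 (Or.inr ⟨le_rfl, hlt h1⟩)) h2.symm
          (fun z => (h3 z).symm)
        exact ⟨q, p, g2, g1, fun a h h' => g3 a h' h⟩)
    exact ⟨q, p, h2, h1, fun a h h' => h3 a h' h⟩
  · exact key x y hne hle inv fun x' h1 h2 h3 =>
      ih (x', y) (Prod.mk_lt_mk.2 (Or.inl ⟨hlt h1, le_rfl⟩)) h2 h3
end ord
end Wlk

namespace Wlk
open Relation
set_option linter.unusedSectionVars false

def Lk {X : Type} (T : X → X → Prop) (sg : Bool → X) (K : X → Prop) (p : Bool → List X) : Prop :=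
  (∀ b, ∃ k, K k ∧ Wk T (sg b) k (p b)) ∧ ∀ {b b'}, b ≠ b' → ∀ {x}, x ∈ p b → x ∉ p b'

structure Net (X I : Type) [PartialOrder X] where
  T : X → X → Prop
  s : I → X
  t : I → X
  sg : Bool → X
  K : X → Prop
  psi : Bool → List X
  lt : ∀ {x y}, T x y → x < y
  le : ∀ {x y}, x ≤ y → ReflTransGen T x y
  st : ∀ i, s i ≤ t i
  lk : Lk T sg K psi
  ess : ∀ a b, T a b → (∃ i, ¬ ReflTransGen (cut T a b) (s i) (t i)) ∨ ¬ ∃ p, Lk (cut T a b) sg K p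

namespace Net
variable {X I : Type} [PartialOrder X] (N : Net X I)

def Ei (i : I) (a b : X) : Prop := N.T a b ∧ ¬ ReflTransGen (cut N.T a b) (N.s i) (N.t i)
def EP (a b : X) : Prop := N.T a b ∧ ¬ ∃ p, Lk (cut N.T a b) N.sg N.K p

variable {N} {i j : I} {a b x y v w : X}

theorem cut_lt {x y} (h : cut N.T a b x y) : x < y := N.lt h.1

theorem Ei.rt (h : N.Ei i a b) : N.s i ≤ a ∧ b ≤ N.t i := by
  by_contra hc
  exact h.2 (avoid N.lt (N.le (N.st i)) hc)

theorem Ei.R (h : N.Ei i a b) : N.s i ≤ b := h.rt.1.trans (N.lt h.1).le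

/-- an essential arc cannot be circumvented -/
theorem Ei.seg (h : N.Ei i a b) (hs : N.s i ≤ x) (ht : y ≤ N.t i) (hxy : ReflTransGen (cut N.T a b) x y) :
    b ≤ x ∨ y ≤ a := by
  by_contra! hc
  refine h.2 ((avoid N.lt (N.le hs) fun h => hc.1 h.2).trans (hxy.trans (avoid N.lt (N.le ht) fun h => hc.2 h.1)))

theorem Ei.cmp (h : N.Ei i a b) (hs : N.s i ≤ x) (ht : x ≤ N.t i) : x ≤ b ∨ b ≤ x := by
  rcases h.seg hs ht .refl with h1 | h1
  · exact Or.inr h1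
  · exact Or.inl (h1.trans (N.lt h.1).le)

theorem Ei.pred (h : N.Ei i a b) (hw : N.T w b) (hs : N.s i ≤ w) : w = a := by
  by_contra hc
  have : ReflTransGen (cut N.T a b) w b := .single ⟨hw, fun h => hc h.1⟩
  rcases h.seg hs h.rt.2 this with h1 | h1
  · exact absurd (N.lt hw) h1.not_gt
  · exact absurd (N.lt h.1) h1.not_gt

theorem lt_pred (h : x < b) : ∃ w, N.T w b ∧ x ≤ w := by
  rcases (N.le h.le).cases_tail with h1 | ⟨w, h1, h2⟩
  · exact absurd h (by rw [h1]; exact lt_irrefl _)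
  · exact ⟨w, h2, rtg_le N.lt h1⟩

theorem Ei.e1 (h : N.Ei i a b) (h' : N.Ei j w b) (hn : a ≠ w) (hi : N.s i ≤ x) (hj : N.s j ≤ x) : ¬ x < b := by
  intro hx
  obtain ⟨y, hy, hxy⟩ := lt_pred (N := N) hx
  exact hn ((h.pred hy (hi.trans hxy)).symm.trans (h'.pred hy (hj.trans hxy)))

theorem walk_cut {k p q} (h : Wk N.T w k p) (hb : b ∉ p) (hq : q = p) : Wk (cut N.T a b) w k q := by
  subst hq
  exact h.mono fun x y _ hy h => ⟨h, fun e => hb (e.2 ▸ hy)⟩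

theorem Ei.byp (h : N.Ei i a b) {k p} (hp : Wk N.T w k p) (hx : x ∈ p) (hy : y ∈ p) (hxy : x ≤ y)
    (hs : N.s i ≤ x) (ht : y ≤ N.t i) (hb : b ∉ p) : b < x ∨ y < b := by
  have := (walk_cut (N := N) (a := a) hp hb rfl).seg cut_lt hx hy hxy
  rcases h.seg hs ht this with h1 | h1
  · exact Or.inl (lt_of_le_of_ne h1 fun e => hb (e ▸ hx))
  · exact Or.inr (h1.trans_lt (N.lt h.1))

theorem Lk_mono {T T' : X → X → Prop} {sg K p} (h : Lk T sg K p) (hT : ∀ x y, T x y → T' x y) : Lk T' sg K p :=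
  ⟨fun b => by obtain ⟨k, h1, h2⟩ := h.1 b; exact ⟨k, h1, h2.mono' hT⟩, h.2⟩

/-- step of a walk entering `b` : either avoids arc or uses it -/
theorem wk_uses {T : X → X → Prop} {c k p} (h : Wk T c k p) (a b : X) :
    Wk (cut T a b) c k p ∨ (a ∈ p ∧ b ∈ p ∧ ∃ p1 p2, Wk T c a p1 ∧ Wk T b k p2 ∧ p = p1 ++ p2) := by
  induction h with
  | nil a => exact Or.inl (.nil _)
  | cons h1 h2 ih =>
    rename_i c d k p
    by_cases e : c = a ∧ d = b
    · obtain ⟨rfl, rfl⟩ := e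
      exact Or.inr ⟨by simp, by simp [h2.mem_head], [c], p, .nil _, h2, rfl⟩
    · rcases ih with ih | ⟨g1, g2, p1, p2, g3, g4, g5⟩
      · exact Or.inl (.cons ⟨h1, e⟩ ih)
      · exact Or.inr ⟨by simp [g1], by simp [g2], c :: p1, p2, .cons h1 g3, g4, by simp [g5]⟩

/-- all linkages use a `P`-essential arc, on a unique path. -/
theorem EP.uses (h : N.EP a b) {p} (hp : Lk N.T N.sg N.K p) :
    ∃ σ k, N.K k ∧ a ∈ p σ ∧ b ∈ p σ ∧ ∃ p1 p2, Wk N.T (N.sg σ) a p1 ∧ Wk N.T b k p2 ∧ p σ = p1 ++ p2 := by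
  by_contra hc
  refine h.2 ⟨p, fun σ => ?_, hp.2⟩
  obtain ⟨k, h1, h2⟩ := hp.1 σ
  rcases wk_uses h2 a b with g | g
  · exact ⟨k, h1, g⟩
  · exact (hc ⟨σ, k, h1, g⟩).elim

/-- before the arc / after the arc -/
theorem split_mem {T : X → X → Prop} (hlt : ∀ {x y}, T x y → x < y) {c k : X} {p1 p2 : List X} (h1 : Wk T c a p1) (h2 : Wk T b k p2)
    (hx : x ∈ p1 ++ p2) : x ≤ a ∨ b ≤ x := by
  rcases List.mem_append.1 hx with h | h
  · exact Or.inl (rtg_le hlt (h1.to_last h))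
  · exact Or.inr (rtg_le hlt (h2.from_head h))

/-- the separator of a P-essential arc -/
theorem EP.sep [Finite X] (h : N.EP a b) : ∃ z, ∀ σ, ¬ Av (cut N.T a b) N.K z (N.sg σ) := by
  by_contra! hc
  have hne : N.sg false ≠ N.sg true := fun e => by
    obtain ⟨k, _, h1⟩ := N.lk.1 false
    obtain ⟨k, _, h2⟩ := N.lk.1 true
    exact N.lk.2 (by decide : false ≠ true) h1.mem_head (e ▸ h2.mem_head)
  obtain ⟨p, q, h1, h2, h3⟩ := pebble (K := N.K) (cut_lt (N := N) (a := a) (b := b)) _ _ hne fun z => by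
    obtain ⟨σ, hσ⟩ := hc z
    cases σ
    · exact Or.inl hσ
    · exact Or.inr hσ
  refine h.2 ⟨fun σ => if σ then q else p, fun σ => ?_, ?_⟩
  · cases σ
    · exact h1
    · exact h2
  · intro σ τ hs x hx hy
    cases σ <;> cases τ <;> simp at hs hx hy
    · exact h3 x hx hy
    · exact h3 x hy hx

inductive Rc (T : X → X → Prop) (sg : Bool → X) (z : X) : X → Prop
  | base (σ) : sg σ ≠ z → Rc T sg z (sg σ)
  | step {x' y'} : Rc T sg z x' → T x' y' → y' ≠ z → Rc T sg z y'

theorem Rc.ne {T : X → X → Prop} {sg : Bool → X} {z x} (h : Rc T sg z x) : x ≠ z := by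
  cases h <;> assumption

theorem Rc.not_av {T : X → X → Prop} {sg : Bool → X} {K : X → Prop} {z x} (h : Rc T sg z x)
    (hs : ∀ σ, ¬ Av T K z (sg σ)) : ¬ Av T K z x := by
  induction h with
  | base σ _ => exact hs σ
  | step h1 h2 _ ih => exact fun h => ih (.step h2 h1.ne h)

theorem wk_rc {T : X → X → Prop} {sg : Bool → X} {z c k p} (h : Wk T c k p) (hc : Rc T sg z c)
    {x} (hx : x ∈ p) (hz : z ∉ p ∨ (∀ y ∈ p, ReflTransGen T y x → y ≠ z)) : Rc T sg z x := by
  induction h with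
  | nil a => simp at hx; subst hx; exact hc
  | cons h1 h2 ih =>
    rename_i c d k p
    rcases List.mem_cons.1 hx with rfl | hx
    · exact hc
    · refine ih (.step hc h1 ?_) hx ?_
      · rcases hz with hz | hz
        · rintro rfl; exact hz (by simp [h2.mem_head])
        · exact hz _ (by simp [h2.mem_head]) (h2.from_head hx)
      · rcases hz with hz | hz
        · left; simp at hz; exact hz.2
        · right; exact fun y hy => hz y (by simp [hy])

theorem wk_av_of {T : X → X → Prop} (hlt : ∀ {x y}, T x y → x < y) {K : X → Prop} {z c k p} (h : Wk T c k p) (hk : K k) {x} (hx : x ∈ p) (hz : z < x ∨ z ∉ p) :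
    Av T K z x := by
  induction h with
  | nil a => 
    simp at hx; subst hx
    exact .base hk (by rcases hz with hz | hz; exact hz.ne'; simp at hz; exact fun e => hz e.symm)
  | cons h1 h2 ih =>
    rename_i c d k p
    have hz' : z < x ∨ z ∉ p := hz.imp id (by simp)
    rcases List.mem_cons.1 hx with rfl | hx
    · refine .step h1 (by rcases hz with hz | hz; exact hz.ne'; simp at hz; exact fun e => hz.1 e.symm) ?_
      rcases hz with hz | hz
      · exact Wk.av (h2) hk fun hm => (hz.trans (hlt h1)).not_ge (rtg_le hlt (h2.from_head hm))
      · simp at hz; exact Wk.av h2 hk hz.2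
    · exact ih hk hx hz'

theorem EP.facts [Finite X] (h : N.EP a b) : ∃ (σ : Bool) (z : X) (A : X → Prop),
    a ∈ N.psi σ ∧ b ∈ N.psi σ ∧ (∀ x ∈ N.psi σ, x ≤ a ∨ b ≤ x) ∧ z ∈ N.psi (!σ) ∧
    (∀ x ∈ N.psi σ, A x ↔ x < b) ∧ (∀ x ∈ N.psi (!σ), A x ↔ x < z) ∧
    (∀ x y, A x → x ≤ y → ¬ A y → (x ≤ z ∧ z ≤ y) ∨ (x ≤ a ∧ b ≤ y)) ∧
    (∀ p, Lk N.T N.sg N.K p → (∃ τ, z ∈ p τ) ∧ (∃ τ, b ∈ p τ ∧ ∀ x ∈ p τ, x ≤ a ∨ b ≤ x) ∧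
      ∀ τ, z ∈ p τ ∨ (b ∈ p τ ∧ ∀ x ∈ p τ, x ≤ a ∨ b ≤ x)) := by
  obtain ⟨σ, k, hk, ha, hb, p1, p2, w1, w2, hp⟩ := h.uses N.lk
  obtain ⟨z, hz⟩ := h.sep
  have hdis : ∀ {x}, x ∈ N.psi σ → x ∉ N.psi (!σ) := fun hx => N.lk.2 (by cases σ <;> decide) hx
  have hspl : ∀ x ∈ N.psi σ, x ≤ a ∨ b ≤ x := fun x hx => split_mem N.lt w1 w2 (hp ▸ hx)
  obtain ⟨k', hk', w'⟩ := N.lk.1 (!σ)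
  have w'c : Wk (cut N.T a b) (N.sg (!σ)) k' (N.psi (!σ)) := walk_cut w' (hdis hb) rfl
  have hzm : z ∈ N.psi (!σ) := by
    by_contra hc
    exact hz _ (w'c.av hk' hc)
  have hzs : z ∉ N.psi σ := fun hc => hdis hc hzm
  have hlab := N.lt h.1
  have bp1 : b ∉ p1 := fun hc => (rtg_le N.lt (w1.to_last hc)).not_gt hlab
  have w1c : Wk (cut N.T a b) (N.sg σ) a p1 := walk_cut w1 bp1 rfl
  have w2c : Wk (cut N.T a b) b k p2 := w2.mono fun x y hx _ hT =>
    ⟨hT, fun e => (rtg_le N.lt (w2.from_head hx)).not_gt (e.1 ▸ hlab)⟩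
  refine ⟨σ, z, Rc (cut N.T a b) N.sg z, ha, hb, hspl, hzm, ?_, ?_, ?_, ?_⟩
  · intro x hx
    constructor
    · intro hA
      rw [hp] at hx
      rcases List.mem_append.1 hx with h1 | h1
      · exact (rtg_le N.lt (w1.to_last h1)).trans_lt hlab
      · exact (hA.not_av hz (wk_av_of cut_lt w2c hk h1 (Or.inr fun hc => hzs (by rw [hp]; simp [hc])))).elim
    · intro hlt
      rw [hp] at hx
      rcases List.mem_append.1 hx with h1 | h1
      · refine wk_rc w1c (.base σ ?_) h1 (Or.inl fun hc => hzs (by rw [hp]; simp [hc]))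
        intro e
        exact hzs (by rw [hp, ← e]; simp [w1.mem_head])
      · exact absurd hlt (rtg_le N.lt (w2.from_head h1)).not_gt
  · intro x hx
    constructor
    · intro hA
      have hne := hA.ne
      rcases w'.total hx hzm with h1 | h1
      · exact lt_of_le_of_ne (rtg_le N.lt h1) hne
      · exact (hA.not_av hz (wk_av_of cut_lt w'c hk' hx
          (Or.inl (lt_of_le_of_ne (rtg_le N.lt h1) hne.symm)))).elim
    · intro hlt
      refine wk_rc w'c (.base _ ?_) hx (Or.inr fun y _ hyx => ?_)
      · intro e
        exact (rtg_le N.lt (w'.from_head hx)).not_gt (e ▸ hlt)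
      · rintro rfl
        exact (rtg_le cut_lt hyx).not_gt hlt
  · intro x y hA hxy
    have := N.le hxy
    clear hxy
    induction this with
    | refl => exact fun hn => (hn hA).elim
    | tail h1 h2 ih =>
      rename_i c d
      intro hn
      by_cases hc : Rc (cut N.T a b) N.sg z c
      · by_cases hd : d = z
        · subst hd
          exact Or.inl ⟨(rtg_le N.lt h1).trans (N.lt h2).le, le_rfl⟩
        · by_cases e : c = a ∧ d = b
          · obtain ⟨rfl, rfl⟩ := e
            exact Or.inr ⟨rtg_le N.lt h1, le_rfl⟩
          · exact (hn (.step hc ⟨h2, e⟩ hd)).elim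
      · have := (N.lt h2).le
        exact (ih hc).imp (fun q => ⟨q.1, q.2.trans this⟩) (fun q => ⟨q.1, q.2.trans this⟩)
  · intro p hpl
    obtain ⟨τ, k1, _, ha', hb', p1, p2, w1, w2, hp'⟩ := h.uses hpl
    have g1 : b ∈ p τ ∧ ∀ x ∈ p τ, x ≤ a ∨ b ≤ x :=
      ⟨hb', fun x hx => split_mem N.lt w1 w2 (hp' ▸ hx)⟩
    have g2 : z ∈ p (!τ) := by
      obtain ⟨k2, hk2, w2⟩ := hpl.1 (!τ)
      by_contra hc
      refine hz _ ((walk_cut (N := N) w2 (hpl.2 (by cases τ <;> decide) hb') rfl).av hk2 hc)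
    refine ⟨⟨_, g2⟩, ⟨_, g1⟩, fun ρ => ?_⟩
    by_cases e : ρ = τ
    · exact Or.inr (e ▸ g1)
    · have : ρ = !τ := by cases ρ <;> cases τ <;> simp_all
      exact Or.inl (this ▸ g2)

/-- flexibility lemma : a linkage avoiding a non-essential arc -/
theorem Ei.flex (h : N.Ei i a b) (hP : ¬ N.EP a b) : ∃ p, Lk N.T N.sg N.K p ∧
    ∀ τ x y, x ∈ p τ → y ∈ p τ → N.s i ≤ x → y ≤ N.t i → x < b → b ≤ y → False := by
  have : ∃ p, Lk (cut N.T a b) N.sg N.K p := by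
    by_contra hc; exact hP ⟨h.1, hc⟩
  obtain ⟨p, hp⟩ := this
  refine ⟨p, Lk_mono hp fun _ _ h => h.1, fun τ x y hx hy hs ht hxb hby => ?_⟩
  obtain ⟨k, _, w⟩ := hp.1 τ
  rcases h.seg hs ht (w.seg cut_lt hx hy (hxb.le.trans hby)) with h1 | h1
  · exact h1.not_gt hxb
  · exact (hby.trans h1).not_gt (N.lt h.1)

theorem EP.unique [Finite X] (h : N.EP a b) (h' : N.EP w b) : a = w := by
  obtain ⟨σ, _, _, ha, hb, hs, _⟩ := h.facts
  obtain ⟨σ', _, _, ha', hb', hs', _⟩ := h'.facts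
  have : σ = σ' := by
    by_contra hc; exact N.lk.2 hc hb hb'
  subst this
  exact le_antisymm ((hs' a ha).resolve_right (N.lt h.1).not_ge) ((hs w ha').resolve_right (N.lt h'.1).not_ge)

variable (N)
def MgP (v : X) : Prop := ∃ g f, N.EP g v ∧ N.T f v ∧ f ≠ g
def MgU (v : X) : Prop := (∃ x y, N.T x v ∧ N.T y v ∧ x ≠ y) ∧ ∀ g, ¬ N.EP g v

structure DP (v g f : X) (i : I) (σ : Bool) (z : X) (A : X → Prop) : Prop where
  ep : N.EP g v
  ei : N.Ei i f v
  ne : f ≠ g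
  g_ps : g ∈ N.psi σ
  v_ps : v ∈ N.psi σ
  spl : ∀ x ∈ N.psi σ, x ≤ g ∨ v ≤ x
  z_ps : z ∈ N.psi (!σ)
  A1 : ∀ x ∈ N.psi σ, A x ↔ x < v
  A2 : ∀ x ∈ N.psi (!σ), A x ↔ x < z
  c2 : ∀ x y, A x → x ≤ y → ¬ A y → (x ≤ z ∧ z ≤ y) ∨ (x ≤ g ∧ v ≤ y)
  lk : ∀ p, Lk N.T N.sg N.K p → (∃ τ, z ∈ p τ) ∧ (∃ τ, v ∈ p τ ∧ ∀ x ∈ p τ, x ≤ g ∨ v ≤ x) ∧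
      ∀ τ, z ∈ p τ ∨ (v ∈ p τ ∧ ∀ x ∈ p τ, x ≤ g ∨ v ≤ x)

structure DU (v f g : X) (i j : I) : Prop where
  ei : N.Ei i f v
  ej : N.Ei j g v
  ne : f ≠ g
  ep : ∀ g, ¬ N.EP g v
variable {N}

theorem MgP.dp [Finite X] (h : N.MgP v) : ∃ g f i σ z A, N.DP v g f i σ z A := by
  obtain ⟨g, f, h1, h2, h3⟩ := h
  rcases N.ess _ _ h2 with ⟨i, hi⟩ | hp
  · obtain ⟨σ, z, A, q1, q2, q3, q4, q5, q6, q7, q8⟩ := h1.facts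
    exact ⟨g, f, i, σ, z, A, h1, ⟨h2, hi⟩, h3, q1, q2, q3, q4, q5, q6, q7, q8⟩
  · exact (h3 (EP.unique ⟨h2, hp⟩ h1)).elim

theorem MgU.du (h : N.MgU v) : ∃ f g i j, N.DU v f g i j := by
  obtain ⟨⟨x, y, h1, h2, h3⟩, h4⟩ := h
  rcases N.ess _ _ h1 with ⟨i, hi⟩ | hp
  · rcases N.ess _ _ h2 with ⟨j, hj⟩ | hp
    · exact ⟨x, y, i, j, ⟨h1, hi⟩, ⟨h2, hj⟩, h3, h4⟩
    · exact (h4 _ ⟨h2, hp⟩).elim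
  · exact (h4 _ ⟨h1, hp⟩).elim

theorem DP.R_g {g f σ z A} (h : N.DP v g f i σ z A) : ¬ N.s i ≤ g := fun hc =>
  h.ne (h.ei.pred h.ep.1 hc).symm

theorem DP.min {g f σ z A} (h : N.DP v g f i σ z A) (hx : x ∈ N.psi σ) (hR : N.s i ≤ x) : v ≤ x :=
  (h.spl x hx).resolve_left fun hc => h.R_g (hR.trans hc)

theorem DP.uniq {g f g' f' σ z A z' A'} (h : N.DP v g f i σ z A) (h' : N.DP w g' f' i σ z' A') : v = w :=
  le_antisymm (h.min h'.v_ps h'.ei.R) (h'.min h.v_ps h.ei.R)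

theorem DU.symm {f g} (h : N.DU v f g i j) : N.DU v g f j i := ⟨h.ej, h.ei, h.ne.symm, h.ep⟩

theorem DU.ij {f g} (h : N.DU v f g i j) : i ≠ j := by
  rintro rfl
  exact h.ne (h.ei.pred h.ej.1 h.ej.rt.1).symm

theorem DU.e1 {f g} (h : N.DU v f g i j) (hi : N.s i ≤ x) (hj : N.s j ≤ x) : ¬ x < v :=
  h.ei.e1 h.ej h.ne hi hj

theorem DU.uniq {f g f' g'} (h : N.DU v f g i j) (h' : N.DU w f' g' i j) : v = w := by
  have h1 := h.e1 h'.ei.R h'.ej.R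
  have h2 := h'.e1 h.ei.R h.ej.R
  rcases h.ei.cmp h'.ei.R h'.ei.rt.2 with h3 | h3
  · rcases h3.eq_or_lt with h3 | h3
    · exact h3.symm
    · exact (h1 h3).elim
  · rcases h3.eq_or_lt with h3 | h3
    · exact h3
    · exact (h2 h3).elim

theorem DP.flexA {g f g' f' σ τ z A z' A' e e'} (h : N.DP v g f i σ z A) (h' : N.DP w g' f' i τ z' A')
    (hu : N.DU x e e' i j) (hwv : w < v) (hxz : x ≤ z) (hz : z < v) : ¬ w < x := by
  intro hwx
  obtain ⟨p, hp, H⟩ := hu.ei.flex (hu.ep _)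
  obtain ⟨_, ⟨ρ, hw, hs⟩, _⟩ := h'.lk p hp
  rcases (h.lk p hp).2.2 ρ with g1 | ⟨g1, g2⟩
  · exact H ρ w z hw g1 h'.ei.R (hz.le.trans h.ei.rt.2) hwx hxz
  · rcases g2 w hw with g3 | g3
    · exact h.R_g (h'.ei.R.trans g3)
    · exact g3.not_gt hwv

theorem DP.flexB {g f g' f' σ τ z A z' A' e e' b1 b2 b3 ρ B} (h : N.DP v g f i σ z A) (h' : N.DP w g' f' i τ z' A')
    (h2 : N.DP b1 b2 b3 j ρ x B)
    (hu : N.DU x e e' i j) (hvw : v < w) (hwx : w < x) : False := by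
  obtain ⟨p, hp, H⟩ := hu.ei.flex (hu.ep _)
  obtain ⟨_, ⟨ρ, hw, hs⟩, _⟩ := h'.lk p hp
  obtain ⟨_, ⟨ρ', hv, _⟩, _⟩ := h.lk p hp
  obtain ⟨⟨ρ2, hx⟩, _⟩ := h2.lk p hp
  have hxt := hu.ei.rt.2
  by_cases e1 : ρ = ρ'
  · subst e1
    rcases hs v hv with g1 | g1
    · exact h'.R_g (h.ei.R.trans g1)
    · exact g1.not_gt hvw
  · by_cases e2 : ρ2 = ρ
    · subst e2; exact H _ _ _ hw hx h'.ei.R hxt hwx le_rfl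
    · have : ρ2 = ρ' := by cases ρ <;> cases ρ' <;> cases ρ2 <;> simp_all
      subst this; exact H _ _ _ hv hx h.ei.R hxt (hvw.trans hwx) le_rfl

end Net
end Wlk

namespace Wlk
open Relation Classical
namespace Net
variable {X I : Type} [PartialOrder X] {N : Net X I}

theorem exists_cfg [Finite X] [Nonempty I] : ∃ (C : Cfg X I) (own : X → I) (sd : X → Bool) (l1 l2 : X → I),
    (∀ v, N.MgP v → C.has (sd v) (own v)) ∧ 
    (∀ v w, N.MgP v → N.MgP w → own v = own w → sd v = sd w → v = w) ∧
    (∀ v, N.MgU v → C.adj (l1 v) (l2 v) ∧ l1 v ≠ l2 v) ∧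
    (∀ v w, N.MgU v → N.MgU w → s(l1 v, l2 v) = s(l1 w, l2 w) → v = w) := by
  have : Nonempty X := ⟨N.sg true⟩
  have hP : ∀ v, ∃ g f i σ z A, N.MgP v → N.DP v g f i σ z A := fun v => by
    by_cases h : N.MgP v
    · obtain ⟨g, f, i, σ, z, A, h⟩ := h.dp; exact ⟨g, f, i, σ, z, A, fun _ => h⟩
    · exact ⟨v, v, Classical.arbitrary _, true, v, fun _ => True, fun h' => (h h').elim⟩
  have hU : ∀ v, ∃ f g i j, N.MgU v → N.DU v f g i j := fun v => by
    by_cases h : N.MgU v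
    · obtain ⟨f, g, i, j, h⟩ := h.du; exact ⟨f, g, i, j, fun _ => h⟩
    · exact ⟨v, v, Classical.arbitrary _, Classical.arbitrary _, fun h' => (h h').elim⟩
  choose g f own sd z A dp using hP
  choose f1 f2 l1 l2 du using hU
  let has : Bool → I → Prop := fun σ i => ∃ v, N.MgP v ∧ own v = i ∧ sd v = σ
  let c : Bool → I → X := fun σ i => Classical.epsilon fun v => N.MgP v ∧ own v = i ∧ sd v = σ
  have hc : ∀ {σ i}, has σ i → N.MgP (c σ i) ∧ own (c σ i) = i ∧ sd (c σ i) = σ := fun h =>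
    Classical.epsilon_spec h
  have hD : ∀ {σ i}, has σ i → N.DP (c σ i) (g (c σ i)) (f (c σ i)) i σ (z (c σ i)) (A (c σ i)) := fun h => by
    obtain ⟨h1, h2, h3⟩ := hc h
    have := dp _ h1
    rw [h2, h3] at this
    exact this
  let adj : I → I → Prop := fun i j => ∃ v, N.MgU v ∧ s(l1 v, l2 v) = s(i, j)
  let uu : Sym2 I → X := fun e => Classical.epsilon fun v => N.MgU v ∧ s(l1 v, l2 v) = e
  have hu : ∀ {i j}, adj i j → N.MgU (uu s(i, j)) ∧ s(l1 (uu s(i, j)), l2 (uu s(i, j))) = s(i, j) := fun h =>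
    Classical.epsilon_spec h
  have hE : ∀ {i j}, adj i j → ∃ f g, N.DU (uu s(i, j)) f g i j := fun h => by
    obtain ⟨h1, h2⟩ := hu h
    have := du _ h1
    rw [Sym2.eq_iff] at h2
    rcases h2 with ⟨h2, h3⟩ | ⟨h2, h3⟩
    · rw [h2, h3] at this; exact ⟨_, _, this⟩
    · rw [h2, h3] at this; exact ⟨_, _, this.symm⟩
  have nn : ∀ {σ τ : Bool}, σ ≠ τ → τ = !σ := fun {σ τ} h => by cases σ <;> cases τ <;> simp_all
  refine ⟨{
    R := fun i x => N.s i ≤ x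
    t := N.t
    ps := fun σ x => x ∈ N.psi σ
    has := has
    c := c
    z := fun σ i => z (c σ i)
    ga := fun σ i => g (c σ i)
    A := fun σ i => A (c σ i)
    adj := adj
    u := fun i j => uu s(i, j)
    R_up := fun h h' => h.trans h'
    chain := fun {σ x y} hx hy => by
      obtain ⟨k, _, w⟩ := N.lk.1 σ
      exact (w.total hx hy).imp (rtg_le N.lt) (rtg_le N.lt)
    disj := fun hs hx hy e => N.lk.2 hs hx (e ▸ hy)
    c_ps := fun h => (hD h).v_ps
    z_ps := fun hs h => nn hs ▸ (hD h).z_ps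
    ga_lt := fun h => N.lt (hD h).ep.1
    R_c := fun h => (hD h).ei.R
    c_t := fun h => (hD h).ei.rt.2
    min_c := fun h h1 h2 => (hD h).min h1 h2
    R_ga := fun h => (hD h).R_g
    A_lt := fun h hx => (hD h).A1 _ hx
    A_z := fun hs h hx => (hD h).A2 _ (nn hs ▸ hx)
    c1 := fun {σ i y} h hR hlt hA => by
      have hv : ¬ A (c σ i) (c σ i) := fun hA => lt_irrefl _ (((hD h).A1 _ (hD h).v_ps).1 hA)
      rcases (hD h).c2 _ _ hA hlt.le hv with h1 | h1
      · exact ⟨h1.1, lt_of_le_of_ne h1.2 fun e =>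
          N.lk.2 (by cases σ <;> decide) (hD h).v_ps (e ▸ (hD h).z_ps)⟩
      · exact ((hD h).R_g (hR.trans h1.1)).elim
    c2 := fun h hA hxy hy => (hD h).c2 _ _ hA hxy hy
    byp_c := fun {σ τ i x y} hs h hx hy hxy hR ht => by
      obtain ⟨k, _, w⟩ := N.lk.1 τ
      exact (hD h).ei.byp w hx hy hxy hR ht (N.lk.2 hs (hD h).v_ps)
    cmp_c := fun h hR ht => (hD h).ei.cmp hR ht
    c_inj := fun h h' e => by rw [← (hc h).2.1, e, (hc h').2.1]
    adj_symm := fun {i j} h => by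
      obtain ⟨v, h1, h2⟩ := h
      exact ⟨v, h1, h2.trans Sym2.eq_swap⟩
    adj_irr := fun h => by
      obtain ⟨_, _, h⟩ := hE h
      exact h.ij rfl
    u_symm := fun i j => by rw [Sym2.eq_swap]
    R_u := fun h => by obtain ⟨_, _, h⟩ := hE h; exact h.ei.R
    u_t := fun h => by obtain ⟨_, _, h⟩ := hE h; exact h.ei.rt.2
    e1 := fun h h1 h2 => by obtain ⟨_, _, h⟩ := hE h; exact h.e1 h1 h2
    cmp_u := fun h h1 h2 => by obtain ⟨_, _, h⟩ := hE h; exact h.ei.cmp h1 h2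
    byp_u := fun {τ i j x y} h hx hy hxy hR ht hn => by
      obtain ⟨_, _, h⟩ := hE h
      obtain ⟨k, _, w⟩ := N.lk.1 τ
      exact h.ei.byp w hx hy hxy hR ht hn
    u_ne := fun h h' e => (hu h).1.2 _ (e ▸ (hD h').ep)
    u_inj := fun {i i' j} h h' hne e => by
      have h1 := (hu h).2
      have h2 := (hu h').2
      rw [e, h2, Sym2.eq_iff] at h1
      rcases h1 with h1 | h1
      · exact hne h1.1.symm
      · exact hne (h1.1.trans h1.2).symm
    flexA := fun hs h h' ha h1 h2 h3 => by
      obtain ⟨_, _, hE⟩ := hE ha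
      exact (hD h).flexA (hD h') hE h1 h2 h3
    flexB := fun {σ τ i j} hs h h' hj ha h1 h2 h3 _ => by
      obtain ⟨_, _, hE⟩ := hE ha
      have := hD hj
      rw [← h3] at this
      exact (hD h).flexB (hD h') this hE h1 h2 }, own, sd, l1, l2, ?_, ?_, ?_, ?_⟩
  · exact fun v hv => ⟨v, hv, rfl, rfl⟩
  · intro v w hv hw e1 e2
    have h1 := dp v hv
    have h2 := dp w hw
    rw [e1, e2] at h1
    exact h1.uniq h2
  · exact fun v hv => ⟨⟨v, hv, rfl⟩, (du v hv).ij⟩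
  · intro v w hv hw e
    have h1 := du v hv
    have h2 := du w hw
    rcases Sym2.eq_iff.1 e with ⟨e1, e2⟩ | ⟨e1, e2⟩
    · rw [e1, e2] at h1; exact h1.uniq h2
    · rw [e1, e2] at h1; exact h1.symm.uniq h2

theorem bound [Fintype X] [Fintype I] [Nonempty I] :
    Set.ncard {v | ∃ x y, N.T x v ∧ N.T y v ∧ x ≠ y} ≤ Bd (Fintype.card I) := by
  obtain ⟨C, own, sd, l1, l2, h1, h2, h3, h4⟩ := exists_cfg (N := N)
  have hcount := C.count _ Finset.univ (Finset.card_univ (α := I))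
  have hsub : {v | ∃ x y, N.T x v ∧ N.T y v ∧ x ≠ y} ⊆ {v | N.MgP v} ∪ {v | N.MgU v} := by
    rintro v ⟨x, y, hx, hy, hne⟩
    by_cases h : ∃ g, N.EP g v
    · obtain ⟨g, hg⟩ := h
      left
      by_cases e : x = g
      · exact ⟨g, y, hg, hy, fun e' => hne (e.trans e'.symm)⟩
      · exact ⟨g, x, hg, hx, e⟩
    · exact Or.inr ⟨⟨x, y, hx, hy, hne⟩, fun g hg => h ⟨g, hg⟩⟩
  have hle := Set.ncard_le_ncard hsub (Set.toFinite _)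
  have hun := Set.ncard_union_le {v | N.MgP v} {v | N.MgU v}
  have hP : Set.ncard {v | N.MgP v} ≤ ∑ i, C.w i := by
    have e : ∑ i, C.w i = ((Finset.univ : Finset (I × Bool)).filter fun q => C.has q.2 q.1).card := by
      rw [Finset.card_filter, Fintype.sum_prod_type]
      refine Finset.sum_congr rfl fun i _ => ?_
      rw [Fintype.sum_bool, add_comm]; rfl
    rw [e, ← Set.ncard_coe_finset]
    refine Set.ncard_le_ncard_of_injOn (fun v => (own v, sd v)) ?_ ?_ (Set.toFinite _)
    · intro v hv; simpa using h1 v hv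
    · intro v hv w hw e
      simp at e
      exact h2 v w hv hw e.1 e.2
  have hU : 2 * Set.ncard {v | N.MgU v} ≤ C.e Finset.univ Finset.univ := by
    have e : C.e Finset.univ Finset.univ = ((Finset.univ : Finset (I × I)).filter fun q => C.adj q.1 q.2).card := by
      rw [Finset.card_filter, Fintype.sum_prod_type, Cfg.e]
    rw [e, ← Set.ncard_coe_finset]
    have e2 : 2 * Set.ncard {v | N.MgU v} = Set.ncard ({v | N.MgU v} ×ˢ (Set.univ : Set Bool)) := by
      rw [Set.ncard_prod, Set.ncard_univ]; simp [mul_comm]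
    rw [e2]
    refine Set.ncard_le_ncard_of_injOn (fun q => if q.2 then (l1 q.1, l2 q.1) else (l2 q.1, l1 q.1)) ?_ ?_ (Set.toFinite _)
    · rintro ⟨v, b⟩ ⟨hv, -⟩
      have := (h3 v hv).1
      cases b <;> simp
      · exact C.adj_symm this
      · exact this
    · rintro ⟨v, b⟩ ⟨hv, -⟩ ⟨w, b'⟩ ⟨hw, -⟩ e
      have n1 := (h3 v hv).2
      simp only at e
      have hvw : v = w := by
        refine h4 v w hv hw (Sym2.eq_iff.2 ?_)
        cases b <;> cases b' <;> simp at e <;> tauto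
      subst hvw
      cases b <;> cases b' <;> simp at e <;> first | rfl | exact (n1 e.1).elim | exact (n1 e.2).elim | exact (n1 e.1.symm).elim
  omega

end Net
end Wlk

namespace Wlk
open Relation Classical

theorem path_wk {G : MultiDigraph} {u v : G.V} {p : List G.E} (h : G.IsPathFrom u v p) :
    ∃ a b, Wk (fun e f => G.dst e = G.src f) a b p ∧ G.src a = u ∧ G.dst b = v := by
  obtain ⟨h1, h2, h3, h4⟩ := h
  obtain ⟨a, ha⟩ : ∃ a, p.head? = some a := by cases p; exact (h1 rfl).elim; exact ⟨_, rfl⟩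
  obtain ⟨b, hb⟩ : ∃ b, p.getLast? = some b := ⟨_, List.getLast?_eq_some_getLast h1⟩
  exact ⟨a, b, Wk.of_chain h2 ha hb, h3 a ha, h4 b hb⟩

theorem wk_path {G : MultiDigraph} {p : List G.E} {a b} (h : Wk (fun e f => G.dst e = G.src f) a b p) :
    G.IsPathFrom (G.src a) (G.dst b) p := by
  refine ⟨h.ne_nil, h.chain, ?_, ?_⟩
  · intro e he; rw [h.head?] at he; simp at he; rw [he]
  · intro e he; rw [h.last?] at he; simp at he; rw [he]

theorem infix_T {X : Type} {T : X → X → Prop} {p : List X} {a b : X} (h : List.IsChain T p) (hi : [a, b] <:+: p) : T a b := by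
  have := h.infix hi
  simpa using this

theorem upper (k : ℕ) (hk : 0 < k) (c : Fin (k + 1) → ℕ) (hc1 : ∀ i : Fin k, c i.castSucc = 1)
    (hc2 : c (Fin.last k) = 2) : MAtMost c (Bd k) := by
  intro G S R ⟨hac, _, hmin⟩ _
  have := G.fintE
  have : Nonempty (Fin k) := ⟨⟨0, hk⟩⟩
  let B : G.E → G.E → Prop := fun e f => G.dst e = G.src f
  have hsing : ∀ i : Fin k, ∃ a b, (∃ p, Wk B a b p) ∧ G.src a = S i.castSucc ∧ G.dst b = R i.castSucc := by
    intro i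
    obtain ⟨⟨α, hα⟩, _⟩ := hmin i.castSucc
    obtain ⟨a, b, h1, h2, h3⟩ := path_wk (hα.1 ⟨0, by rw [hc1]; exact one_pos⟩)
    exact ⟨a, b, ⟨_, h1⟩, h2, h3⟩
  choose s t hst hs ht using hsing
  obtain ⟨⟨α, hα⟩, _⟩ := hmin (Fin.last k)
  let ix : Bool → Fin (c (Fin.last k)) := fun b => if b then ⟨1, by rw [hc2]; exact one_lt_two⟩ else ⟨0, by rw [hc2]; exact two_pos⟩
  have ixne : ∀ {b b'}, b ≠ b' → ix b ≠ ix b' := by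
    intro b b' h; cases b <;> cases b' <;> simp [ix] at h ⊢
  have hpair : ∀ b : Bool, ∃ a d, Wk B a d (α (ix b)) ∧ G.src a = S (Fin.last k) ∧ G.dst d = R (Fin.last k) :=
    fun b => path_wk (hα.1 _)
  choose sg tg hw hsg htg using hpair
  let K : G.E → Prop := fun x => G.dst x = R (Fin.last k)
  let rel : Finset (G.E × G.E) → G.E → G.E → Prop := fun T x y => (x, y) ∈ T
  let Fe : Finset (G.E × G.E) → Prop := fun T => (∀ q ∈ T, B q.1 q.2) ∧
    (∀ i, ReflTransGen (rel T) (s i) (t i)) ∧ ∃ p, Lk (rel T) sg K p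
  have hex : Fe (Finset.univ.filter fun q => B q.1 q.2) := by
    have e : rel (Finset.univ.filter fun q => B q.1 q.2) = B := by
      funext x y; simp [rel]
    refine ⟨fun q hq => (Finset.mem_filter.1 hq).2, ?_, fun b => α (ix b), ?_, ?_⟩
    · intro i; rw [e]
      obtain ⟨p, hp⟩ := hst i
      exact hp.from_head hp.mem_last
    · intro b; rw [e]; exact ⟨tg b, htg b, hw b⟩
    · intro b b' hb x; exact hα.2 _ _ (ixne hb) x
  obtain ⟨T, hT⟩ := (Set.toFinite {T | Fe T}).exists_minimal ⟨_, hex⟩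
  obtain ⟨hTB, hTs, psi, hTp⟩ := hT.1
  have hrB : ∀ x y, rel T x y → B x y := fun x y h => hTB (x, y) h
  have acyc : ∀ {x y}, ReflTransGen (rel T) x y → ¬ B y x := by
    intro x y h hB
    obtain ⟨p, hp⟩ := Wk.of_rtg h
    have := wk_path (hp.mono' hrB)
    rw [show G.dst y = G.src x from hB] at this
    exact hac _ _ this
  letI PO : PartialOrder G.E := {
    le := ReflTransGen (rel T)
    le_refl := fun _ => .refl
    le_trans := fun _ _ _ => ReflTransGen.trans
    lt_iff_le_not_ge := fun _ _ => Iff.rfl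
    le_antisymm := fun a b h1 h2 => by
      rcases h2.cases_tail with h | ⟨w, h3, h4⟩
      · exact h
      · exact (acyc (h1.trans h3) (hrB _ _ h4)).elim }
  let N : Net G.E (Fin k) := {
    T := rel T
    s := s
    t := t
    sg := sg
    K := K
    psi := psi
    lt := fun {x y} h => lt_iff_le_not_ge.2 ⟨ReflTransGen.single h, fun h' => acyc h' (hrB _ _ h)⟩
    le := fun h => h
    st := hTs
    lk := hTp
    ess := fun a b hab => by
      by_contra hc
      push Not at hc
      have e : rel (T.erase (a, b)) = cut (rel T) a b := by
        funext x y; simp [rel, cut, and_comm]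
      have : Fe (T.erase (a, b)) := by
        refine ⟨fun q hq => hTB q (Finset.mem_of_mem_erase hq), ?_, ?_⟩
        · intro i; rw [e]; exact hc.1 i
        · rw [e]; exact hc.2
      have := hT.2 this (Finset.erase_subset _ _) hab
      simp at this }
  have hbd := Net.bound (N := N)
  rw [Fintype.card_fin] at hbd
  have hq : ∀ i : Fin k, ∃ p, Wk (rel T) (s i) (t i) p := fun i => Wk.of_rtg (hTs i)
  choose q hq using hq
  let q' : Fin (k + 1) → List G.E := Fin.lastCases [] q
  have hq' : ∀ i : Fin k, q' i.castSucc = q i := fun i => by simp [q']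
  let β : (i : Fin (k + 1)) → Fin (c i) → List G.E := fun i a =>
    if i = Fin.last k then psi (decide (a.val = 1)) else q' i
  have hβ : ∀ i a, List.IsChain (rel T) (β i a) := by
    intro i a
    refine Fin.lastCases (motive := fun i => ∀ a, List.IsChain (rel T) (β i a)) ?_ ?_ i a
    · intro a; simp only [β, if_true]
      obtain ⟨_, _, h⟩ := hTp.1 (decide (a.val = 1)); exact h.chain
    · intro j a; simp only [β, (Fin.castSucc_lt_last j).ne, if_false, hq']
      exact (hq j).chain
  refine ⟨β, ?_, ?_⟩
  · intro i
    refine Fin.lastCases (motive := fun i => G.MengerSystem (S i) (R i) (c i) (β i)) ?_ ?_ i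
    · constructor
      · intro a; simp only [β, if_true]
        obtain ⟨d, h1, h⟩ := hTp.1 (decide (a.val = 1))
        have := wk_path (h.mono' hrB)
        rw [hsg, show G.dst d = _ from h1] at this
        exact this
      · intro a b hab e he; simp only [β, if_true] at he ⊢
        refine hTp.2 ?_ he
        intro h
        apply hab
        have := a.2; have := b.2
        ext
        by_cases h1 : a.val = 1 <;> by_cases h2 : b.val = 1 <;> simp [h1, h2] at h ⊢
        omega
    · intro j
      have hj : j.castSucc ≠ Fin.last k := (Fin.castSucc_lt_last j).ne
      constructor
      · intro a; simp only [β, hj, if_false, hq']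
        have := wk_path ((hq j).mono' hrB)
        rw [hs, ht] at this
        exact this
      · intro a b hab
        exfalso
        have := a.2; have := b.2; have := hc1 j
        exact hab (by ext; omega)
  · refine le_trans (Set.ncard_le_ncard ?_ (Set.toFinite _)) hbd
    rintro e ⟨i, j, _, a, b, f, g, hfg, h1, h2⟩
    exact ⟨f, g, infix_T (hβ i a) h1, infix_T (hβ j b) h2, hfg⟩
end Wlk

namespace Wlk
open Relation Classical

structure Bld (J : Type) where
  X : Type
  fin : Fintype X
  T : X → X → Prop
  rho : X → ℕ
  s : J → X
  t : J → X
  sg : Bool → X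
  tg : Bool → X
  Q : Bool → X → Prop
  rk : ∀ {a b}, T a b → rho a < rho b
  T_sg : ∀ {a b}, ¬ T a (sg b)
  T_tg : ∀ {a b}, ¬ T (tg b) a
  s_inj : ∀ {i j}, s i = s j → i = j
  t_inj : ∀ {i j}, t i = t j → i = j
  s_sg : ∀ {i b}, s i ≠ sg b
  t_tg : ∀ {i b}, t i ≠ tg b
  st : ∀ i, ReflTransGen T (s i) (t i)
  Q_sg : ∀ b, Q b (sg b)
  Q_path : ∀ b, ReflTransGen (fun x y => T x y ∧ Q b y) (sg b) (tg b)
  Q_disj : ∀ {x}, Q false x → ¬ Q true x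

namespace Bld
variable {J : Type} (B : Bld J)

noncomputable def nin (x : B.X) : B.X := if x = B.sg true then B.sg false else x
noncomputable def nout (x : B.X) : B.X := if x = B.tg true then B.tg false else x

noncomputable def Gr : MultiDigraph where
  V := B.X × Bool
  E := B.X ⊕ {q : B.X × B.X // B.T q.1 q.2}
  fintV := by
    have := B.fin
    infer_instance
  fintE := by
    have := B.fin
    exact Fintype.ofFinite _
  src := fun e => match e with
    | .inl x => (B.nin x, false)
    | .inr q => (q.1.1, true)
  dst := fun e => match e with
    | .inl x => (B.nout x, true)
    | .inr q => (q.1.2, false)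

def R (e f : B.Gr.E) : Prop := B.Gr.dst e = B.Gr.src f

def ar {a b : B.X} (h : B.T a b) : B.Gr.E := Sum.inr ⟨(a, b), h⟩
def vx (a : B.X) : B.Gr.E := Sum.inl a

theorem e_cases (e : B.Gr.E) : (∃ x, e = B.vx x) ∨ ∃ a b, ∃ h : B.T a b, e = B.ar h := by
  rcases e with x | ⟨⟨a, b⟩, h⟩
  · exact Or.inl ⟨x, rfl⟩
  · exact Or.inr ⟨a, b, h, rfl⟩

theorem vx_inj {x y} (h : B.vx x = B.vx y) : x = y := Sum.inl.inj h
theorem ar_inj {a b c d} {h : B.T a b} {h' : B.T c d} (e : B.ar h = B.ar h') : a = c ∧ b = d := by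
  have := Sum.inr.inj e
  simpa using this

theorem vv {x y} : ¬ B.R (B.vx x) (B.vx y) := fun h => by
  have := congrArg Prod.snd h
  simp [vx, Gr] at this
theorem aa {a b c d} {h : B.T a b} {h' : B.T c d} : ¬ B.R (B.ar h) (B.ar h') := fun h => by
  have := congrArg Prod.snd h
  simp [ar, Gr] at this
theorem va {x a b} {h : B.T a b} : B.R (B.vx x) (B.ar h) ↔ x = a := by
  have h1 : B.R (B.vx x) (B.ar h) ↔ B.nout x = a := by simp [R, vx, ar, Gr]
  rw [h1, nout]
  split_ifs with e
  · subst e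
    constructor
    · rintro rfl; exact (B.T_tg h).elim
    · rintro rfl; exact (B.T_tg h).elim
  · rfl
theorem av {x a b} {h : B.T a b} : B.R (B.ar h) (B.vx x) ↔ x = b := by
  have h1 : B.R (B.ar h) (B.vx x) ↔ b = B.nin x := by simp [R, vx, ar, Gr]
  rw [h1, nin]
  split_ifs with e
  · subst e
    constructor
    · rintro rfl; exact (B.T_sg h).elim
    · rintro rfl; exact (B.T_sg h).elim
  · exact eq_comm

theorem acyclic : B.Gr.Acyclic := by
  intro v p hp
  obtain ⟨a, b, h, h1, h2⟩ := path_wk hp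
  let f : B.Gr.E → ℕ := fun e => Sum.elim (fun x => 2 * B.rho x) (fun q => 2 * B.rho q.1.1 + 1) e
  have hf : ∀ e e', B.R e e' → f e < f e' := by
    intro e e' hR
    rcases B.e_cases e with ⟨x, rfl⟩ | ⟨a, b, h, rfl⟩ <;>
      rcases B.e_cases e' with ⟨y, rfl⟩ | ⟨c, d, h', rfl⟩
    · exact (B.vv hR).elim
    · rw [B.va] at hR; subst hR; simp [f, vx, ar]
    · rw [B.av] at hR; subst hR
      have := B.rk h
      simp [f, vx, ar]; omega
    · exact (B.aa hR).elim
  have h3 : f b < f a := hf _ _ (h2.trans h1.symm)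
  have h4 : f a ≤ f b := by
    have := h.from_head h.mem_last
    clear h3 h2 h1 h hp
    induction this with
    | refl => exact le_rfl
    | tail _ h ih => exact ih.trans (hf _ _ h).le
  omega

/-- a path crossing into `D` -/
theorem cross (D : B.X → Prop) : ∀ (p : List B.Gr.E) {x y : B.X}, Wk B.R (B.vx x) (B.vx y) p → ¬ D x → D y →
    ∃ a b, ∃ h : B.T a b, ¬ D a ∧ D b ∧ [B.vx a, B.ar h, B.vx b] <:+: p := by
  intro p
  induction hn : p.length using Nat.strong_induction_on generalizing p with
  | _ n ih =>
  intro x y h hx hy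
  generalize e1 : B.vx x = e at h
  generalize e2 : B.vx y = e' at h
  cases h with
  | nil => subst e1; exact (hx (B.vx_inj e2 ▸ hy)).elim
  | cons h1 h2 =>
    subst e1
    rename_i d p
    rcases B.e_cases d with ⟨z, rfl⟩ | ⟨a, b, h, rfl⟩
    · exact (B.vv h1).elim
    rw [B.va] at h1
    subst h1
    generalize e3 : B.ar h = d at h2
    cases h2 with
    | nil => subst e3; cases e2
    | cons g1 g2 =>
      subst e3 e2
      rename_i d p
      rcases B.e_cases d with ⟨z, rfl⟩ | ⟨a, b, h, rfl⟩
      swap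
      · exact (B.aa g1).elim
      rw [B.av] at g1
      subst g1
      by_cases hz : D z
      · refine ⟨x, z, h, hx, hz, ?_⟩
        cases g2 with
        | nil => exact List.infix_rfl
        | cons _ _ => exact ⟨[], _, rfl⟩
      · obtain ⟨a, b, h', q1, q2, q3⟩ := ih p.length (by simp at hn; omega) p rfl g2 hz hy
        refine ⟨a, b, h', q1, q2, q3.trans ⟨[B.vx x, B.ar h], [], by simp⟩⟩

theorem expand {T' : B.X → B.X → Prop} (hT : ∀ x y, T' x y → B.T x y) {x y p} (h : Wk T' x y p) :
    ∃ q, Wk B.R (B.vx x) (B.vx y) q ∧ (∀ a, B.vx a ∈ q → a ∈ p) ∧ ∀ a b (h : B.T a b), B.ar h ∈ q → a ∈ p := by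
  induction h with
  | nil a =>
    refine ⟨[B.vx a], .nil _, ?_, ?_⟩
    · intro b hb; simp at hb; simp [B.vx_inj hb]
    · intro b c h hb; simp at hb; cases hb
  | cons h1 h2 ih =>
    rename_i a b c p
    obtain ⟨q, g1, g2, g3⟩ := ih
    refine ⟨B.vx a :: B.ar (hT _ _ h1) :: q, .cons (B.va.2 rfl) (.cons (B.av.2 rfl) g1), ?_, ?_⟩
    · intro d hd
      simp only [List.mem_cons] at hd ⊢
      rcases hd with hd | hd | hd
      · exact Or.inl (B.vx_inj hd)
      · cases hd
      · exact Or.inr (g2 _ hd)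
    · intro d d' h hd
      simp only [List.mem_cons] at hd ⊢
      rcases hd with hd | hd | hd
      · cases hd
      · exact Or.inl (B.ar_inj hd).1
      · exact Or.inr (g3 _ _ _ hd)

theorem src_s {i e} (h : B.Gr.src e = (B.s i, false)) : e = B.vx (B.s i) := by
  rcases B.e_cases e with ⟨x, rfl⟩ | ⟨a, b, h', rfl⟩
  · simp [vx, Gr, nin] at h
    split_ifs at h with e
    · exact (B.s_sg h.symm).elim
    · rw [h]
  · simp [ar, Gr] at h
theorem dst_t {i e} (h : B.Gr.dst e = (B.t i, true)) : e = B.vx (B.t i) := by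
  rcases B.e_cases e with ⟨x, rfl⟩ | ⟨a, b, h', rfl⟩
  · simp [vx, Gr, nout] at h
    split_ifs at h with e
    · exact (B.t_tg h.symm).elim
    · rw [h]
  · simp [ar, Gr] at h
theorem src_sg {e} (h : B.Gr.src e = (B.sg false, false)) : ∃ b, e = B.vx (B.sg b) := by
  rcases B.e_cases e with ⟨x, rfl⟩ | ⟨a, b, h', rfl⟩
  · simp [vx, Gr, nin] at h
    by_cases e : x = B.sg true
    · exact ⟨true, by rw [e]⟩
    · exact ⟨false, by rw [h e]⟩
  · simp [ar, Gr] at h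
theorem dst_tg {e} (h : B.Gr.dst e = (B.tg false, true)) : ∃ b, e = B.vx (B.tg b) := by
  rcases B.e_cases e with ⟨x, rfl⟩ | ⟨a, b, h', rfl⟩
  · simp [vx, Gr, nout] at h
    by_cases e : x = B.tg true
    · exact ⟨true, by rw [e]⟩
    · exact ⟨false, by rw [h e]⟩
  · simp [ar, Gr] at h

theorem nin_s (i) : B.nin (B.s i) = B.s i := by simp [nin, B.s_sg]
theorem nout_t (i) : B.nout (B.t i) = B.t i := by simp [nout, B.t_tg]
theorem nin_sg (b) : B.nin (B.sg b) = B.sg false := by cases b <;> simp [nin]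
theorem nout_tg (b) : B.nout (B.tg b) = B.tg false := by cases b <;> simp [nout]

def Ess : Option J → B.X → B.X → Prop
  | some i, x, v => ∃ D : B.X → Prop, ¬ D (B.s i) ∧ D (B.t i) ∧ ∀ a b, B.T a b → ¬ D a → D b → a = x ∧ b = v
  | none, x, v => ∃ (D : B.X → Prop) (z : B.X), (∀ b, ¬ D (B.sg b)) ∧ (∀ b, D (B.tg b)) ∧
      ∀ a b, B.T a b → ¬ D a → D b → (a = x ∧ b = v) ∨ a = z

variable {k : ℕ} (e : Fin k ≃ J)

def ix : Option J → Fin (k + 1)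
  | some j => (e.symm j).castSucc
  | none => Fin.last k

theorem ix_inj {d d'} (h : ix e d = ix e d') : d = d' := by
  cases d <;> cases d' <;> simp [ix] at h ⊢
  · exact (Fin.castSucc_lt_last _).ne h.symm
  · exact h

def S : Fin (k + 1) → B.Gr.V := Fin.lastCases (motive := fun _ => B.X × Bool) (B.sg false, false) (fun i => (B.s (e i), false))
def Rr : Fin (k + 1) → B.Gr.V := Fin.lastCases (motive := fun _ => B.X × Bool) (B.tg false, true) (fun i => (B.t (e i), true))

theorem S_last : B.S e (Fin.last k) = (B.sg false, false) := by simp [S]; rfl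
theorem S_cs (i : Fin k) : B.S e i.castSucc = (B.s (e i), false) := by simp [S]; rfl
theorem Rr_last : B.Rr e (Fin.last k) = (B.tg false, true) := by simp [Rr]; rfl
theorem Rr_cs (i : Fin k) : B.Rr e i.castSucc = (B.t (e i), true) := by simp [Rr]; rfl

theorem S_inj : Function.Injective (B.S e) := by
  intro i j
  refine Fin.lastCases ?_ ?_ i <;> refine Fin.lastCases ?_ ?_ j
  · intro _; rfl
  · intro i h; rw [S_last, S_cs] at h; exact (B.s_sg (congrArg Prod.fst h).symm).elim
  · intro i h; rw [S_last, S_cs] at h; exact (B.s_sg (congrArg Prod.fst h)).elim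
  · intro i i' h; rw [S_cs, S_cs] at h
    rw [e.injective (B.s_inj (congrArg Prod.fst h))]
theorem Rr_inj : Function.Injective (B.Rr e) := by
  intro i j
  refine Fin.lastCases ?_ ?_ i <;> refine Fin.lastCases ?_ ?_ j
  · intro _; rfl
  · intro i h; rw [Rr_last, Rr_cs] at h; exact (B.t_tg (congrArg Prod.fst h).symm).elim
  · intro i h; rw [Rr_last, Rr_cs] at h; exact (B.t_tg (congrArg Prod.fst h)).elim
  · intro i i' h; rw [Rr_cs, Rr_cs] at h
    rw [e.injective (B.t_inj (congrArg Prod.fst h))]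

theorem cut1 (i : J) : B.Gr.MinCut (B.s i, false) (B.t i, true) 1 := by
  constructor
  · obtain ⟨p, hp⟩ := Wk.of_rtg (B.st i)
    obtain ⟨q, hq, _⟩ := B.expand (fun _ _ h => h) hp
    refine ⟨fun _ => q, fun _ => ?_, fun a b h => (h (Subsingleton.elim a b)).elim⟩
    have := wk_path hq
    have e1 : B.Gr.src (B.vx (B.s i)) = (B.s i, false) := by simp [vx, Gr, nin_s]
    have e2 : B.Gr.dst (B.vx (B.t i)) = (B.t i, true) := by simp [vx, Gr, nout_t]
    rwa [e1, e2] at this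
  · rintro ⟨α, h1, h2⟩
    have : ∀ a, B.vx (B.s i) ∈ α a := fun a => by
      obtain ⟨x, y, w, hx, _⟩ := path_wk (h1 a)
      rw [B.src_s hx] at w
      exact w.mem_head
    exact h2 0 1 (by decide) _ (this 0) (this 1)

theorem cut2 : B.Gr.MinCut (B.sg false, false) (B.tg false, true) 2 := by
  constructor
  · have : ∀ b, ∃ q, Wk B.R (B.vx (B.sg b)) (B.vx (B.tg b)) q ∧ (∀ a, B.vx a ∈ q → B.Q b a) ∧
        ∀ a d (h : B.T a d), B.ar h ∈ q → B.Q b a := by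
      intro b
      obtain ⟨p, hp⟩ := Wk.of_rtg (B.Q_path b)
      have hQ : ∀ x ∈ p, B.Q b x := fun x hx => by
        rcases (hp.from_head hx).cases_tail with h | ⟨_, _, h⟩
        · rw [h]; exact B.Q_sg b
        · exact h.2
      obtain ⟨q, hq, h1, h2⟩ := B.expand (fun _ _ h => h.1) hp
      exact ⟨q, hq, fun a ha => hQ _ (h1 a ha), fun a d h ha => hQ _ (h2 a d h ha)⟩
    choose q hq h1 h2 using this
    have hd : ∀ x, x ∈ q false → x ∉ q true := by
      intro x hx hy
      rcases B.e_cases x with ⟨a, rfl⟩ | ⟨a, b, h, rfl⟩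
      · exact B.Q_disj (h1 _ _ hx) (h1 _ _ hy)
      · exact B.Q_disj (h2 _ _ _ _ hx) (h2 _ _ _ _ hy)
    refine ⟨fun i => q (decide (i = 1)), fun i => ?_, ?_⟩
    · have := wk_path (hq (decide (i = 1)))
      have e1 : ∀ b, B.Gr.src (B.vx (B.sg b)) = (B.sg false, false) := fun b => by simp [vx, Gr, nin_sg]
      have e2 : ∀ b, B.Gr.dst (B.vx (B.tg b)) = (B.tg false, true) := fun b => by simp [vx, Gr, nout_tg]
      rwa [e1, e2] at this
    · intro i j hij x
      fin_cases i <;> fin_cases j <;> simp at hij ⊢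
      · exact hd x
      · exact fun h h' => hd x h' h
  · rintro ⟨α, h1, h2⟩
    have : ∀ a, ∃ b, B.vx (B.sg b) ∈ α a := fun a => by
      obtain ⟨x, y, w, hx, _⟩ := path_wk (h1 a)
      obtain ⟨b, rfl⟩ := B.src_sg hx
      exact ⟨b, w.mem_head⟩
    choose b hb using this
    obtain ⟨i, j, hij, hbb⟩ := Fintype.exists_ne_map_eq_of_card_lt b (by simp)
    exact h2 i j hij _ (hb i) (hbb ▸ hb j)

theorem inf2 {α : Type} {a b c : α} {l : List α} (h : [a, b, c] <:+: l) : [b, c] <:+: l :=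
  List.IsInfix.trans ⟨[a], [], rfl⟩ h

theorem ess_use {c : Fin (k + 1) → ℕ} (hc1 : ∀ i : Fin k, c i.castSucc = 1) (hc2 : c (Fin.last k) = 2)
    (α : (i : Fin (k + 1)) → Fin (c i) → List B.Gr.E)
    (hα : ∀ i, B.Gr.MengerSystem (B.S e i) (B.Rr e i) (c i) (α i)) {d x v} (h : B.Ess d x v) :
    ∃ (a : _) (h : B.T x v), [B.ar h, B.vx v] <:+: α (ix e d) a := by
  cases d with
  | some i =>
    obtain ⟨D, h1, h2, h3⟩ := h
    have := (hα (e.symm i).castSucc).1 ⟨0, by rw [hc1]; exact one_pos⟩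
    rw [S_cs, Rr_cs, e.apply_symm_apply] at this
    obtain ⟨a, b, w, ha, hb⟩ := path_wk this
    rw [B.src_s ha, B.dst_t hb] at w
    obtain ⟨a', b', h', g1, g2, g3⟩ := B.cross D _ w h1 h2
    obtain ⟨rfl, rfl⟩ := h3 _ _ h' g1 g2
    exact ⟨_, h', inf2 g3⟩
  | none =>
    obtain ⟨D, z, h1, h2, h3⟩ := h
    have key : ∀ a, ∃ x' v', ∃ h : B.T x' v', ((x' = x ∧ v' = v) ∨ x' = z) ∧ [B.vx x', B.ar h, B.vx v'] <:+: α (Fin.last k) a := by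
      intro a
      have := (hα (Fin.last k)).1 a
      rw [S_last, Rr_last] at this
      obtain ⟨a, b, w, ha, hb⟩ := path_wk this
      obtain ⟨b1, rfl⟩ := B.src_sg ha
      obtain ⟨b2, rfl⟩ := B.dst_tg hb
      obtain ⟨a', b', h', g1, g2, g3⟩ := B.cross D _ w (h1 _) (h2 _)
      exact ⟨a', b', h', h3 _ _ h' g1 g2, g3⟩
    let i0 : Fin (c (Fin.last k)) := ⟨0, by rw [hc2]; exact two_pos⟩
    let i1 : Fin (c (Fin.last k)) := ⟨1, by rw [hc2]; exact one_lt_two⟩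
    obtain ⟨x0, v0, t0, q0, r0⟩ := key i0
    obtain ⟨x1, v1, t1, q1, r1⟩ := key i1
    rcases q0 with ⟨rfl, rfl⟩ | rfl
    · exact ⟨i0, t0, inf2 r0⟩
    rcases q1 with ⟨rfl, rfl⟩ | rfl
    · exact ⟨i1, t1, inf2 r1⟩
    · exact ((hα (Fin.last k)).2 i0 i1 (by simp [i0, i1]) (B.vx x1) (r0.subset (by simp)) (r1.subset (by simp))).elim

theorem lower (e : Fin k ≃ J) {c : Fin (k + 1) → ℕ} (hc1 : ∀ i : Fin k, c i.castSucc = 1) (hc2 : c (Fin.last k) = 2)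
    {ι : Type} [Fintype ι] (mg : ι → B.X) (hmg : Function.Injective mg)
    (cert : ∀ n, ∃ d d' x y, d ≠ d' ∧ x ≠ y ∧ B.Ess d x (mg n) ∧ B.Ess d' y (mg n)) :
    MAtLeast c (Fintype.card ι) := by
  refine ⟨B.Gr, B.S e, B.Rr e, ⟨B.acyclic, B.Rr_inj e, ?_⟩, B.S_inj e, ?_⟩
  · intro i
    refine Fin.lastCases ?_ ?_ i
    · rw [S_last, Rr_last, hc2]; exact B.cut2
    · intro i; rw [S_cs, Rr_cs, hc1]; exact B.cut1 _
  · intro α hα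
    have := B.Gr.fintE
    rw [← Nat.card_eq_fintype_card, ← Set.ncard_univ]
    refine Set.ncard_le_ncard_of_injOn (fun n => B.vx (mg n)) ?_ ?_ (Set.toFinite _)
    · intro n _
      obtain ⟨d, d', x, y, hd, hxy, h1, h2⟩ := cert n
      obtain ⟨a, t1, g1⟩ := B.ess_use e hc1 hc2 α hα h1
      obtain ⟨b, t2, g2⟩ := B.ess_use e hc1 hc2 α hα h2
      exact ⟨ix e d, ix e d', fun h => hd (ix_inj e h), a, b, _, _, fun h => hxy (B.ar_inj h).1, g1, g2⟩
    · intro a _ b _ h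
      exact hmg (B.vx_inj h)
end Bld
end Wlk

namespace Wlk
namespace Chn
open Relation

inductive X (k : ℕ) : Type
  | s (m : Fin k)
  | a (m : Fin k)
  | b (m : Fin k)
  | U (m : Fin k)
  | sg (d : Bool)
  | tg (d : Bool)

inductive T (k : ℕ) : X k → X k → Prop
  | s0 (m : Fin k) : m.1 = 0 → T k (.s m) (.a m)
  | sU (m m' : Fin k) : m'.1 = m.1 + 1 → T k (.s m') (.U m)
  | Ua (m m' : Fin k) : m'.1 = m.1 + 1 → T k (.U m) (.a m')
  | ab (m : Fin k) : T k (.a m) (.b m)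
  | bU (m : Fin k) : T k (.b m) (.U m)
  | aa (m m' : Fin k) : m'.1 = m.1 + 1 → T k (.a m) (.a m')
  | bb (m m' : Fin k) : m'.1 = m.1 + 1 → T k (.b m) (.b m')
  | at' (m : Fin k) : m.1 + 1 = k → T k (.a m) (.tg false)
  | bt (m : Fin k) : m.1 + 1 = k → T k (.b m) (.tg true)
  | ga (m : Fin k) : m.1 = 0 → T k (.sg false) (.a m)
  | gb (m : Fin k) : m.1 = 0 → T k (.sg true) (.b m)

def Dd {k : ℕ} (fs fa fb fU : ℕ → Prop) (fsg ftg : Prop) : X k → Prop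
  | .s m => fs m.1
  | .a m => fa m.1
  | .b m => fb m.1
  | .U m => fU m.1
  | .sg _ => fsg
  | .tg _ => ftg

def rho {k : ℕ} : X k → ℕ
  | .s _ => 0
  | .a m => 4 * m.1 + 1
  | .b m => 4 * m.1 + 2
  | .U m => 4 * m.1 + 3
  | .sg _ => 0
  | .tg _ => 4 * k

def Q {k : ℕ} (d : Bool) : X k → Prop
  | .s _ => False
  | .a _ => d = false
  | .b _ => d = true
  | .U _ => False
  | .sg e => d = e
  | .tg e => d = e

theorem fin (k : ℕ) : Finite (X k) := by
  refine Finite.of_surjective (fun q : (Fin k ⊕ Fin k ⊕ Fin k ⊕ Fin k) ⊕ Bool ⊕ Bool => match q with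
    | .inl (.inl m) => X.s m
    | .inl (.inr (.inl m)) => X.a m
    | .inl (.inr (.inr (.inl m))) => X.b m
    | .inl (.inr (.inr (.inr m))) => X.U m
    | .inr (.inl d) => X.sg d
    | .inr (.inr d) => X.tg d) ?_
  rintro (m | m | m | m | m | m)
  · exact ⟨.inl (.inl m), rfl⟩
  · exact ⟨.inl (.inr (.inl m)), rfl⟩
  · exact ⟨.inl (.inr (.inr (.inl m))), rfl⟩
  · exact ⟨.inl (.inr (.inr (.inr m))), rfl⟩
  · exact ⟨.inr (.inl m), rfl⟩
  · exact ⟨.inr (.inr m), rfl⟩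

theorem up {k : ℕ} {R : X k → X k → Prop} {f : Fin k → X k} {x : X k} (h0 : ∀ m : Fin k, m.1 = 0 → ReflTransGen R x (f m))
    (h1 : ∀ m m' : Fin k, m'.1 = m.1 + 1 → R (f m) (f m')) : ∀ m : Fin k, ReflTransGen R x (f m) := by
  rintro ⟨m, hm⟩
  induction m with
  | zero => exact h0 _ rfl
  | succ n ih => exact (ih (by omega)).tail (h1 _ _ rfl)

noncomputable def B (k : ℕ) (hk : 0 < k) : Bld (Fin k) where
  X := X k
  fin := by
    have := fin k
    exact Fintype.ofFinite _
  T := T k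
  rho := rho
  s := .s
  t := .U
  sg := .sg
  tg := .tg
  Q := Q
  rk := by
    intro a b h
    cases h <;> simp only [rho] <;> omega
  T_sg := by intro a b h; cases h
  T_tg := by intro a b h; cases h
  s_inj := by intro i j h; cases h; rfl
  t_inj := by intro i j h; cases h; rfl
  s_sg := by intro i j h; cases h
  t_tg := by intro i j h; cases h
  st := by
    intro i
    have : ReflTransGen (T k) (.s i) (.a i) := by
      by_cases h : i.1 = 0
      · exact .single (.s0 _ h)
      · exact .head (.sU ⟨i.1 - 1, by omega⟩ i (by simp; omega)) (.single (.Ua _ _ (by simp; omega)))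
    exact (this.tail (.ab i)).tail (.bU i)
  Q_sg := by intro b; simp [Q]
  Q_path := by
    intro b
    cases b with
    | false =>
      refine ReflTransGen.tail (up (f := .a) ?_ ?_ ⟨k - 1, by omega⟩) ?_
      · intro m h; exact .single ⟨.ga _ h, rfl⟩
      · intro m m' h; exact ⟨.aa _ _ h, rfl⟩
      · exact ⟨.at' _ (by simp; omega), rfl⟩
    | true =>
      refine ReflTransGen.tail (up (f := .b) ?_ ?_ ⟨k - 1, by omega⟩) ?_
      · intro m h; exact .single ⟨.gb _ h, rfl⟩
      · intro m m' h; exact ⟨.bb _ _ h, rfl⟩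
      · exact ⟨.bt _ (by simp; omega), rfl⟩
  Q_disj := by
    intro x h
    cases x <;> simp_all [Q]

variable {k : ℕ} (hk : 0 < k)

theorem e1 {i : Fin k} {x v : X k} (D : X k → Prop) (h1 : ¬ D (.s i)) (h2 : D (.U i))
    (h3 : ∀ a b, T k a b → ¬ D a → D b → a = x ∧ b = v) : (B k hk).Ess (some i) x v := ⟨D, h1, h2, h3⟩
theorem e2 {x v : X k} (D : X k → Prop) (z : X k) (h1 : ∀ b, ¬ D (.sg b)) (h2 : ∀ b, D (.tg b))
    (h3 : ∀ a b, T k a b → ¬ D a → D b → (a = x ∧ b = v) ∨ a = z) : (B k hk).Ess none x v := ⟨D, z, h1, h2, h3⟩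

theorem fa (m : Fin k) : ∃ d d' x y, d ≠ d' ∧ x ≠ y ∧ (B k hk).Ess d x (.a m : X k) ∧ (B k hk).Ess d' y (.a m : X k) := by
  by_cases h : m.1 = 0
  · refine ⟨some m, none, (.s m : X k), (.sg false : X k), by simp, nofun, ?_, ?_⟩
    · refine e1 hk (Dd (fun j => j ≠ m) (fun _ => True) (fun _ => True) (fun _ => True) True True) (by simp [Dd]) (by simp [Dd]) ?_
      intro a b hT
      cases hT <;> simp [Dd, Fin.ext_iff] <;> omega
    · refine e2 hk (Dd (fun j => True) (fun _ => True) (fun _ => True) (fun _ => True) False True) (.sg true) (by simp [Dd]) (by simp [Dd]) ?_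
      intro a b hT
      cases hT <;> simp [Dd, Fin.ext_iff] <;> omega
  · have hm := m.2
    obtain ⟨n, hn⟩ : ∃ n : Fin k, m.1 = n.1 + 1 := ⟨⟨m.1 - 1, by omega⟩, by simp; omega⟩
    refine ⟨some m, none, (.U n : X k), (.a n : X k), by simp, nofun, ?_, ?_⟩
    · refine e1 hk (Dd (fun j => j ≠ m) (fun _ => True) (fun _ => True) (fun j => j ≠ n) True True) (by simp [Dd]) (by simp [Dd]; omega) ?_
      intro a b hT
      cases hT <;> simp [Dd, Fin.ext_iff] <;> omega
    · refine e2 hk (Dd (fun j => True) (fun j => m ≤ j) (fun j => m ≤ j) (fun j => n ≤ j) False True) (.b n) (by simp [Dd]) (by simp [Dd]) ?_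
      intro a b hT
      cases hT <;> simp [Dd, Fin.ext_iff] <;> omega

theorem fb (m : Fin k) : ∃ d d' x y, d ≠ d' ∧ x ≠ y ∧ (B k hk).Ess d x (.b m : X k) ∧ (B k hk).Ess d' y (.b m : X k) := by
  have h0 : (B k hk).Ess (some m) (.a m : X k) (.b m : X k) := by
    refine e1 hk (Dd (fun j => j ≠ m) (fun j => j < m) (fun j => j ≤ m) (fun j => j + 1 ≠ m ∧ j ≤ m) True False) (by simp [Dd]) (by simp [Dd]) ?_
    intro a b hT
    cases hT <;> simp [Dd, Fin.ext_iff] <;> omega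
  by_cases h : m.1 = 0
  · refine ⟨some m, none, (.a m : X k), (.sg true : X k), by simp, nofun, h0, ?_⟩
    refine e2 hk (Dd (fun j => True) (fun j => m < j) (fun j => m ≤ j) (fun j => m ≤ j) False True) (.a m) (by simp [Dd]) (by simp [Dd]) ?_
    intro a b hT
    cases hT <;> simp [Dd, Fin.ext_iff] <;> omega
  · have hm := m.2
    obtain ⟨n, hn⟩ : ∃ n : Fin k, m.1 = n.1 + 1 := ⟨⟨m.1 - 1, by omega⟩, by simp; omega⟩
    refine ⟨some m, none, (.a m : X k), (.b n : X k), by simp, nofun, h0, ?_⟩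
    refine e2 hk (Dd (fun j => True) (fun j => m < j) (fun j => m ≤ j) (fun j => m ≤ j) False True) (.a m) (by simp [Dd]) (by simp [Dd]) ?_
    intro a b hT
    cases hT <;> simp [Dd, Fin.ext_iff] <;> omega

theorem fU (m : Fin k) (h : m.1 + 1 < k) : ∃ d d' x y, d ≠ d' ∧ x ≠ y ∧ (B k hk).Ess d x (.U m : X k) ∧ (B k hk).Ess d' y (.U m : X k) := by
  obtain ⟨n, hn⟩ : ∃ n : Fin k, n.1 = m.1 + 1 := ⟨⟨m.1 + 1, h⟩, rfl⟩
  refine ⟨some m, some n, (.b m : X k), (.s n : X k), by simp [Fin.ext_iff]; omega, nofun, ?_, ?_⟩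
  · refine e1 hk (Dd (fun j => j = n) (fun j => False) (fun j => False) (fun j => j = m) False False) (by simp [Dd]; omega) (by simp [Dd]) ?_
    intro a b hT
    cases hT <;> simp [Dd, Fin.ext_iff] <;> omega
  · refine e1 hk (Dd (fun j => j ≠ n) (fun j => True) (fun j => True) (fun j => True) True True) (by simp [Dd]) (by simp [Dd]) ?_
    intro a b hT
    cases hT <;> simp [Dd, Fin.ext_iff] <;> omega

def mg : Fin k ⊕ Fin k ⊕ Fin (k - 1) → X k
  | .inl m => .a m
  | .inr (.inl m) => .b m
  | .inr (.inr m) => .U ⟨m.1, by omega⟩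

theorem mg_inj : Function.Injective (mg hk) := by
  rintro (m | m | m) (n | n | n) h <;> simp_all [mg, Fin.ext_iff]

theorem low (hk : 0 < k) (c : Fin (k + 1) → ℕ) (hc1 : ∀ i : Fin k, c i.castSucc = 1) (hc2 : c (Fin.last k) = 2) :
    MAtLeast c (3 * k - 1) := by
  have := (B k hk).lower (Equiv.refl _) hc1 hc2 (ι := Fin k ⊕ Fin k ⊕ Fin (k - 1)) (mg hk) ?_ ?_
  · simp at this
    have e : 3 * k - 1 = k + (k + (k - 1)) := by omega
    rwa [e]
  · exact mg_inj hk
  · rintro (m | m | m)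
    · exact fa hk m
    · exact fb hk m
    · exact fU hk ⟨m.1, by omega⟩ (by simp; omega)
end Chn
end Wlk

namespace Wlk
namespace Grd
open Relation

inductive X (p q : ℕ) : Type
  | sr (r : Fin p)
  | sc (c : Fin q)
  | u (r : Fin p) (c : Fin q)
  | b (r : Fin p)
  | a (c : Fin q)
  | ai
  | bs
  | sg (d : Bool)
  | tg (d : Bool)

inductive T (p q : ℕ) : X p q → X p q → Prop
  | t1 (r : Fin p) : r.1 = 0 → T p q (.sr r) .ai
  | t2 (r : Fin p) : r.1 = 0 → T p q .ai (.b r)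
  | t3 (r : Fin p) : 0 < r.1 → T p q (.sr r) (.b r)
  | t4 (r : Fin p) (c : Fin q) : c.1 = 0 → T p q (.b r) (.u r c)
  | t5 (r : Fin p) (c c' : Fin q) : c'.1 = c.1 + 1 → T p q (.u r c) (.u r c')
  | t6 (r : Fin p) (c : Fin q) : r.1 = 0 → T p q (.sc c) (.u r c)
  | t7 (r r' : Fin p) (c : Fin q) : r'.1 = r.1 + 1 → T p q (.u r c) (.u r' c)
  | t8 (r : Fin p) (c : Fin q) : r.1 + 1 = p → T p q (.u r c) (.a c)
  | t9 (c : Fin q) : c.1 + 1 = q → T p q (.a c) .bs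
  | t10 : T p q (.sg false) .ai
  | t11 (c : Fin q) : c.1 = 0 → T p q .ai (.a c)
  | t12 (c c' : Fin q) : c'.1 = c.1 + 1 → T p q (.a c) (.a c')
  | t13 (c : Fin q) : c.1 + 1 = q → T p q (.a c) (.tg false)
  | t14 (r : Fin p) : r.1 = 0 → T p q (.sg true) (.b r)
  | t15 (r r' : Fin p) : r'.1 = r.1 + 1 → T p q (.b r) (.b r')
  | t16 (r : Fin p) : r.1 + 1 = p → T p q (.b r) .bs
  | t17 : T p q .bs (.tg true)

def Dd {p q : ℕ} (fsr fsc : ℕ → Prop) (fu : ℕ → ℕ → Prop) (fb fa : ℕ → Prop) (fai fbs fsg ftg : Prop) : X p q → Prop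
  | .sr m => fsr m.1
  | .sc m => fsc m.1
  | .u r c => fu r.1 c.1
  | .b m => fb m.1
  | .a m => fa m.1
  | .ai => fai
  | .bs => fbs
  | .sg _ => fsg
  | .tg _ => ftg

def rho {p q : ℕ} : X p q → ℕ
  | .sr _ => 0
  | .sc _ => 0
  | .u r c => p + 2 + r.1 + c.1
  | .b m => 2 + m.1
  | .a m => 2 * p + q + 2 + m.1
  | .ai => 1
  | .bs => 2 * p + 2 * q + 3
  | .sg _ => 0
  | .tg _ => 2 * p + 2 * q + 4

def Q {p q : ℕ} (d : Bool) : X p q → Prop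
  | .sr _ => False
  | .sc _ => False
  | .u _ _ => False
  | .b _ => d = true
  | .a _ => d = false
  | .ai => d = false
  | .bs => d = true
  | .sg e => d = e
  | .tg e => d = e

theorem fin (p q : ℕ) : Finite (X p q) := by
  refine Finite.of_surjective (fun w : ((Fin p ⊕ Fin q) ⊕ (Fin p × Fin q)) ⊕ (Fin p ⊕ Fin q) ⊕ (Bool ⊕ Bool ⊕ Bool) => match w with
    | .inl (.inl (.inl m)) => X.sr m
    | .inl (.inl (.inr m)) => X.sc m
    | .inl (.inr m) => X.u m.1 m.2
    | .inr (.inl (.inl m)) => X.b m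
    | .inr (.inl (.inr m)) => X.a m
    | .inr (.inr (.inl d)) => if d then X.ai else X.bs
    | .inr (.inr (.inr (.inl d))) => X.sg d
    | .inr (.inr (.inr (.inr d))) => X.tg d) ?_
  rintro (m | m | ⟨m, n⟩ | m | m | _ | _ | m | m)
  · exact ⟨.inl (.inl (.inl m)), rfl⟩
  · exact ⟨.inl (.inl (.inr m)), rfl⟩
  · exact ⟨.inl (.inr (m, n)), rfl⟩
  · exact ⟨.inr (.inl (.inl m)), rfl⟩
  · exact ⟨.inr (.inl (.inr m)), rfl⟩
  · exact ⟨.inr (.inr (.inl true)), rfl⟩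
  · exact ⟨.inr (.inr (.inl false)), rfl⟩
  · exact ⟨.inr (.inr (.inr (.inl m))), rfl⟩
  · exact ⟨.inr (.inr (.inr (.inr m))), rfl⟩

theorem up {k : ℕ} {Y : Type} {R : Y → Y → Prop} {f : Fin k → Y} {x : Y} (h0 : ∀ m : Fin k, m.1 = 0 → ReflTransGen R x (f m))
    (h1 : ∀ m m' : Fin k, m'.1 = m.1 + 1 → R (f m) (f m')) : ∀ m : Fin k, ReflTransGen R x (f m) := by
  rintro ⟨m, hm⟩
  induction m with
  | zero => exact h0 _ rfl
  | succ n ih => exact (ih (by omega)).tail (h1 _ _ rfl)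

variable {p q : ℕ}

def tt (hq : 0 < q) : Fin p ⊕ Fin q → X p q
  | .inl r => .u r ⟨q - 1, by omega⟩
  | .inr c => if c.1 + 1 = q then .bs else .a c

noncomputable def B (hp : 0 < p) (hq : 0 < q) : Bld (Fin p ⊕ Fin q) where
  X := X p q
  fin := by
    have := fin p q
    exact Fintype.ofFinite _
  T := T p q
  rho := rho
  s := Sum.elim .sr .sc
  t := tt hq
  sg := .sg
  tg := .tg
  Q := Q
  rk := by
    intro a b h
    cases h <;> simp only [rho] <;> omega
  T_sg := by intro a b h; cases h
  T_tg := by intro a b h; cases h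
  s_inj := by rintro (i | i) (j | j) h <;> cases h <;> rfl
  t_inj := by
    rintro (i | i) (j | j) h <;> simp only [tt] at h
    · cases h; rfl
    · split_ifs at h
    · split_ifs at h
    · split_ifs at h
      · congr 1; ext; omega
      · cases h; rfl
  s_sg := by rintro (i | i) j h <;> cases h
  t_tg := by
    rintro (i | i) j h <;> simp only [tt] at h
    · cases h
    · split_ifs at h
  st := by
    rintro (i | i)
    · have : ReflTransGen (T p q) (.sr i) (.b i) := by
        by_cases h : i.1 = 0
        · exact .head (.t1 _ h) (.single (.t2 _ h))
        · exact .single (.t3 _ (by omega))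
      exact up (f := fun c => X.u i c) (fun c hc => this.tail (.t4 _ _ hc)) (fun c c' h => .t5 _ _ _ h) ⟨q - 1, by omega⟩
    · have : ReflTransGen (T p q) (.sc i) (.a i) := by
        refine ReflTransGen.tail (up (f := fun r => X.u r i) (fun r hr => .single (.t6 _ _ hr)) (fun c c' h => .t7 _ _ _ h) ⟨p - 1, by omega⟩) ?_
        exact .t8 _ _ (by simp; omega)
      simp only [tt, Sum.elim_inr]
      split_ifs with h
      · exact this.tail (.t9 _ h)
      · exact this
  Q_sg := by intro b; simp [Q]
  Q_path := by
    intro b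
    cases b with
    | false =>
      refine ReflTransGen.tail (up (f := X.a) ?_ ?_ ⟨q - 1, by omega⟩) ?_
      · intro m h; exact .tail (b := X.ai) (.single ⟨.t10, rfl⟩) ⟨.t11 _ h, rfl⟩
      · intro m m' h; exact ⟨.t12 _ _ h, rfl⟩
      · exact ⟨.t13 _ (by simp; omega), rfl⟩
    | true =>
      refine ReflTransGen.tail (b := X.bs) (ReflTransGen.tail (up (f := (X.b : Fin p → X p q)) ?_ ?_ ⟨p - 1, by omega⟩) ?_) ?_
      · intro m h; exact .single ⟨.t14 _ h, rfl⟩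
      · intro m m' h; exact ⟨.t15 _ _ h, rfl⟩
      · exact ⟨.t16 _ (by simp; omega), rfl⟩
      · exact ⟨.t17, rfl⟩
  Q_disj := by
    intro x h
    cases x <;> simp_all [Q]

variable (hp : 0 < p) (hq : 0 < q)

theorem e1 {i : Fin p ⊕ Fin q} {x v : X p q} (D : X p q → Prop) (h1 : ¬ D (Sum.elim X.sr X.sc i)) (h2 : D (tt hq i))
    (h3 : ∀ a b, T p q a b → ¬ D a → D b → a = x ∧ b = v) : (B hp hq).Ess (some i) x v := ⟨D, h1, h2, h3⟩
theorem e2 {x v : X p q} (D : X p q → Prop) (z : X p q) (h1 : ∀ b, ¬ D (.sg b)) (h2 : ∀ b, D (.tg b))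
    (h3 : ∀ a b, T p q a b → ¬ D a → D b → (a = x ∧ b = v) ∨ a = z) : (B hp hq).Ess none x v := ⟨D, z, h1, h2, h3⟩

def Cert (v : X p q) : Prop :=
  ∃ d d' x y, d ≠ d' ∧ x ≠ y ∧ (B hp hq).Ess d x v ∧ (B hp hq).Ess d' y v

theorem mk {d d'} {x y v : X p q} (h1 : (B hp hq).Ess d x v) (h2 : (B hp hq).Ess d' y v) (hd : d ≠ d') (hxy : x ≠ y) :
    Cert hp hq v := ⟨d, d', x, y, hd, hxy, h1, h2⟩

def Drow (r c : ℕ) : X p q → Prop :=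
  Dd (fun j => j < r) (fun _ => True) (fun i j => i < r ∨ (i = r ∧ c ≤ j)) (fun j => j < r) (fun _ => False) (0 < r) False True False
def Dcol (q : ℕ) (r c : ℕ) : X p q → Prop :=
  Dd (fun _ => True) (fun j => j < c) (fun i j => j < c ∨ (j = c ∧ r ≤ i)) (fun _ => True) (fun j => j ≤ c) True (c + 1 = q) True False

theorem row0 (r : Fin p) (c : Fin q) (h : c.1 = 0) : (B hp hq).Ess (some (.inl r)) (.b r : X p q) (.u r c : X p q) := by
  refine e1 hp hq (Drow r c) (by simp [Drow, Dd]) (by simp [Drow, Dd, tt]; omega) ?_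
  intro a b hT
  cases hT <;> simp [Drow, Dd, Fin.ext_iff] <;> omega
theorem row1 (r : Fin p) (c c' : Fin q) (h : c.1 = c'.1 + 1) : (B hp hq).Ess (some (.inl r)) (.u r c' : X p q) (.u r c : X p q) := by
  refine e1 hp hq (Drow r c) (by simp [Drow, Dd]) (by simp [Drow, Dd, tt]; omega) ?_
  intro a b hT
  cases hT <;> simp [Drow, Dd, Fin.ext_iff] <;> omega

theorem dcol_t (r : ℕ) (c : Fin q) : Dcol q r c (tt (p := p) hq (.inr c)) := by
  simp only [tt]
  split_ifs with h
  · simp [Dcol, Dd, h]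
  · simp [Dcol, Dd]
theorem col0 (r : Fin p) (c : Fin q) (h : r.1 = 0) : (B hp hq).Ess (some (.inr c)) (.sc c : X p q) (.u r c : X p q) := by
  refine e1 hp hq (Dcol q r c) (by simp [Dcol, Dd]) (dcol_t hq _ _) ?_
  intro a b hT
  cases hT <;> simp [Dcol, Dd, Fin.ext_iff] <;> omega
theorem col1 (r r' : Fin p) (c : Fin q) (h : r.1 = r'.1 + 1) : (B hp hq).Ess (some (.inr c)) (.u r' c : X p q) (.u r c : X p q) := by
  refine e1 hp hq (Dcol q r c) (by simp [Dcol, Dd]) (dcol_t hq _ _) ?_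
  intro a b hT
  cases hT <;> simp [Dcol, Dd, Fin.ext_iff] <;> omega
theorem col2 (r : Fin p) (c : Fin q) (h : r.1 + 1 = p) : (B hp hq).Ess (some (.inr c)) (.u r c : X p q) (.a c : X p q) := by
  refine e1 hp hq (Dcol q p c) (by simp [Dcol, Dd]) (dcol_t hq _ _) ?_
  intro a b hT
  cases hT <;> simp [Dcol, Dd, Fin.ext_iff] <;> omega

theorem prd {n : ℕ} (m : Fin n) : m.1 = 0 ∨ ∃ m' : Fin n, m.1 = m'.1 + 1 := by
  by_cases h : m.1 = 0
  · exact Or.inl h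
  · exact Or.inr ⟨⟨m.1 - 1, by omega⟩, by simp; omega⟩

theorem fu (r : Fin p) (c : Fin q) : Cert hp hq (.u r c) := by
  rcases prd r with hr | ⟨r', hr⟩ <;> rcases prd c with hc | ⟨c', hc⟩
  · exact mk hp hq (row0 hp hq r c hc) (col0 hp hq r c hr) (by simp) nofun
  · exact mk hp hq (row1 hp hq r c c' hc) (col0 hp hq r c hr) (by simp) nofun
  · exact mk hp hq (row0 hp hq r c hc) (col1 hp hq r r' c hr) (by simp) nofun
  · refine mk hp hq (row1 hp hq r c c' hc) (col1 hp hq r r' c hr) (by simp) ?_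
    intro h; cases h; omega

theorem fa (c : Fin q) : Cert hp hq (.a c) := by
  have h0 := col2 hp hq ⟨p - 1, by omega⟩ c (by simp; omega)
  have h1 : ∀ x : X p q, (c.1 = 0 → x = .ai) → (∀ c' : Fin q, c.1 = c'.1 + 1 → x = .a c') → (B hp hq).Ess none x (.a c : X p q) := by
    intro x hx1 hx2
    refine e2 hp hq (Dd (fun _ => True) (fun _ => True) (fun _ _ => True) (fun j => j ≠ 0) (fun j => c ≤ j) False True False True) (.b ⟨0, hp⟩) (by simp [Dd]) (by simp [Dd]) ?_
    intro a b hT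
    cases hT <;> simp [Dd, Fin.ext_iff] <;> try omega
    · intro h
      exact ⟨(hx1 (by omega)).symm, by omega⟩
    · intro h h'
      exact ⟨(hx2 _ (by omega)).symm, by omega⟩
  rcases prd c with hc | ⟨c', hc⟩
  · exact mk hp hq h0 (h1 .ai (fun _ => rfl) (by omega)) (by simp) nofun
  · refine mk hp hq h0 (h1 (.a c') (by omega) (fun c'' h => ?_)) (by simp) nofun
    congr 1; ext; omega

theorem fb (r : Fin p) : Cert hp hq (.b r) := by
  rcases prd r with hr | ⟨r', hr⟩
  · refine ⟨some (.inl r), none, (.ai : X p q), (.sg true : X p q), by simp, nofun, ?_, ?_⟩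
    · refine e1 hp hq (Dd (fun j => j ≠ 0) (fun _ => True) (fun _ _ => True) (fun _ => True) (fun _ => False) False False True False) (by simp [Dd, hr]) (by simp [Dd, tt]) ?_
      intro a b hT
      cases hT <;> simp [Dd, Fin.ext_iff] <;> omega
    · refine e2 hp hq (Dd (fun _ => True) (fun _ => True) (fun _ _ => True) (fun _ => True) (fun _ => True) False True False True) .ai (by simp [Dd]) (by simp [Dd]) ?_
      intro a b hT
      cases hT <;> simp [Dd, Fin.ext_iff] <;> omega
  · refine ⟨some (.inl r), none, (.sr r : X p q), (.b r' : X p q), by simp, nofun, ?_, ?_⟩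
    · refine e1 hp hq (Dd (fun j => j ≠ r) (fun _ => True) (fun _ _ => True) (fun _ => True) (fun _ => True) True True True True) (by simp [Dd]) (by simp [Dd, tt]) ?_
      intro a b hT
      cases hT <;> simp [Dd, Fin.ext_iff] <;> omega
    · refine e2 hp hq (Dd (fun j => r ≤ j) (fun _ => False) (fun _ _ => False) (fun j => r ≤ j) (fun _ => False) False True False True) (.a ⟨q - 1, by omega⟩) (by simp [Dd]) (by simp [Dd]) ?_
      intro a b hT
      cases hT <;> simp [Dd, Fin.ext_iff] <;> omega

theorem fai : Cert hp hq .ai := by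
  refine ⟨some (.inl ⟨0, hp⟩), none, (.sr ⟨0, hp⟩ : X p q), (.sg false : X p q), by simp, nofun, ?_, ?_⟩
  · refine e1 hp hq (Dd (fun j => j ≠ 0) (fun _ => True) (fun _ _ => True) (fun _ => True) (fun _ => True) True True True True) (by simp [Dd]) (by simp [Dd, tt]) ?_
    intro a b hT
    cases hT <;> simp [Dd, Fin.ext_iff] <;> omega
  · refine e2 hp hq (Dd (fun _ => True) (fun _ => True) (fun _ _ => True) (fun _ => True) (fun _ => True) True True False True) (.sg true) (by simp [Dd]) (by simp [Dd]) ?_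
    intro a b hT
    cases hT <;> simp [Dd]

theorem fbs : Cert hp hq .bs := by
  refine ⟨some (.inr ⟨q - 1, by omega⟩), none, (.a ⟨q - 1, by omega⟩ : X p q), (.b ⟨p - 1, by omega⟩ : X p q), by simp, nofun, ?_, ?_⟩
  · refine e1 hp hq (Dd (fun _ => True) (fun _ => False) (fun _ _ => False) (fun _ => True) (fun _ => False) True True True False) (by simp [Dd]) ?_ ?_
    · have : q - 1 + 1 = q := by omega
      simp [tt, Dd, this]
    intro a b hT
    cases hT <;> simp [Dd, Fin.ext_iff] <;> omega
  · refine e2 hp hq (Dd (fun _ => False) (fun _ => False) (fun _ _ => False) (fun _ => False) (fun _ => False) False True False True) (.a ⟨q - 1, by omega⟩) (by simp [Dd]) (by simp [Dd]) ?_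
    intro a b hT
    cases hT <;> simp [Dd, Fin.ext_iff] <;> omega

def mg : (Fin p × Fin q) ⊕ Fin p ⊕ Fin q ⊕ Bool → X p q
  | .inl w => .u w.1 w.2
  | .inr (.inl m) => .b m
  | .inr (.inr (.inl m)) => .a m
  | .inr (.inr (.inr true)) => .ai
  | .inr (.inr (.inr false)) => .bs

theorem mg_inj : Function.Injective (mg (p := p) (q := q)) := by
  rintro (⟨m, n⟩ | m | m | _ | _) (⟨m', n'⟩ | m' | m' | _ | _) h <;> simp_all [mg]

theorem low (hp : 0 < p) (hq : 0 < q) (c : Fin (p + q + 1) → ℕ) (hc1 : ∀ i : Fin (p + q), c i.castSucc = 1) (hc2 : c (Fin.last (p + q)) = 2) :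
    MAtLeast c (p * q + (p + (q + 2))) := by
  have := (B hp hq).lower finSumFinEquiv.symm hc1 hc2 (ι := (Fin p × Fin q) ⊕ Fin p ⊕ Fin q ⊕ Bool) mg mg_inj ?_
  · simpa using this
  · rintro (⟨m, n⟩ | m | m | _ | _)
    · exact fu hp hq m n
    · exact fb hp hq m
    · exact fa hp hq m
    · exact fbs hp hq
    · exact fai hp hq
end Grd
end Wlk


theorem Bd_small (k : ℕ) (hk : 0 < k) (h : k ≤ 6) : Bd k = 3 * k - 1 := by
  interval_cases k <;> rfl

theorem Bd_large (k : ℕ) (h : 6 < k) : Bd k = k ^ 2 / 4 + k + 2 := by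
  obtain ⟨n, rfl⟩ : ∃ n, k = n + 2 := ⟨k - 2, by omega⟩
  rw [Bd]
  apply max_eq_right
  have h2 : 2 * (n + 2) - 3 ≤ (n + 2) ^ 2 / 4 := by
    rw [Nat.le_div_iff_mul_le (by norm_num)]
    obtain ⟨m, rfl⟩ : ∃ m, n = m + 5 := ⟨n - 5, by omega⟩
    have e : 2 * (m + 5 + 2) - 3 = 2 * m + 11 := by omega
    rw [e]
    nlinarith
  omega

theorem half_mul (k : ℕ) : k / 2 * (k - k / 2) = k ^ 2 / 4 := by
  obtain ⟨n, rfl | rfl⟩ := k.even_or_odd'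
  · have h1 : 2 * n / 2 = n := by omega
    have h2 : 2 * n - n = n := by omega
    have h3 : (2 * n) ^ 2 = n * n * 4 := by ring
    rw [h1, h2, h3, Nat.mul_div_cancel _ (by norm_num)]
  · have h1 : (2 * n + 1) / 2 = n := by omega
    have h2 : 2 * n + 1 - n = n + 1 := by omega
    have h3 : (2 * n + 1) ^ 2 = 1 + 4 * (n * (n + 1)) := by ring
    rw [h1, h2, h3, Nat.add_mul_div_left _ _ (by norm_num)]
    simp

theorem low_large (k p q : ℕ) (hp : 0 < p) (hq : 0 < q) (h : k = p + q) (c : Fin (k + 1) → ℕ)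
    (hc1 : ∀ i : Fin k, c i.castSucc = 1) (hc2 : c (Fin.last k) = 2) : MAtLeast c (p * q + k + 2) := by
  subst h
  have := Wlk.Grd.low hp hq c hc1 hc2
  have e : p * q + (p + q) + 2 = p * q + (p + (q + 2)) := by ring
  rwa [e]

/-- For every positive integer `k`, `M(1, …, 1, 2)` (with `k` ones)
equals `3k − 1` if `k ≤ 6`, and `⌊k² / 4⌋ + k + 2` if `k > 6`. -/
theorem M_ones_two (k : ℕ) (hk : 0 < k) :
    (k ≤ 6 → MEq (Fin.snoc (fun _ : Fin k => 1) 2) (3 * k - 1)) ∧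
      (6 < k → MEq (Fin.snoc (fun _ : Fin k => 1) 2) (k ^ 2 / 4 + k + 2)) := by
  have hc1 : ∀ i : Fin k, (Fin.snoc (fun _ : Fin k => 1) 2 : Fin (k + 1) → ℕ) i.castSucc = 1 := by
    intro i; simp
  have hc2 : (Fin.snoc (fun _ : Fin k => 1) 2 : Fin (k + 1) → ℕ) (Fin.last k) = 2 := by simp
  have hu := Wlk.upper k hk _ hc1 hc2
  refine ⟨fun h => ⟨?_, ?_⟩, fun h => ⟨?_, ?_⟩⟩
  · rw [← Bd_small k hk h]; exact hu
  · exact Wlk.Chn.low hk _ hc1 hc2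
  · rw [← Bd_large k h]; exact hu
  · rw [← half_mul k]
    exact low_large k (k / 2) (k - k / 2) (by omega) (by omega) (by omega) _ hc1 hc2
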